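/- Let n ≥ 1, let Ω ⊆ ℝⁿ be a bounded convex open set with smooth boundary, T > 0, M > 0, λ > 0, x₀ ∈ Ω, and let u be a classical solution of the parabolic differential inequality |∂_t u − Δu| ≤ M(|∇u| + |u|) on Ω × (0,T] vanishing on ∂Ω, two times continuously differentiable in x and once in t up to the closure. Define H_λ(t) = ∫_Ω |u(x,t)|² G_λ(x,t) dx, D_λ(t) = ∫_Ω |∇u(x,t)|² G_λ(x,t) dx, and N_λ(t) = 2 D_λ(t)/H_λ(t), and assume H_λ(t) > 0 for all t ∈ (0,T). Then there exists a constant C > 0, depending only on the dimension n, such that for every t ∈ (0,T): N_λ'(t) − (1/(T−t+λ) + C M²) N_λ(t) ≤ C M². -/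

import Mathlib

open MeasureTheory Real

/-- The Laplacian in the spatial variable: sum of second partial derivatives. -/
noncomputable def lap {n : ℕ} (f : EuclideanSpace ℝ (Fin n) → ℝ) (x : EuclideanSpace ℝ (Fin n)) : ℝ :=
  ∑ i : Fin n, fderiv ℝ (fun y => fderiv ℝ f y (EuclideanSpace.single i 1)) x (EuclideanSpace.single i 1)

/-- The caloric weight `G_λ(x,t) = (T−t+λ)^{−n/2} exp(−|x−x₀|²/(4(T−t+λ)))`. -/
noncomputable def caloric {n : ℕ} (T lam : ℝ) (x₀ : EuclideanSpace ℝ (Fin n))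
    (x : EuclideanSpace ℝ (Fin n)) (t : ℝ) : ℝ :=
  (T - t + lam) ^ (-(n : ℝ)/2) * Real.exp (-‖x - x₀‖^2 / (4 * (T - t + lam)))

/-- `H_λ(t) = ∫_Ω u(x,t)² G_λ(x,t) dx`. -/
noncomputable def Hfun {n : ℕ} (Ω : Set (EuclideanSpace ℝ (Fin n))) (T lam : ℝ)
    (x₀ : EuclideanSpace ℝ (Fin n)) (u : EuclideanSpace ℝ (Fin n) → ℝ → ℝ) (t : ℝ) : ℝ :=
  ∫ x in Ω, (u x t)^2 * caloric T lam x₀ x t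

/-- `D_λ(t) = ∫_Ω |∇u(x,t)|² G_λ(x,t) dx`. -/
noncomputable def Dfun {n : ℕ} (Ω : Set (EuclideanSpace ℝ (Fin n))) (T lam : ℝ)
    (x₀ : EuclideanSpace ℝ (Fin n)) (u : EuclideanSpace ℝ (Fin n) → ℝ → ℝ) (t : ℝ) : ℝ :=
  ∫ x in Ω, ‖gradient (fun y => u y t) x‖^2 * caloric T lam x₀ x t

/-- The frequency function `N_λ(t) = 2 D_λ(t) / H_λ(t)`. -/
noncomputable def Nfun {n : ℕ} (Ω : Set (EuclideanSpace ℝ (Fin n))) (T lam : ℝ)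
    (x₀ : EuclideanSpace ℝ (Fin n)) (u : EuclideanSpace ℝ (Fin n) → ℝ → ℝ) (t : ℝ) : ℝ :=
  2 * Dfun Ω T lam x₀ u t / Hfun Ω T lam x₀ u t

section Evolution

open Set Filter Topology
open scoped RealInnerProductSpace

variable {F : Type*} [NormedAddCommGroup F] [InnerProductSpace ℝ F]

/-- One-sided mean value inequality, with right derivatives in the open interval only. -/
theorem sub_le_of_right_deriv_le {f f' : ℝ → ℝ} {p q B : ℝ} (hpq : p ≤ q)
    (hf : ContinuousOn f (Icc p q))
    (hf' : ∀ x ∈ Ioo p q, HasDerivWithinAt f (f' x) (Ici x) x)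
    (hB : ∀ x ∈ Ioo p q, f' x ≤ B) : f q - f p ≤ B * (q - p) := by
  rcases hpq.eq_or_lt with rfl | hlt
  · simp
  have key : ∀ s ∈ Ioo p q, f q - f s ≤ B * (q - s) := by
    intro s hs
    have h := image_le_of_deriv_right_le_deriv_boundary (f := f) (f' := f') (a := s) (b := q)
      (B := fun x => f s + B * (x - s)) (B' := fun _ => B)
      (hf.mono (Icc_subset_Icc_left hs.1.le))
      (fun x hx => hf' x ⟨hs.1.trans_le hx.1, hx.2⟩) (by simp) (by fun_prop)
      (fun x _ => by
        simpa using (((hasDerivAt_id x).sub_const s).const_mul B).const_add (f s)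
          |>.hasDerivWithinAt)
      (fun x hx => hB x ⟨hs.1.trans_le hx.1, hx.2⟩) (right_mem_Icc.2 hs.2.le)
    linarith
  have hne : (𝓝[Ioo p q] p).NeBot := left_nhdsWithin_Ioo_neBot hlt
  have h1 : Tendsto (fun s => f q - f s) (𝓝[Ioo p q] p) (𝓝 (f q - f p)) :=
    tendsto_const_nhds.sub ((hf p (left_mem_Icc.2 hpq)).mono Ioo_subset_Icc_self)
  have h2 : Tendsto (fun s => B * (q - s)) (𝓝[Ioo p q] p) (𝓝 (B * (q - p))) :=
    ((by fun_prop : Continuous fun s => B * (q - s)).tendsto p).mono_left nhdsWithin_le_nhds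
  exact le_of_tendsto_of_tendsto h1 h2 (eventually_nhdsWithin_of_forall key)

/-- An abstract version of a family `U` solving `U' = V` in a weak sense, where `V` differs from
the image `L` of `U` under a symmetric nonpositive operator by a term controlled by `‖U‖`. Weak
differentiability is expressed after applying the operators `P m`. -/
structure EvolutionData (α β : ℝ) (U V L : ℝ → F) (P : ℕ → F →L[ℝ] F) (K c : ℝ) : Prop where
  K_nonneg : 0 ≤ K
  c_nonneg : 0 ≤ c
  P_symm : ∀ m x y, ⟪P m x, y⟫ = ⟪x, P m y⟫
  P_le : ∀ m x, ‖P m x‖ ≤ ‖x‖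
  P_tendsto : ∀ x, Tendsto (fun m => P m x) atTop (𝓝 x)
  hasDeriv : ∀ m, ∀ t ∈ Icc α β,
    HasDerivWithinAt (fun s => P m (U s)) (P m (V t)) (Icc α β) t
  cont : ∀ m, ContinuousOn (fun t => P m (V t)) (Icc α β)
  symm : ∀ s ∈ Icc α β, ∀ t ∈ Icc α β, ⟪U s, L t⟫ = ⟪U t, L s⟫
  cross : ∀ s ∈ Icc α β, ∀ t ∈ Icc α β, |⟪U s, L t⟫| ≤ (-⟪U s, L s⟫ + -⟪U t, L t⟫) / 2
  err : ∀ t ∈ Icc α β, ‖V t - L t‖ ≤ c * ‖U t‖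
  energy : ∀ t ∈ Icc α β, -⟪U t, L t⟫ ≤ K * ‖U t‖ ^ 2
  compact : ∀ t ∈ Icc α β, ∀ s : ℕ → ℝ, (∀ j, s j ∈ Icc α β) → Tendsto s atTop (𝓝 t) →
    (∃ C, ∀ j, ‖U (s j)‖ ≤ C) → Tendsto (fun j => U (s j)) atTop (𝓝 (U t))
  short : (7 * K + 1 + 2 * c ^ 2) * (β - α) ≤ 1 / 2

/-- `U` is continuous at `t` and has bounded forward difference quotients at `t`. -/
def ForwardLipschitzAt (α β : ℝ) (U : ℝ → F) (t : ℝ) : Prop :=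
  ContinuousWithinAt U (Icc α β) t ∧
    ∃ C, ∀ᶠ s in 𝓝[Icc α β ∩ Ioi t] t, ‖U s - U t‖ ≤ C * (s - t)

namespace EvolutionData

variable {α β : ℝ} {U V L : ℝ → F} {P : ℕ → F →L[ℝ] F} {K c : ℝ}

theorem tendsto_inner_slope (h : EvolutionData α β U V L P K c) {t : ℝ} (ht : t ∈ Icc α β)
    (hg : ForwardLipschitzAt α β U t) (ψ : F) :
    Tendsto (fun s => ⟪(s - t)⁻¹ • (U s - U t), ψ⟫) (𝓝[Icc α β ∩ Ioi t] t) (𝓝 ⟪V t, ψ⟫) := by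
  obtain ⟨-, C, hC⟩ := hg
  have hq : ∀ᶠ s in 𝓝[Icc α β ∩ Ioi t] t, ‖(s - t)⁻¹ • (U s - U t)‖ ≤ |C| := by
    filter_upwards [hC, self_mem_nhdsWithin] with s hs hst
    have hpos : 0 < s - t := sub_pos.2 hst.2
    rw [norm_smul, norm_inv, Real.norm_of_nonneg hpos.le, inv_mul_le_iff₀ hpos]
    calc _ ≤ C * (s - t) := hs
      _ ≤ |C| * (s - t) := by gcongr; exact le_abs_self C
      _ = _ := by ring
  rw [Metric.tendsto_nhds]
  intro ε hε
  obtain ⟨m, hm⟩ : ∃ m, (|C| + ‖V t‖) * ‖ψ - P m ψ‖ < ε / 2 := by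
    have h1 : Tendsto (fun m => (|C| + ‖V t‖) * ‖ψ - P m ψ‖) atTop (𝓝 0) := by
      have := ((tendsto_const_nhds (x := ψ)).sub (h.P_tendsto ψ)).norm.const_mul (|C| + ‖V t‖)
      simpa using this
    exact ((tendsto_order.1 h1).2 _ (half_pos hε)).exists
  have hP : Tendsto (fun s => ⟪P m ((s - t)⁻¹ • (U s - U t)) - P m (V t), ψ⟫)
      (𝓝[Icc α β ∩ Ioi t] t) (𝓝 0) := by
    have h1 := (hasDerivWithinAt_iff_tendsto_slope'
      (s := Icc α β ∩ Ioi t) (by simp)).1 ((h.hasDeriv m t ht).mono inter_subset_left)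
    have h2 := (h1.sub_const (P m (V t))).inner (𝕜 := ℝ) (tendsto_const_nhds (x := ψ))
    simpa [slope_def_module] using h2
  rw [Metric.tendsto_nhds] at hP
  filter_upwards [hq, hP (ε / 2) (half_pos hε)] with s hs1 hs2
  rw [Real.dist_eq] at *
  set q := (s - t)⁻¹ • (U s - U t)
  have e1 : ⟪q, ψ⟫ - ⟪V t, ψ⟫ = ⟪P m q - P m (V t), ψ⟫ + ⟪q - V t, ψ - P m ψ⟫ := by
    rw [inner_sub_right, ← h.P_symm, map_sub, inner_sub_left, inner_sub_left]; ring
  have e2 : |⟪q - V t, ψ - P m ψ⟫| ≤ (|C| + ‖V t‖) * ‖ψ - P m ψ‖ :=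
    (abs_real_inner_le_norm _ _).trans <| by
      gcongr; exact (norm_sub_le _ _).trans (by gcongr)
  rw [e1]
  rw [sub_zero] at hs2
  exact (abs_add_le _ _).trans_lt (by linarith)

theorem hasDerivWithinAt_norm_sq (h : EvolutionData α β U V L P K c) {t : ℝ}
    (ht : t ∈ Ico α β) (hg : ForwardLipschitzAt α β U t) (φ : F) :
    HasDerivWithinAt (fun s => ‖U s - φ‖ ^ 2) (2 * ⟪V t, U t - φ⟫) (Ici t) t := by
  have hW : 𝓝[Icc α β ∩ Ioi t] t = 𝓝[>] t := by
    apply le_antisymm (nhdsWithin_mono _ inter_subset_right)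
    have : Ioo t β ⊆ Icc α β ∩ Ioi t := fun s hs => ⟨⟨ht.1.trans hs.1.le, hs.2.le⟩, hs.1⟩
    rw [← nhdsWithin_Ioo_eq_nhdsGT ht.2]
    exact nhdsWithin_mono _ this
  have h1 := h.tendsto_inner_slope ⟨ht.1, ht.2.le⟩ hg (U t - φ)
  obtain ⟨-, C, hC⟩ := hg
  rw [hW] at h1 hC
  apply HasDerivWithinAt.Ici_of_Ioi
  rw [hasDerivWithinAt_iff_tendsto_slope' (by simp)]
  have h2 : Tendsto (fun s => (s - t)⁻¹ * ‖U s - U t‖ ^ 2) (𝓝[>] t) (𝓝 0) := by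
    have hlin : Tendsto (fun s => C ^ 2 * (s - t)) (𝓝[>] t) (𝓝 0) := by
      have : Tendsto (fun s => C ^ 2 * (s - t)) (𝓝 t) (𝓝 (C ^ 2 * (t - t))) :=
        Continuous.tendsto (by fun_prop) t
      simpa using this.mono_left nhdsWithin_le_nhds
    refine squeeze_zero' ?_ ?_ hlin
    · filter_upwards [self_mem_nhdsWithin] with s hs
      have : 0 < s - t := sub_pos.2 hs
      positivity
    · filter_upwards [self_mem_nhdsWithin, hC] with s hs hs2
      have : 0 < s - t := sub_pos.2 hs
      rw [inv_mul_le_iff₀ this]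
      calc ‖U s - U t‖ ^ 2 ≤ (C * (s - t)) ^ 2 := by gcongr
        _ = _ := by ring
  have h3 := (h1.const_mul 2).add h2
  rw [add_zero] at h3
  refine h3.congr fun s => ?_
  rw [slope_def_field, real_inner_smul_left]
  have : ‖U s - φ‖ ^ 2 = ‖U s - U t‖ ^ 2 + 2 * ⟪U s - U t, U t - φ⟫ + ‖U t - φ‖ ^ 2 := by
    rw [← norm_add_sq_real]; simp
  rw [this]
  ring

theorem abs_rate_le (h : EvolutionData α β U V L P K c) {t r : ℝ} (ht : t ∈ Icc α β)
    (hr : r ∈ Icc α β) :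
    |2 * ⟪V t, U t - U r⟫| ≤ (7 * K + 1 + 2 * c ^ 2) * (‖U t - U r‖ ^ 2 + ‖U r‖ ^ 2) := by
  have e : 2 * ⟪V t, U t - U r⟫ =
      2 * ⟪U t, L t⟫ - 2 * ⟪U r, L t⟫ + 2 * ⟪V t - L t, U t - U r⟫ := by
    simp only [inner_sub_left, inner_sub_right, real_inner_comm (L t)]; ring
  have h1 := h.cross r hr t ht
  have h2 := h.energy t ht
  have h3 := h.energy r hr
  have h4 : |⟪V t - L t, U t - U r⟫| ≤ (c * ‖U t‖) * ‖U t - U r‖ :=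
    (abs_real_inner_le_norm _ _).trans (by gcongr; exact h.err t ht)
  have h5 := h.cross t ht t ht
  have h6 : ‖U t‖ ^ 2 ≤ 2 * ‖U t - U r‖ ^ 2 + 2 * ‖U r‖ ^ 2 := by
    have : ‖U t‖ ≤ ‖U t - U r‖ + ‖U r‖ := norm_le_norm_sub_add _ _
    nlinarith [norm_nonneg (U t), sq_nonneg (‖U t - U r‖ - ‖U r‖)]
  have h7 := mul_le_mul_of_nonneg_left h6 h.K_nonneg
  have h8 := mul_le_mul_of_nonneg_left h6 (sq_nonneg c)
  have h9 := h.K_nonneg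
  have h10 : 2 * ((c * ‖U t‖) * ‖U t - U r‖) ≤ c ^ 2 * ‖U t‖ ^ 2 + ‖U t - U r‖ ^ 2 := by
    nlinarith [sq_nonneg (c * ‖U t‖ - ‖U t - U r‖)]
  have h11 : 0 ≤ K * ‖U t - U r‖ ^ 2 := by positivity
  have h12 : 0 ≤ K * ‖U r‖ ^ 2 := by positivity
  have h13 := sq_nonneg ‖U r‖
  rw [e]
  rw [abs_le] at h1 h4 h5 ⊢
  constructor <;> nlinarith

/-- On an interval of forward Lipschitz points, the distance to an endpoint is controlled. -/
theorem dist_left_le (h : EvolutionData α β U V L P K c) {a t : ℝ} (ha : a ∈ Icc α β)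
    (ht : t ∈ Icc α β) (hg : ∀ s ∈ Ioo a t, ForwardLipschitzAt α β U s)
    (hc : ContinuousOn U (Icc a t)) {s : ℝ} (hs : s ∈ Icc a t) :
    ‖U s - U a‖ ^ 2 ≤ ‖U a‖ ^ 2 := by
  have hcont : ContinuousOn (fun s => ‖U s - U a‖ ^ 2) (Icc a t) := by fun_prop
  obtain ⟨p, hp, hmax⟩ := isCompact_Icc.exists_isMaxOn ⟨s, hs⟩ hcont
  have hmax' : ∀ x ∈ Icc a t, ‖U x - U a‖ ^ 2 ≤ ‖U p - U a‖ ^ 2 := fun x hx => hmax hx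
  have hC : 0 ≤ 7 * K + 1 + 2 * c ^ 2 := by have := h.K_nonneg; positivity
  have key := sub_le_of_right_deriv_le (f := fun s => ‖U s - U a‖ ^ 2)
    (f' := fun s => 2 * ⟪V s, U s - U a⟫) hp.1 (hcont.mono (Icc_subset_Icc_right hp.2))
    (fun x hx => h.hasDerivWithinAt_norm_sq ⟨ha.1.trans hx.1.le, (hx.2.trans_le hp.2).trans_le ht.2⟩
      (hg x ⟨hx.1, hx.2.trans_le hp.2⟩) _)
    (B := (7 * K + 1 + 2 * c ^ 2) * (‖U p - U a‖ ^ 2 + ‖U a‖ ^ 2))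
    (fun x hx => (le_abs_self _).trans <| (h.abs_rate_le
      ⟨ha.1.trans hx.1.le, (hx.2.trans_le hp.2).le.trans ht.2⟩ ha).trans <| by
        gcongr 1
        gcongr ?_ + _
        exact hmax' x ⟨hx.1.le, (hx.2.trans_le hp.2).le⟩)
  have h2 : (7 * K + 1 + 2 * c ^ 2) * (p - a) ≤ 1 / 2 :=
    le_trans (by gcongr; exacts [hp.2.trans ht.2, ha.1]) h.short
  simp only [sub_self, norm_zero] at key
  have h3 : 0 ≤ ‖U p - U a‖ ^ 2 + ‖U a‖ ^ 2 := by positivity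
  have := mul_le_mul_of_nonneg_right h2 h3
  have := hmax' s hs
  nlinarith

theorem dist_right_le (h : EvolutionData α β U V L P K c) {a t : ℝ} (ha : a ∈ Icc α β)
    (ht : t ∈ Icc α β) (hg : ∀ s ∈ Ioo a t, ForwardLipschitzAt α β U s)
    (hc : ContinuousOn U (Icc a t)) {s : ℝ} (hs : s ∈ Icc a t) :
    ‖U s - U t‖ ^ 2 ≤ ‖U t‖ ^ 2 := by
  have hcont : ContinuousOn (fun s => ‖U s - U t‖ ^ 2) (Icc a t) := by fun_prop
  obtain ⟨p, hp, hmax⟩ := isCompact_Icc.exists_isMaxOn ⟨s, hs⟩ hcont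
  have hmax' : ∀ x ∈ Icc a t, ‖U x - U t‖ ^ 2 ≤ ‖U p - U t‖ ^ 2 := fun x hx => hmax hx
  have hC : 0 ≤ 7 * K + 1 + 2 * c ^ 2 := by have := h.K_nonneg; positivity
  have key := sub_le_of_right_deriv_le (f := fun s => -‖U s - U t‖ ^ 2)
    (f' := fun s => -(2 * ⟪V s, U s - U t⟫)) hp.2 (hcont.neg.mono (Icc_subset_Icc_left hp.1))
    (fun x hx => (h.hasDerivWithinAt_norm_sq
      ⟨(ha.1.trans hp.1).trans hx.1.le, hx.2.trans_le ht.2⟩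
      (hg x ⟨hp.1.trans_lt hx.1, hx.2⟩) _).neg)
    (B := (7 * K + 1 + 2 * c ^ 2) * (‖U p - U t‖ ^ 2 + ‖U t‖ ^ 2))
    (fun x hx => (neg_le_abs _).trans <| (h.abs_rate_le
      ⟨(ha.1.trans hp.1).trans hx.1.le, hx.2.le.trans ht.2⟩ ht).trans <| by
        gcongr 1
        gcongr ?_ + _
        exact hmax' x ⟨hp.1.trans hx.1.le, hx.2.le⟩)
  have h2 : (7 * K + 1 + 2 * c ^ 2) * (t - p) ≤ 1 / 2 :=
    le_trans (by gcongr; exacts [ht.2, ha.1.trans hp.1]) h.short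
  simp only [sub_self, norm_zero] at key
  have h3 : 0 ≤ ‖U p - U t‖ ^ 2 + ‖U t‖ ^ 2 := by positivity
  have := mul_le_mul_of_nonneg_right h2 h3
  have := hmax' s hs
  nlinarith

end EvolutionData
end Evolution

section Evolution

open Set Filter Topology
open scoped RealInnerProductSpace

variable {F : Type*} [NormedAddCommGroup F] [InnerProductSpace ℝ F]
namespace EvolutionData

variable {α β : ℝ} {U V L : ℝ → F} {P : ℕ → F →L[ℝ] F} {K c : ℝ}

theorem continuousWithinAt_of_bounded (h : EvolutionData α β U V L P K c) {t : ℝ}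
    (ht : t ∈ Icc α β) {s : Set ℝ} (hs : s ⊆ Icc α β) {C : ℝ}
    (hC : ∀ᶠ x in 𝓝[s] t, ‖U x‖ ≤ C) : ContinuousWithinAt U s t := by
  refine tendsto_of_seq_tendsto fun x hx => ?_
  have h1 : ∀ᶠ j in atTop, x j ∈ s ∧ ‖U (x j)‖ ≤ C :=
    (hx.eventually eventually_mem_nhdsWithin).and (hx.eventually hC)
  obtain ⟨N, hN⟩ := eventually_atTop.1 h1
  rw [← tendsto_add_atTop_iff_nat N]
  exact h.compact t ht (fun j => x (j + N)) (fun j => hs (hN _ (by omega)).1)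
    ((tendsto_add_atTop_iff_nat N).2 (hx.mono_right nhdsWithin_le_nhds))
    ⟨C, fun j => (hN _ (by omega)).2⟩

theorem norm_le_two_mul {E : Type*} [NormedAddCommGroup E] {x y : E}
    (hxy : ‖x - y‖ ^ 2 ≤ ‖y‖ ^ 2) : ‖x‖ ≤ 2 * ‖y‖ := by
  have h1 : ‖x - y‖ ≤ ‖y‖ := le_of_sq_le_sq hxy (norm_nonneg _)
  have h2 : ‖x‖ ≤ ‖x - y‖ + ‖y‖ := norm_le_norm_sub_add _ _
  linarith

theorem continuousOn_Icc (h : EvolutionData α β U V L P K c) {a t : ℝ} (ha : a ∈ Icc α β)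
    (ht : t ∈ Icc α β) (hg : ∀ s ∈ Ioo a t, ForwardLipschitzAt α β U s) :
    ContinuousOn U (Icc a t) := by
  have hsub : Icc a t ⊆ Icc α β := Icc_subset_Icc ha.1 ht.2
  have hcont : ∀ p q, a < p → q < t → ContinuousOn U (Icc p q) := fun p q hp hq x hx =>
    (hg x ⟨hp.trans_le hx.1, hx.2.trans_lt hq⟩).1.mono
      ((Icc_subset_Icc hp.le hq.le).trans hsub)
  set r := (a + t) / 2 with hr
  have hbd : ∀ x ∈ Icc a t, ‖U x‖ ≤ 2 * ‖U r‖ + ‖U a‖ + ‖U t‖ := by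
    intro x hx
    have n1 := norm_nonneg (U r)
    have n2 := norm_nonneg (U a)
    have n3 := norm_nonneg (U t)
    rcases hx.1.eq_or_lt with rfl | h1
    · linarith
    rcases hx.2.eq_or_lt with rfl | h2
    · linarith
    have hrW : r ∈ Icc α β := hsub ⟨by linarith, by linarith⟩
    suffices ‖U x‖ ≤ 2 * ‖U r‖ by linarith
    apply norm_le_two_mul
    rcases le_total x r with hxr | hxr
    · exact h.dist_right_le (hsub hx) hrW (fun s hs => hg s ⟨h1.trans hs.1, by linarith [hs.2]⟩)
        (hcont _ _ h1 (by linarith)) ⟨le_rfl, hxr⟩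
    · exact h.dist_left_le hrW (hsub hx) (fun s hs => hg s ⟨by linarith [hs.1], hs.2.trans h2⟩)
        (hcont _ _ (by linarith) h2) ⟨hxr, le_rfl⟩
  exact fun x hx => h.continuousWithinAt_of_bounded (hsub hx) hsub
    (eventually_nhdsWithin_of_forall hbd)

/-- Lipschitz bound on an interval of forward Lipschitz points, in terms of the data at its left
endpoint. -/
theorem norm_sub_left_le (h : EvolutionData α β U V L P K c) {a t k : ℝ} (ha : a ∈ Icc α β)
    (ht : t ∈ Icc α β) (hat : a ≤ t) (hg : ∀ s ∈ Ioo a t, ForwardLipschitzAt α β U s)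
    (hUk : ‖U a‖ ≤ k) (hVk : ‖V a‖ ≤ k) : ‖U t - U a‖ ≤ 2 * (1 + 3 * c) * k * (t - a) := by
  have hc := h.continuousOn_Icc ha ht hg
  have hsub : Icc a t ⊆ Icc α β := Icc_subset_Icc ha.1 ht.2
  have hcont : ContinuousOn (fun s => ‖U s - U a‖) (Icc a t) := by fun_prop
  obtain ⟨p, hp, hmax⟩ := isCompact_Icc.exists_isMaxOn ⟨t, right_mem_Icc.2 hat⟩ hcont
  have hmax' : ∀ x ∈ Icc a t, ‖U x - U a‖ ≤ ‖U p - U a‖ := fun x hx => hmax hx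
  have hk : 0 ≤ k := (norm_nonneg _).trans hUk
  have hc0 := h.c_nonneg
  have rate : ∀ x ∈ Ioo a p, 2 * ⟪V x, U x - U a⟫ ≤ ‖U p - U a‖ * (2 * (1 + 3 * c) * k) := by
    intro x hx
    have hxt : x ∈ Icc a t := ⟨hx.1.le, hx.2.le.trans hp.2⟩
    have hxW := hsub hxt
    have e : 2 * ⟪V x, U x - U a⟫ = 2 * (⟪U x, L x⟫ + ⟪U a, L a⟫ - ⟪U x, L a⟫ - ⟪U a, L x⟫)
        + 2 * ⟪L a + (V x - L x), U x - U a⟫ := by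
      simp only [inner_sub_left, inner_sub_right, inner_add_left, real_inner_comm (L x),
        real_inner_comm (L a)]
      ring
    have h1 := (abs_le.1 (h.cross a ha x hxW)).1
    have h2 := h.symm a ha x hxW
    have h3 : ‖U x‖ ≤ 2 * k :=
      (norm_le_two_mul (h.dist_left_le ha ht hg hc hxt)).trans (by gcongr)
    have h4 : ‖L a‖ ≤ (1 + c) * k := by
      have := h.err a ha
      have h5 : ‖L a‖ ≤ ‖V a‖ + ‖V a - L a‖ := norm_le_norm_add_norm_sub _ _
      have : c * ‖U a‖ ≤ c * k := by gcongr
      linarith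
    have h5 : ‖V x - L x‖ ≤ c * (2 * k) := (h.err x hxW).trans (by gcongr)
    have h6 : ⟪L a + (V x - L x), U x - U a⟫ ≤ ((1 + c) * k + c * (2 * k)) * ‖U p - U a‖ := by
      refine (real_inner_le_norm _ _).trans ?_
      gcongr
      · exact (norm_add_le _ _).trans (add_le_add h4 h5)
      · exact hmax' x hxt
    rw [e]
    linarith
  have key := sub_le_of_right_deriv_le (f := fun s => ‖U s - U a‖ ^ 2)
    (f' := fun s => 2 * ⟪V s, U s - U a⟫) hp.1
    ((hcont.mono (Icc_subset_Icc_right hp.2)).pow 2)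
    (fun x hx => h.hasDerivWithinAt_norm_sq
      ⟨ha.1.trans hx.1.le, (hx.2.trans_le hp.2).trans_le ht.2⟩
      (hg x ⟨hx.1, hx.2.trans_le hp.2⟩) _) rate
  simp only [sub_self, norm_zero] at key
  have hC : 0 ≤ 2 * (1 + 3 * c) * k := by positivity
  have h1 : ‖U p - U a‖ ≤ 2 * (1 + 3 * c) * k * (p - a) := by
    rcases (norm_nonneg (U p - U a)).eq_or_lt with h0 | h0
    · rw [← h0]; exact mul_nonneg hC (sub_nonneg.2 hp.1)
    · refine le_of_mul_le_mul_left ?_ h0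
      linarith
  calc _ ≤ _ := hmax' t (right_mem_Icc.2 hat)
    _ ≤ _ := h1
    _ ≤ _ := by gcongr; exact hp.2

section Closed

variable {S : Set ℝ}

/-- Between two points of a closed set off which all points are forward Lipschitz, `U` is
Lipschitz as soon as `U` and `V` are bounded on that set. -/
theorem norm_sub_le_of_mem_closed (h : EvolutionData α β U V L P K c) (hS : IsClosed S)
    (hgood : ∀ t ∈ Icc α β, t ∉ S → ForwardLipschitzAt α β U t)
    {s t k : ℝ} (hs : s ∈ Icc α β) (ht : t ∈ Icc α β) (hst : s ≤ t) (hsS : s ∈ S) (htS : t ∈ S)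
    (hk : ∀ x ∈ S ∩ Icc s t, ‖U x‖ ≤ k ∧ ‖V x‖ ≤ k) :
    ‖U t - U s‖ ≤ (2 * (1 + 3 * c) * k + k + 1) * (t - s) := by
  have hsub : Icc s t ⊆ Icc α β := Icc_subset_Icc hs.1 ht.2
  have hk0 : 0 ≤ k := (norm_nonneg _).trans (hk s ⟨hsS, left_mem_Icc.2 hst⟩).1
  have hc0 := h.c_nonneg
  set C := 2 * (1 + 3 * c) * k + k + 1 with hCdef
  have hC1 : 2 * (1 + 3 * c) * k ≤ C := by linarith
  have hC2 : k + 1 ≤ C := by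
    have : 0 ≤ 2 * (1 + 3 * c) * k := by positivity
    linarith
  have main : ∀ m, ‖P m (U t) - P m (U s)‖ ≤ C * (t - s) := by
    intro m
    set f := fun τ => P m (U τ) with hf
    have hfc : ContinuousOn f (Icc s t) := fun x hx =>
      (h.hasDeriv m x (hsub hx)).continuousWithinAt.mono hsub
    set A := (S ∩ Icc s t) ∩ {τ | τ ∈ Icc s t ∧ ‖f τ - f s‖ ≤ C * (τ - s)} with hA
    have hAc : IsClosed A := by
      refine (hS.inter isClosed_Icc).inter ?_
      exact isClosed_Icc.isClosed_le (by fun_prop) (by fun_prop)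
    have hAs : s ∈ A := ⟨⟨hsS, left_mem_Icc.2 hst⟩, left_mem_Icc.2 hst, by simp⟩
    have hbdd : BddAbove A := ⟨t, fun x hx => hx.2.1.2⟩
    have hσ : sSup A ∈ A := hAc.csSup_mem ⟨s, hAs⟩ hbdd
    set σ := sSup A with hσdef
    have hσmax : ∀ τ ∈ A, τ ≤ σ := fun τ hτ => le_csSup hbdd hτ
    have step : ∀ τ ∈ S ∩ Icc s t, σ ≤ τ → ‖f τ - f σ‖ ≤ C * (τ - σ) → τ ≤ σ := by
      intro τ hτ hστ hle
      refine hσmax τ ⟨hτ, hτ.2, ?_⟩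
      calc ‖f τ - f s‖ ≤ ‖f τ - f σ‖ + ‖f σ - f s‖ := norm_sub_le_norm_sub_add_norm_sub _ _ _
        _ ≤ C * (τ - σ) + C * (σ - s) := add_le_add hle hσ.2.2
        _ = _ := by ring
    rcases hσ.2.1.2.eq_or_lt with hσt | hσt
    · rw [← hσt]; exact hσ.2.2
    exfalso
    by_cases hgap : ∃ τ ∈ S ∩ Ioc σ t, ∀ x ∈ Ioo σ τ, x ∉ S
    · obtain ⟨τ, hτ, hτS⟩ := hgap
      have hτI : τ ∈ Icc s t := ⟨hσ.2.1.1.trans hτ.2.1.le, hτ.2.2⟩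
      have h1 := h.norm_sub_left_le (hsub hσ.2.1) (hsub hτI) hτ.2.1.le
        (fun x hx => hgood x (hsub ⟨hσ.2.1.1.trans hx.1.le, hx.2.le.trans hτ.2.2⟩) (hτS x hx))
        (hk σ hσ.1).1 (hk σ hσ.1).2
      refine absurd (step τ ⟨hτ.1, hτI⟩ hτ.2.1.le ?_) (not_le.2 hτ.2.1)
      have hpos : 0 ≤ τ - σ := sub_nonneg.2 hτ.2.1.le
      calc ‖f τ - f σ‖ = ‖P m (U τ - U σ)‖ := by rw [map_sub]
        _ ≤ _ := h.P_le _ _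
        _ ≤ _ := h1
        _ ≤ _ := by gcongr
    · push Not at hgap
      have hd := (h.hasDeriv m σ (hsub hσ.2.1))
      have hb : ∀ᶠ x in 𝓝[Icc α β] σ, ‖f x - f σ‖ ≤ (k + 1) * ‖x - σ‖ := by
        have h1 := hd.isLittleO.def (c := 1) one_pos
        filter_upwards [h1] with x hx
        have h2 : ‖(x - σ) • P m (V σ)‖ ≤ k * ‖x - σ‖ := by
          rw [norm_smul, mul_comm]
          gcongr
          exact (h.P_le _ _).trans (hk σ hσ.1).2
        have h3 : ‖f x - f σ‖ ≤ ‖f x - f σ - (x - σ) • P m (V σ)‖ + ‖(x - σ) • P m (V σ)‖ :=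
          norm_le_norm_sub_add _ _
        linarith
      obtain ⟨ε, hε, hball⟩ := Metric.mem_nhdsWithin_iff.1 hb
      set e := min (σ + ε / 2) t with he
      have hσe : σ < e := lt_min (by linarith) hσt
      have hTc : IsCompact (S ∩ Icc e t) := isCompact_Icc.inter_left hS
      obtain ⟨τ, hτ, hτmin⟩ := hTc.exists_isLeast ⟨t, htS, min_le_right _ _, le_rfl⟩
      obtain ⟨x, hx, hxS⟩ := hgap τ ⟨hτ.1, hσe.trans_le hτ.2.1, hτ.2.2⟩
      have hxe : x < e := by
        by_contra hxe
        exact absurd (hτmin ⟨hxS, not_lt.1 hxe, hx.2.le.trans hτ.2.2⟩) (not_le.2 hx.2)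
      have hxI : x ∈ Icc s t := ⟨hσ.2.1.1.trans hx.1.le, hx.2.le.trans hτ.2.2⟩
      have hxε : x < σ + ε / 2 := hxe.trans_le (min_le_left _ _)
      have hpos : 0 < x - σ := sub_pos.2 hx.1
      have h1 : ‖f x - f σ‖ ≤ (k + 1) * ‖x - σ‖ :=
        hball ⟨by rw [Metric.mem_ball, Real.dist_eq, abs_of_pos hpos]; linarith, hsub hxI⟩
      rw [Real.norm_of_nonneg hpos.le] at h1
      refine absurd (step x ⟨hxS, hxI⟩ hx.1.le (h1.trans ?_)) (not_le.2 hx.1)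
      gcongr
  have hlim : Tendsto (fun m => ‖P m (U t) - P m (U s)‖) atTop (𝓝 ‖U t - U s‖) :=
    ((h.P_tendsto _).sub (h.P_tendsto _)).norm
  exact le_of_tendsto' hlim main

/-- A point of a closed set off which all points are forward Lipschitz is itself forward
Lipschitz, if `U` and `V` are bounded on that set near the point. -/
theorem forwardLipschitzAt_of_bounded (h : EvolutionData α β U V L P K c) (hS : IsClosed S)
    (hgood : ∀ t ∈ Icc α β, t ∉ S → ForwardLipschitzAt α β U t)
    {p ε k : ℝ} (hp : p ∈ Icc α β) (hpS : p ∈ S) (hε : 0 < ε)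
    (hk : ∀ x ∈ S, x ∈ Icc α β → |x - p| < ε → ‖U x‖ ≤ k ∧ ‖V x‖ ≤ k) :
    ForwardLipschitzAt α β U p := by
  have hk0 : 0 ≤ k := (norm_nonneg _).trans (hk p hpS hp (by simpa)).1
  have hc0 := h.c_nonneg
  have right : ∀ t ∈ Icc α β, p ≤ t → |t - p| < ε → ∃ a ∈ S, a ∈ Icc p t ∧
      ∀ x ∈ Ioo a t, ForwardLipschitzAt α β U x := by
    intro t ht hpt htε
    obtain ⟨a, ha, hmax⟩ := ((isCompact_Icc (a := p) (b := t)).inter_left hS).exists_isGreatest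
      ⟨p, hpS, le_rfl, hpt⟩
    refine ⟨a, ha.1, ha.2, fun x hx => hgood x ⟨hp.1.trans (ha.2.1.trans hx.1.le),
      hx.2.le.trans ht.2⟩ fun hxS => ?_⟩
    exact absurd (hmax ⟨hxS, ha.2.1.trans hx.1.le, hx.2.le⟩) (not_le.2 hx.1)
  have bdd : ∀ t ∈ Icc α β, |t - p| < ε → ‖U t‖ ≤ 2 * k := by
    intro t ht htε
    rcases le_total p t with hpt | hpt
    · obtain ⟨a, haS, ha, hg⟩ := right t ht hpt htε
      have haW : a ∈ Icc α β := ⟨hp.1.trans ha.1, ha.2.trans ht.2⟩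
      have h1 := h.dist_left_le haW ht hg (h.continuousOn_Icc haW ht hg) ⟨ha.2, le_rfl⟩
      refine (norm_le_two_mul h1).trans ?_
      gcongr
      refine (hk a haS haW ?_).1
      rw [abs_of_nonneg (sub_nonneg.2 hpt)] at htε
      rw [abs_of_nonneg (sub_nonneg.2 ha.1)]
      linarith [ha.2]
    · obtain ⟨a, ha, hmin⟩ := ((isCompact_Icc (a := t) (b := p)).inter_left hS).exists_isLeast
        ⟨p, hpS, hpt, le_rfl⟩
      have haW : a ∈ Icc α β := ⟨ht.1.trans ha.2.1, ha.2.2.trans hp.2⟩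
      have hg : ∀ x ∈ Ioo t a, ForwardLipschitzAt α β U x := fun x hx =>
        hgood x ⟨ht.1.trans hx.1.le, hx.2.le.trans haW.2⟩ fun hxS =>
          absurd (hmin ⟨hxS, hx.1.le, hx.2.le.trans ha.2.2⟩) (not_le.2 hx.2)
      have h1 := h.dist_right_le ht haW hg (h.continuousOn_Icc ht haW hg) ⟨le_rfl, ha.2.1⟩
      refine (norm_le_two_mul h1).trans ?_
      gcongr
      refine (hk a ha.1 haW ?_).1
      rw [abs_of_nonpos (sub_nonpos.2 hpt)] at htε
      rw [abs_of_nonpos (sub_nonpos.2 ha.2.2)]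
      linarith [ha.2.1]
  have hnear : ∀ᶠ t in 𝓝 p, |t - p| < ε := by
    filter_upwards [Metric.ball_mem_nhds p hε] with t ht
    rwa [Metric.mem_ball, Real.dist_eq] at ht
  refine ⟨h.continuousWithinAt_of_bounded hp Subset.rfl (C := 2 * k) ?_,
    2 * (1 + 3 * c) * k + k + 1, ?_⟩
  · filter_upwards [self_mem_nhdsWithin, hnear.filter_mono nhdsWithin_le_nhds] with t ht h2
    exact bdd t ht h2
  · filter_upwards [self_mem_nhdsWithin, hnear.filter_mono nhdsWithin_le_nhds] with t ht h2
    have hpt : p ≤ t := le_of_lt ht.2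
    obtain ⟨a, haS, ha, hg⟩ := right t ht.1 hpt h2
    have haW : a ∈ Icc α β := ⟨hp.1.trans ha.1, ha.2.trans ht.1.2⟩
    rw [abs_of_nonneg (sub_nonneg.2 hpt)] at h2
    have hk' : ∀ x ∈ S ∩ Icc p a, ‖U x‖ ≤ k ∧ ‖V x‖ ≤ k := fun x hx =>
      hk x hx.1 ⟨hp.1.trans hx.2.1, hx.2.2.trans haW.2⟩ (by
        rw [abs_of_nonneg (sub_nonneg.2 hx.2.1)]; linarith [hx.2.2, ha.2])
    have h1 := h.norm_sub_le_of_mem_closed hS hgood hp haW ha.1 hpS haS hk'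
    have ha' := hk' a ⟨haS, ha.1, le_rfl⟩
    have h3 := h.norm_sub_left_le haW ht.1 ha.2 hg ha'.1 ha'.2
    calc ‖U t - U p‖ ≤ ‖U t - U a‖ + ‖U a - U p‖ := norm_sub_le_norm_sub_add_norm_sub _ _ _
      _ ≤ 2 * (1 + 3 * c) * k * (t - a) + (2 * (1 + 3 * c) * k + k + 1) * (a - p) :=
        add_le_add h3 h1
      _ ≤ (2 * (1 + 3 * c) * k + k + 1) * (t - a) + (2 * (1 + 3 * c) * k + k + 1) * (a - p) := by
        have : 0 ≤ t - a := sub_nonneg.2 ha.2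
        gcongr
        linarith
      _ = _ := by ring

end Closed

theorem forwardLipschitzAt (h : EvolutionData α β U V L P K c) {t : ℝ} (ht : t ∈ Icc α β) :
    ForwardLipschitzAt α β U t := by
  set S := closure {t | t ∈ Icc α β ∧ ¬ ForwardLipschitzAt α β U t} with hSdef
  have hS : IsClosed S := isClosed_closure
  have hSW : S ⊆ Icc α β := closure_minimal (fun x hx => hx.1) isClosed_Icc
  have hgood : ∀ t ∈ Icc α β, t ∉ S → ForwardLipschitzAt α β U t := fun t ht htS => by
    by_contra hb
    exact htS (subset_closure ⟨ht, hb⟩)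
  rcases S.eq_empty_or_nonempty with hemp | hne
  · exact hgood t ht (by simp [hemp])
  exfalso
  have : Nonempty S := hne.to_subtype
  have : CompleteSpace S := hS.isComplete.completeSpace_coe
  let f : ℕ → Set S := fun k => {x | ∀ m, ‖P m (U x)‖ ≤ k ∧ ‖P m (V x)‖ ≤ k}
  have hf : ∀ k, IsClosed (f k) := by
    intro k
    simp only [f, ofPred_forall, ofPred_and]
    refine isClosed_iInter fun m => ?_
    have h1 : ContinuousOn (fun t => P m (U t)) (Icc α β) := fun x hx =>
      (h.hasDeriv m x hx).continuousWithinAt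
    have h2 : Continuous fun x : S => P m (U x) := (h1.mono hSW).domRestrict
    have h3 : Continuous fun x : S => P m (V x) := ((h.cont m).mono hSW).domRestrict
    exact (isClosed_le h2.norm continuous_const).inter (isClosed_le h3.norm continuous_const)
  have hU : ⋃ k, f k = univ := by
    rw [iUnion_eq_univ_iff]
    intro x
    obtain ⟨k, hk⟩ := exists_nat_ge (max ‖U x‖ ‖V x‖)
    exact ⟨k, fun m => ⟨(h.P_le _ _).trans ((le_max_left _ _).trans hk),
      (h.P_le _ _).trans ((le_max_right _ _).trans hk)⟩⟩
  obtain ⟨k, p, hp⟩ := nonempty_interior_of_iUnion_of_closed hf hU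
  obtain ⟨ε, hε, hball⟩ := Metric.mem_nhds_iff.1 (mem_interior_iff_mem_nhds.1 hp)
  have hk : ∀ x ∈ S, |x - p| < ε → ‖U x‖ ≤ k ∧ ‖V x‖ ≤ k := by
    intro x hx hxp
    have h1 : (⟨x, hx⟩ : S) ∈ f k := hball (by rwa [Metric.mem_ball, Subtype.dist_eq, Real.dist_eq])
    exact ⟨le_of_tendsto' (h.P_tendsto _).norm fun m => (h1 m).1,
      le_of_tendsto' (h.P_tendsto _).norm fun m => (h1 m).2⟩
  obtain ⟨x, hx, hxp⟩ := Metric.mem_closure_iff.1 p.2 (ε / 2) (half_pos hε)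
  rw [dist_comm, Real.dist_eq] at hxp
  refine hx.2 (h.forwardLipschitzAt_of_bounded hS hgood hx.1 (subset_closure hx) (half_pos hε)
    (k := k) fun y hy _ hyx => hk y hy ?_)
  calc |y - p| ≤ |y - x| + |x - p| := abs_sub_le _ _ _
    _ < ε := by linarith

theorem norm_sub_right_le (h : EvolutionData α β U V L P K c) (hαβ : α ≤ β) {κ A : ℝ}
    (hκ : 0 ≤ κ) (hA : 0 ≤ A)
    (hend : ∀ σ ∈ Icc α β, -⟪U σ, L σ⟫ ≤ (κ + A * (β - σ)) * ‖U σ‖ ^ 2)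
    (hend' : -⟪U β, L β⟫ = κ * ‖U β‖ ^ 2) :
    ∃ C, ∀ τ ∈ Icc α β, ‖U τ - U β‖ ≤ C * (β - τ) := by
  have hβ : β ∈ Icc α β := right_mem_Icc.2 hαβ
  set b := ‖U β‖ with hb
  have hb0 : 0 ≤ b := norm_nonneg _
  have hc0 := h.c_nonneg
  set C₁ := 6 * κ * b + 2 * (‖L β‖ + 2 * c * b) with hC₁
  set C₂ := 8 * A * b ^ 2 with hC₂
  have hC₁0 : 0 ≤ C₁ := by positivity
  have hC₂0 : 0 ≤ C₂ := by positivity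
  refine ⟨C₁ + C₂ + 1, fun τ hτ => ?_⟩
  have hg : ∀ s ∈ Ioo τ β, ForwardLipschitzAt α β U s := fun s hs =>
    h.forwardLipschitzAt ⟨hτ.1.trans hs.1.le, hs.2.le⟩
  have hc := h.continuousOn_Icc hτ hβ hg
  have hsub : Icc τ β ⊆ Icc α β := Icc_subset_Icc_left hτ.1
  have hcont : ContinuousOn (fun s => ‖U s - U β‖) (Icc τ β) := by fun_prop
  obtain ⟨p, hp, hmax⟩ := isCompact_Icc.exists_isMaxOn ⟨τ, left_mem_Icc.2 hτ.2⟩ hcont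
  have hmax' : ∀ x ∈ Icc τ β, ‖U x - U β‖ ≤ ‖U p - U β‖ := fun x hx => hmax hx
  set m := ‖U p - U β‖ with hm
  have hm0 : 0 ≤ m := norm_nonneg _
  have rate : ∀ x ∈ Ioo p β, -(2 * ⟪V x, U x - U β⟫) ≤ C₁ * m + C₂ * (β - τ) := by
    intro x hx
    have hxτ : x ∈ Icc τ β := ⟨hp.1.trans hx.1.le, hx.2.le⟩
    have hxW := hsub hxτ
    have hw : ‖U x - U β‖ ^ 2 ≤ b ^ 2 := h.dist_right_le hτ hβ hg hc hxτ
    have hwb : ‖U x - U β‖ ≤ b := le_of_sq_le_sq hw hb0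
    have hux : ‖U x‖ ≤ 2 * b := norm_le_two_mul hw
    have hwm := hmax' x hxτ
    have e : -(2 * ⟪V x, U x - U β⟫) = 2 * (-⟪U x, L x⟫ - -⟪U β, L β⟫)
        + 2 * (⟪U β, L x⟫ - ⟪U x, L β⟫) + 2 * (-⟪V x - L x, U x - U β⟫)
        + 2 * ⟪L β, U x - U β⟫ := by
      simp only [inner_sub_left, inner_sub_right, real_inner_comm (L x), real_inner_comm (L β)]
      ring
    have h0 := h.symm β hβ x hxW
    have h1 : -⟪V x - L x, U x - U β⟫ ≤ c * (2 * b) * m := by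
      refine (neg_le_abs _).trans ((abs_real_inner_le_norm _ _).trans ?_)
      gcongr
      exact (h.err x hxW).trans (by gcongr)
    have h2 : ⟪L β, U x - U β⟫ ≤ ‖L β‖ * m :=
      (real_inner_le_norm _ _).trans (by gcongr)
    have h3 : ‖U x‖ ^ 2 - b ^ 2 ≤ 3 * b * m := by
      have : ‖U x‖ ≤ m + b := (norm_le_norm_sub_add _ (U β)).trans (by gcongr)
      nlinarith [norm_nonneg (U x)]
    have h4 : ‖U x‖ ^ 2 ≤ 4 * b ^ 2 := by nlinarith [norm_nonneg (U x)]
    have h5 := hend x hxW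
    have hβx : β - x ≤ β - τ := by linarith [hxτ.1]
    have h6 : A * (β - x) * ‖U x‖ ^ 2 ≤ A * (β - τ) * (4 * b ^ 2) := by
      have : 0 ≤ β - x := sub_nonneg.2 hx.2.le
      have : 0 ≤ β - τ := sub_nonneg.2 hτ.2
      gcongr
    have h7 := mul_le_mul_of_nonneg_left h3 hκ
    rw [e, hC₁, hC₂]
    nlinarith
  have key := sub_le_of_right_deriv_le (f := fun s => -‖U s - U β‖ ^ 2)
    (f' := fun s => -(2 * ⟪V s, U s - U β⟫)) hp.2
    ((hcont.mono (Icc_subset_Icc_left hp.1)).pow 2).neg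
    (fun x hx => (h.hasDerivWithinAt_norm_sq
      ⟨(hτ.1.trans hp.1).trans hx.1.le, hx.2⟩ (hg x ⟨hp.1.trans_lt hx.1, hx.2⟩) _).neg) rate
  simp only [sub_self, norm_zero] at key
  set ℓ := β - τ with hℓ
  have hℓ0 : 0 ≤ ℓ := sub_nonneg.2 hτ.2
  have hβp : β - p ≤ ℓ := by linarith [hp.1]
  have hsq : m ^ 2 ≤ (C₁ * m + C₂ * ℓ) * ℓ := by
    have : (C₁ * m + C₂ * ℓ) * (β - p) ≤ (C₁ * m + C₂ * ℓ) * ℓ := by gcongr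
    linarith
  refine (hmax' τ (left_mem_Icc.2 hτ.2)).trans ?_
  change m ≤ (C₁ + C₂ + 1) * ℓ
  by_contra hlt
  push Not at hlt
  have h1 : ℓ ≤ m := by nlinarith
  have h2 : C₂ * ℓ * ℓ ≤ C₂ * ℓ * m := by gcongr
  have hmpos : 0 < m := lt_of_le_of_lt (by positivity) hlt
  nlinarith

end EvolutionData
end Evolution

section BoundedMeasurable

open Set Filter Topology
open scoped RealInnerProductSpace

variable {E : Type*} [NormedAddCommGroup E] [InnerProductSpace ℝ E] [FiniteDimensional ℝ E]
  [MeasurableSpace E] [BorelSpace E] {Ω : Set E}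

/-- `f` is a.e. strongly measurable and bounded on `Ω`. -/
def BddMeas (Ω : Set E) (f : E → ℝ) : Prop :=
  AEStronglyMeasurable f (volume.restrict Ω) ∧ ∃ C, ∀ x ∈ Ω, |f x| ≤ C

/-- `f` is Lipschitz on the whole space and vanishes outside `Ω`. -/
def ZeroLip (Ω : Set E) (f : E → ℝ) : Prop :=
  (∃ B, LipschitzWith B f) ∧ ∀ x ∉ Ω, f x = 0

namespace BddMeas

variable {f g : E → ℝ}

theorem const (c : ℝ) : BddMeas Ω fun _ => c :=
  ⟨aestronglyMeasurable_const, |c|, fun _ _ => le_rfl⟩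

theorem add (hf : BddMeas Ω f) (hg : BddMeas Ω g) : BddMeas Ω fun x => f x + g x := by
  obtain ⟨h1, C, hC⟩ := hf
  obtain ⟨h2, D, hD⟩ := hg
  exact ⟨h1.add h2, C + D, fun x hx => (abs_add_le _ _).trans (add_le_add (hC x hx) (hD x hx))⟩

theorem neg (hf : BddMeas Ω f) : BddMeas Ω fun x => -f x := by
  obtain ⟨h1, C, hC⟩ := hf
  exact ⟨h1.neg, C, fun x hx => by rw [abs_neg]; exact hC x hx⟩

theorem sub (hf : BddMeas Ω f) (hg : BddMeas Ω g) : BddMeas Ω fun x => f x - g x := by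
  simpa only [sub_eq_add_neg] using hf.add hg.neg

theorem mul (hf : BddMeas Ω f) (hg : BddMeas Ω g) : BddMeas Ω fun x => f x * g x := by
  obtain ⟨h1, C, hC⟩ := hf
  obtain ⟨h2, D, hD⟩ := hg
  refine ⟨h1.mul h2, C * D, fun x hx => ?_⟩
  rw [abs_mul]
  exact mul_le_mul (hC x hx) (hD x hx) (abs_nonneg _) ((abs_nonneg _).trans (hC x hx))

theorem const_mul (c : ℝ) (hf : BddMeas Ω f) : BddMeas Ω fun x => c * f x := (const c).mul hf

theorem pow (hf : BddMeas Ω f) (k : ℕ) : BddMeas Ω fun x => f x ^ k := by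
  obtain ⟨h1, C, hC⟩ := hf
  refine ⟨h1.pow k, C ^ k, fun x hx => ?_⟩
  rw [abs_pow]
  exact pow_le_pow_left₀ (abs_nonneg _) (hC x hx) k

theorem abs (hf : BddMeas Ω f) : BddMeas Ω fun x => |f x| := by
  obtain ⟨h1, C, hC⟩ := hf
  exact ⟨h1.norm, C, fun x hx => by rw [abs_abs]; exact hC x hx⟩

theorem sum {ι : Type*} (s : Finset ι) {f : ι → E → ℝ} (hf : ∀ i ∈ s, BddMeas Ω (f i)) :
    BddMeas Ω fun x => ∑ i ∈ s, f i x := by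
  induction s using Finset.cons_induction with
  | empty => simpa using const 0
  | cons a s ha ih =>
    simp only [Finset.sum_cons]
    exact (hf a (by simp)).add (ih fun i hi => hf i (by simp [hi]))

theorem integrableOn (hf : BddMeas Ω f) (hΩ : MeasurableSet Ω) (hb : Bornology.IsBounded Ω) :
    IntegrableOn f Ω := by
  obtain ⟨h1, C, hC⟩ := hf
  have : IsFiniteMeasure (volume.restrict Ω) := isFiniteMeasure_restrict.2 hb.measure_lt_top.ne
  exact Integrable.of_bound h1 C ((ae_restrict_iff' hΩ).2 (Eventually.of_forall hC))

end BddMeas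

theorem LipschitzOnWith.bddMeas {f : E → ℝ} {B : NNReal} (hf : LipschitzOnWith B f Ω)
    (hΩ : MeasurableSet Ω) (hb : Bornology.IsBounded Ω) : BddMeas Ω f := by
  refine ⟨(hf.continuousOn.aestronglyMeasurable hΩ), ?_⟩
  rcases Ω.eq_empty_or_nonempty with rfl | ⟨p, hp⟩
  · exact ⟨0, by simp⟩
  obtain ⟨R, hR⟩ := Metric.isBounded_iff.1 hb
  refine ⟨|f p| + B * R, fun x hx => ?_⟩
  have h1 : |f x - f p| ≤ B * R := by
    have := hf.dist_le_mul x hx p hp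
    rw [Real.dist_eq] at this
    exact this.trans (by gcongr; exact hR hx hp)
  have : |f x| ≤ |f x - f p| + |f p| := by
    simpa using abs_add_le (f x - f p) (f p)
  linarith

theorem LipschitzWith.bddMeas_fderiv {f : E → ℝ} {B : NNReal} (hf : LipschitzWith B f) (e : E) :
    BddMeas Ω fun x => fderiv ℝ f x e := by
  refine ⟨(measurable_fderiv_apply_const ℝ f e).aestronglyMeasurable, B * ‖e‖, fun x _ => ?_⟩
  exact ((fderiv ℝ f x).le_opNorm e).trans (by gcongr; exact norm_fderiv_le_of_lipschitz ℝ hf)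

theorem LipschitzOnWith.bddMeas_fderiv {f : E → ℝ} {B : NNReal} (hf : LipschitzOnWith B f Ω)
    (hΩ : IsOpen Ω) (e : E) : BddMeas Ω fun x => fderiv ℝ f x e := by
  refine ⟨(measurable_fderiv_apply_const ℝ f e).aestronglyMeasurable, B * ‖e‖, fun x hx => ?_⟩
  exact ((fderiv ℝ f x).le_opNorm e).trans
    (by gcongr; exact norm_fderiv_le_of_lipschitzOn ℝ (hΩ.mem_nhds hx) hf)

theorem LipschitzOnWith.mul_of_bounded {f g : E → ℝ} {B D : NNReal} (hf : LipschitzOnWith B f Ω)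
    (hg : LipschitzOnWith D g Ω) (hb : Bornology.IsBounded Ω) (hΩ : MeasurableSet Ω) :
    ∃ K, LipschitzOnWith K (fun x => f x * g x) Ω := by
  obtain ⟨-, C₁, h1⟩ := hf.bddMeas hΩ hb
  obtain ⟨-, C₂, h2⟩ := hg.bddMeas hΩ hb
  refine ⟨(|C₁| * D + |C₂| * B).toNNReal, LipschitzOnWith.of_dist_le_mul fun x hx y hy => ?_⟩
  rw [Real.coe_toNNReal _ (by positivity), Real.dist_eq]
  have e : f x * g x - f y * g y = f x * (g x - g y) + g y * (f x - f y) := by ring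
  have h3 : |g x - g y| ≤ D * dist x y := hg.dist_le_mul x hx y hy
  have h4 : |f x - f y| ≤ B * dist x y := hf.dist_le_mul x hx y hy
  rw [e]
  calc _ ≤ |f x| * |g x - g y| + |g y| * |f x - f y| := by
        rw [← abs_mul, ← abs_mul]; exact abs_add_le _ _
    _ ≤ |C₁| * (D * dist x y) + |C₂| * (B * dist x y) := by
        exact add_le_add
          (mul_le_mul ((h1 x hx).trans (le_abs_self _)) h3 (abs_nonneg _) (abs_nonneg _))
          (mul_le_mul ((h2 y hy).trans (le_abs_self _)) h4 (abs_nonneg _) (abs_nonneg _))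
    _ = _ := by ring

/-- A function which is Lipschitz on an open bounded convex set and controlled by a Lipschitz
function vanishing outside is globally Lipschitz after extension by zero. -/
theorem ZeroLip.mul_lipschitzOn {w p : E → ℝ} {D : NNReal} (hw : ZeroLip Ω w)
    (hp : LipschitzOnWith D p Ω) (hb : Bornology.IsBounded Ω) (hΩ : MeasurableSet Ω) :
    ZeroLip Ω fun x => w x * p x := by
  obtain ⟨⟨B, hB⟩, hw0⟩ := hw
  refine ⟨?_, fun x hx => by simp [hw0 x hx]⟩
  obtain ⟨K, hK⟩ := (hB.lipschitzOnWith (s := Ω)).mul_of_bounded hp hb hΩ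
  obtain ⟨-, C, hC⟩ := hp.bddMeas hΩ hb
  have hout : ∀ x ∈ Ω, ∀ y ∉ Ω, |w x * p x| ≤ B * |C| * dist x y := by
    intro x hx y hy
    have h1 : |w x| ≤ B * dist x y := by
      have := hB.dist_le_mul x y
      rwa [Real.dist_eq, hw0 y hy, sub_zero] at this
    rw [abs_mul]
    calc _ ≤ (B * dist x y) * |C| :=
          mul_le_mul h1 ((hC x hx).trans (le_abs_self _)) (abs_nonneg _) (by positivity)
      _ = _ := by ring
  refine ⟨K + (B * |C|).toNNReal, LipschitzWith.of_dist_le_mul fun x y => ?_⟩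
  have hKd : 0 ≤ (K : ℝ) * dist x y := by positivity
  have hBd : 0 ≤ B * |C| * dist x y := by positivity
  rw [NNReal.coe_add, Real.coe_toNNReal _ (by positivity), add_mul, Real.dist_eq]
  by_cases hx : x ∈ Ω <;> by_cases hy : y ∈ Ω
  · have := hK.dist_le_mul x hx y hy
    rw [Real.dist_eq] at this
    linarith
  · have := hout x hx y hy
    rw [hw0 y hy, zero_mul, sub_zero]
    linarith
  · have := hout y hy x hx
    rw [dist_comm] at this
    rw [hw0 x hx, zero_mul, zero_sub, abs_neg]
    linarith
  · rw [hw0 x hx, hw0 y hy]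
    simp only [zero_mul, sub_self, abs_zero]
    linarith

theorem ZeroLip.sub {E : Type*} [NormedAddCommGroup E] {Ω : Set E} {w p : E → ℝ}
    (hw : ZeroLip Ω w) (hp : ZeroLip Ω p) : ZeroLip Ω fun x => w x - p x := by
  obtain ⟨⟨B, hB⟩, hw0⟩ := hw
  obtain ⟨⟨D, hD⟩, hp0⟩ := hp
  exact ⟨⟨_, hB.sub hD⟩, fun x hx => by simp [hw0 x hx, hp0 x hx]⟩

theorem ZeroLip.bddMeas {w : E → ℝ} (hw : ZeroLip Ω w) (hΩ : MeasurableSet Ω)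
    (hb : Bornology.IsBounded Ω) : BddMeas Ω w := by
  obtain ⟨⟨B, hB⟩, -⟩ := hw
  exact hB.lipschitzOnWith.bddMeas hΩ hb

theorem ZeroLip.bddMeas_fderiv {w : E → ℝ} (hw : ZeroLip Ω w) (e : E) :
    BddMeas Ω fun x => fderiv ℝ w x e := by
  obtain ⟨⟨B, hB⟩, -⟩ := hw
  exact hB.bddMeas_fderiv e

theorem ZeroLip.hasCompactSupport {E : Type*} [NormedAddCommGroup E] [InnerProductSpace ℝ E]
    [FiniteDimensional ℝ E] {Ω : Set E} {w : E → ℝ} (hw : ZeroLip Ω w)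
    (hb : Bornology.IsBounded Ω) : HasCompactSupport w :=
  HasCompactSupport.of_support_subset_isCompact hb.isCompact_closure fun x hx => by
    by_contra h
    exact hx (hw.2 x fun hxΩ => h (subset_closure hxΩ))

/-- The derivative of a function vanishing outside a convex set vanishes a.e. outside it. -/
theorem ZeroLip.ae_fderiv_eq_zero {w : E → ℝ} (hw : ZeroLip Ω w) (hc : Convex ℝ Ω) :
    ∀ᵐ x : E, x ∉ Ω → fderiv ℝ w x = 0 := by
  have h0 : ∀ᵐ x : E, x ∉ frontier Ω :=
    measure_eq_zero_iff_ae_notMem.1 (hc.addHaar_frontier volume)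
  filter_upwards [h0] with x hx hxΩ
  have hx' : x ∈ (closure Ω)ᶜ := fun h => by
    rcases (closure_eq_self_union_frontier Ω ▸ h : x ∈ Ω ∪ frontier Ω) with h | h
    exacts [hxΩ h, hx h]
  have : w =ᶠ[𝓝 x] fun _ => 0 := by
    filter_upwards [isClosed_closure.isOpen_compl.mem_nhds hx'] with y hy
    exact hw.2 y fun h => hy (subset_closure h)
  rw [this.fderiv_eq]
  simp

theorem ZeroLip.setIntegral_fderiv_eq_zero {w : E → ℝ} (hw : ZeroLip Ω w) (hc : Convex ℝ Ω)
    (hb : Bornology.IsBounded Ω) (e : E) : ∫ x in Ω, fderiv ℝ w x e = 0 := by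
  obtain ⟨B, hB⟩ := hw.1
  have h1 := LipschitzWith.integral_lineDeriv_mul_eq (μ := (volume : Measure E))
    (LipschitzWith.const (1 : ℝ)) hB (hw.hasCompactSupport hb) (-e)
  have h3 : ∀ x, lineDeriv ℝ (fun _ : E => (1 : ℝ)) x (-e) = 0 := fun x => by simp [lineDeriv]
  simp only [neg_neg, mul_one, h3, zero_mul, integral_zero] at h1
  have h2 : ∫ x, fderiv ℝ w x e = ∫ x, lineDeriv ℝ w x e := by
    refine integral_congr_ae ?_
    filter_upwards [hB.ae_differentiableAt] with x hx
    exact hx.lineDeriv_eq_fderiv.symm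
  rw [setIntegral_eq_integral_of_ae_compl_eq_zero, h2, ← h1]
  filter_upwards [hw.ae_fderiv_eq_zero hc] with x hx hxΩ
  simp [hx hxΩ]

/-- Integration by parts with a factor vanishing on the boundary. -/
theorem ZeroLip.integral_fderiv_mul {w p : E → ℝ} {D : NNReal} (hw : ZeroLip Ω w)
    (hΩ : IsOpen Ω) (hb : Bornology.IsBounded Ω) (hc : Convex ℝ Ω)
    (hp : LipschitzOnWith D p Ω) (hpd : ∀ x ∈ Ω, DifferentiableAt ℝ p x) (e : E) :
    ∫ x in Ω, fderiv ℝ w x e * p x = -∫ x in Ω, w x * fderiv ℝ p x e := by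
  have hm := hΩ.measurableSet
  have h0 := (hw.mul_lipschitzOn hp hb hm).setIntegral_fderiv_eq_zero hc hb e
  obtain ⟨B, hB⟩ := hw.1
  have h1 : ∫ x in Ω, fderiv ℝ (fun x => w x * p x) x e
      = ∫ x in Ω, (fderiv ℝ w x e * p x + w x * fderiv ℝ p x e) := by
    refine setIntegral_congr_ae hm ?_
    filter_upwards [hB.ae_differentiableAt] with x hx hxΩ
    rw [fderiv_fun_mul hx (hpd x hxΩ)]
    simp
    ring
  rw [h0, integral_add] at h1
  · linarith
  · exact ((hw.bddMeas_fderiv e).mul (hp.bddMeas hm hb)).integrableOn hm hb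
  · exact ((hw.bddMeas hm hb).mul (hp.bddMeas_fderiv hΩ e)).integrableOn hm hb

end BoundedMeasurable

section Dirichlet

open Set Filter Topology
open scoped RealInnerProductSpace

theorem exists_mem_segment_frontier {E : Type*} [NormedAddCommGroup E] [NormedSpace ℝ E]
    {Ω : Set E} {x y : E} (hx : x ∈ Ω) (hy : y ∉ Ω) : ∃ z ∈ segment ℝ x y, z ∈ frontier Ω := by
  have hpre : IsPreconnected (segment ℝ x y) := (convex_segment x y).isPreconnected
  obtain ⟨z, hz, h1, h2⟩ := isPreconnected_closed_iff.1 hpre (closure Ω) (closure Ωᶜ)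
    isClosed_closure isClosed_closure
    (fun z _ => by
      by_cases hz : z ∈ Ω
      exacts [Or.inl (subset_closure hz), Or.inr (subset_closure hz)])
    ⟨x, left_mem_segment ℝ x y, subset_closure hx⟩
    ⟨y, right_mem_segment ℝ x y, subset_closure hy⟩
  exact ⟨z, hz, by rw [frontier_eq_closure_inter_closure]; exact ⟨h1, h2⟩⟩

variable {n : ℕ} {Ω : Set (EuclideanSpace ℝ (Fin n))}

/-- The Euclidean heat kernel, up to a constant. -/
noncomputable def heatWeight (θ : ℝ) (x₀ x : EuclideanSpace ℝ (Fin n)) : ℝ :=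
  θ ^ (-(n : ℝ)/2) * Real.exp (-‖x - x₀‖^2 / (4 * θ))

/-- The Laplacian with the drift adapted to `heatWeight`. -/
noncomputable def driftLap (θ : ℝ) (x₀ : EuclideanSpace ℝ (Fin n))
    (v : EuclideanSpace ℝ (Fin n) → ℝ) (x : EuclideanSpace ℝ (Fin n)) : ℝ :=
  lap v x - fderiv ℝ v x (x - x₀) / (2 * θ)

/-- A function vanishing outside `Ω`, twice differentiable in `Ω` and with Lipschitz first
derivatives in `Ω`. -/
structure IsDirichletC2 (Ω : Set (EuclideanSpace ℝ (Fin n)))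
    (v : EuclideanSpace ℝ (Fin n) → ℝ) : Prop where
  zeroLip : ZeroLip Ω v
  differentiableAt : ∀ x ∈ Ω, DifferentiableAt ℝ v x
  partial_lipschitz : ∀ i, ∃ B,
    LipschitzOnWith B (fun y => fderiv ℝ v y (EuclideanSpace.single i 1)) Ω
  partial_differentiableAt : ∀ i, ∀ x ∈ Ω,
    DifferentiableAt ℝ (fun y => fderiv ℝ v y (EuclideanSpace.single i 1)) x

theorem IsDirichletC2.of_contDiffOn {f : EuclideanSpace ℝ (Fin n) → ℝ} (hΩ : IsOpen Ω)
    (hb : Bornology.IsBounded Ω) (hc : Convex ℝ Ω) (hf : ContDiffOn ℝ 2 f (closure Ω))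
    (hf0 : ∀ x ∈ frontier Ω, f x = 0) : IsDirichletC2 Ω (Ω.indicator f) := by
  rcases Ω.eq_empty_or_nonempty with rfl | hne
  · refine ⟨⟨⟨0, ?_⟩, by simp⟩, by simp, fun i => ⟨0, by simp⟩, by simp⟩
    simp
  have hK : IsCompact (closure Ω) := hb.isCompact_closure
  have hKc : Convex ℝ (closure Ω) := hc.closure
  have hU : UniqueDiffOn ℝ (closure Ω) := uniqueDiffOn_convex hKc
    (hne.mono (interior_maximal subset_closure hΩ))
  obtain ⟨B, hB⟩ := hf.exists_lipschitzOnWith (by norm_num) hKc hK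
  have hBΩ : LipschitzOnWith B f Ω := hB.mono subset_closure
  have hnhds : ∀ x ∈ Ω, closure Ω ∈ 𝓝 x := fun x hx =>
    mem_of_superset (hΩ.mem_nhds hx) subset_closure
  have hev : ∀ x ∈ Ω, Ω.indicator f =ᶠ[𝓝 x] f := fun x hx => by
    filter_upwards [hΩ.mem_nhds hx] with y hy
    exact indicator_of_mem hy f
  have hout : ∀ x ∈ Ω, ∀ y ∉ Ω, |f x| ≤ B * dist x y := by
    intro x hx y hy
    obtain ⟨z, hz, hzf⟩ := exists_mem_segment_frontier hx hy
    have h1 := hB.dist_le_mul x (subset_closure hx) z (frontier_subset_closure hzf)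
    rw [Real.dist_eq, hf0 z hzf, sub_zero] at h1
    refine h1.trans ?_
    gcongr
    have := dist_add_dist_of_mem_segment hz
    linarith [dist_nonneg (x := z) (y := y)]
  have hfd : ContDiffOn ℝ 1 (fderivWithin ℝ f (closure Ω)) (closure Ω) :=
    hf.fderivWithin hU (by norm_num)
  have hpart : ∀ i : Fin n, ContDiffOn ℝ 1
      (fun y => fderivWithin ℝ f (closure Ω) y (EuclideanSpace.single i 1)) (closure Ω) :=
    fun i => hfd.clm_apply contDiffOn_const
  have heq : ∀ i : Fin n, ∀ x ∈ Ω, fderiv ℝ (Ω.indicator f) x (EuclideanSpace.single i 1) =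
      fderivWithin ℝ f (closure Ω) x (EuclideanSpace.single i 1) := fun i x hx => by
    rw [(hev x hx).fderiv_eq, fderivWithin_of_mem_nhds (hnhds x hx)]
  refine ⟨⟨⟨B, LipschitzWith.of_dist_le_mul fun x y => ?_⟩, fun x hx => indicator_of_notMem hx f⟩,
    fun x hx => ?_, fun i => ?_, fun i x hx => ?_⟩
  · by_cases hx : x ∈ Ω <;> by_cases hy : y ∈ Ω
    · simpa [hx, hy] using hBΩ.dist_le_mul x hx y hy
    · simpa [hx, hy, Real.dist_eq] using hout x hx y hy
    · simpa [hx, hy, Real.dist_eq, dist_comm] using hout y hy x hx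
    · simpa [hx, hy] using (by positivity : 0 ≤ B * dist x y)
  · exact ((hev x hx).differentiableAt_iff).2
      ((hf.differentiableOn (by norm_num)).differentiableAt (hnhds x hx))
  · obtain ⟨D, hD⟩ := (hpart i).exists_lipschitzOnWith (by norm_num) hKc hK
    refine ⟨D, fun x hx y hy => ?_⟩
    simp only [heq i x hx, heq i y hy]
    exact hD (subset_closure hx) (subset_closure hy)
  · have : (fun y => fderiv ℝ (Ω.indicator f) y (EuclideanSpace.single i 1)) =ᶠ[𝓝 x]
        fun y => fderivWithin ℝ f (closure Ω) y (EuclideanSpace.single i 1) := by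
      filter_upwards [hΩ.mem_nhds hx] with y hy
      exact heq i y hy
    exact this.differentiableAt_iff.2
      (((hpart i).differentiableOn (by norm_num)).differentiableAt (hnhds x hx))

theorem inner_gradient_eq_sum (w v : EuclideanSpace ℝ (Fin n) → ℝ)
    (x : EuclideanSpace ℝ (Fin n)) : ⟪gradient w x, gradient v x⟫ =
      ∑ i, fderiv ℝ w x (EuclideanSpace.single i 1) * fderiv ℝ v x (EuclideanSpace.single i 1) := by
  have h : ∀ (f : EuclideanSpace ℝ (Fin n) → ℝ) (i : Fin n),
      (gradient f x) i = fderiv ℝ f x (EuclideanSpace.single i 1) := fun f i => by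
    rw [← inner_gradient_left, EuclideanSpace.inner_single_right]
    simp
  rw [PiLp.inner_apply]
  refine Finset.sum_congr rfl fun i _ => ?_
  rw [h, h, real_inner_comm]
  rfl

theorem fderiv_apply_eq_sum (v : EuclideanSpace ℝ (Fin n) → ℝ)
    (x y : EuclideanSpace ℝ (Fin n)) :
    fderiv ℝ v x y = ∑ i, y i * fderiv ℝ v x (EuclideanSpace.single i 1) := by
  conv_lhs => rw [← (EuclideanSpace.basisFun (Fin n) ℝ).sum_repr y]
  simp [map_sum]

theorem heatWeight_pos {θ : ℝ} (hθ : 0 < θ) (x₀ x : EuclideanSpace ℝ (Fin n)) :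
    0 < heatWeight θ x₀ x := by unfold heatWeight; positivity

theorem contDiff_heatWeight (θ : ℝ) (x₀ : EuclideanSpace ℝ (Fin n)) :
    ContDiff ℝ 1 (heatWeight θ x₀) := by
  unfold heatWeight
  exact contDiff_const.mul
    (((contDiff_id.sub contDiff_const).norm_sq ℝ).neg.div_const _).exp

theorem fderiv_heatWeight (θ : ℝ) (x₀ x e : EuclideanSpace ℝ (Fin n)) :
    fderiv ℝ (heatWeight θ x₀) x e = -(⟪x - x₀, e⟫ / (2 * θ)) * heatWeight θ x₀ x := by
  have h1 : HasFDerivAt (fun x => ‖x - x₀‖ ^ 2) (2 • (innerSL ℝ (x - x₀))) x := by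
    simpa using ((hasFDerivAt_id x).sub_const x₀).norm_sq
  have h2 : HasFDerivAt (fun x => θ ^ (-(n : ℝ)/2) * Real.exp (-‖x - x₀‖ ^ 2 * (4 * θ)⁻¹)) _ x :=
    ((h1.neg.mul_const (4 * θ)⁻¹).exp).const_mul (θ ^ (-(n : ℝ)/2))
  have h3 : heatWeight θ x₀ = fun x => θ ^ (-(n : ℝ)/2) * Real.exp (-‖x - x₀‖ ^ 2 * (4 * θ)⁻¹) := by
    ext x; simp [heatWeight, div_eq_mul_inv]
  rw [h3, h2.fderiv]
  simp only [Pi.neg_apply, smul_apply, neg_apply, innerSL_apply_apply, smul_eq_mul, nsmul_eq_mul]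
  ring

theorem exists_lipschitzOnWith_heatWeight (hb : Bornology.IsBounded Ω) (hc : Convex ℝ Ω) (θ : ℝ)
    (x₀ : EuclideanSpace ℝ (Fin n)) : ∃ B, LipschitzOnWith B (heatWeight θ x₀) Ω := by
  obtain ⟨B, hB⟩ := (contDiff_heatWeight θ x₀).contDiffOn.exists_lipschitzOnWith one_ne_zero
    hc.closure hb.isCompact_closure
  exact ⟨B, hB.mono subset_closure⟩

theorem bddMeas_heatWeight (hΩ : IsOpen Ω) (hb : Bornology.IsBounded Ω) (hc : Convex ℝ Ω) (θ : ℝ)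
    (x₀ : EuclideanSpace ℝ (Fin n)) : BddMeas Ω (heatWeight θ x₀) :=
  let ⟨_, hB⟩ := exists_lipschitzOnWith_heatWeight hb hc θ x₀
  hB.bddMeas hΩ.measurableSet hb

theorem bddMeas_sub_apply (hΩ : IsOpen Ω) (hb : Bornology.IsBounded Ω)
    (x₀ : EuclideanSpace ℝ (Fin n)) (i : Fin n) : BddMeas Ω fun x => (x - x₀) i := by
  refine LipschitzOnWith.bddMeas (B := 1) (LipschitzWith.lipschitzOnWith ?_) hΩ.measurableSet hb
  refine LipschitzWith.of_dist_le_mul fun x y => ?_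
  have := EuclideanSpace.norm_eq (x - y)
  rw [NNReal.coe_one, one_mul, dist_eq_norm, dist_eq_norm]
  calc ‖(x - x₀) i - (y - x₀) i‖ = ‖(x - y) i‖ := by simp
    _ ≤ ‖x - y‖ := PiLp.norm_apply_le (x - y) i

theorem bddMeas_norm_sub_sq (hΩ : IsOpen Ω) (hb : Bornology.IsBounded Ω)
    (x₀ : EuclideanSpace ℝ (Fin n)) : BddMeas Ω fun x => ‖x - x₀‖ ^ 2 := by
  simp only [EuclideanSpace.real_norm_sq_eq]
  exact BddMeas.sum _ fun i _ => (bddMeas_sub_apply hΩ hb x₀ i).pow 2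

theorem ZeroLip.bddMeas_inner_gradient {w v : EuclideanSpace ℝ (Fin n) → ℝ} (hw : ZeroLip Ω w)
    (hv : ZeroLip Ω v) : BddMeas Ω fun x => ⟪gradient w x, gradient v x⟫ := by
  simp only [inner_gradient_eq_sum]
  exact BddMeas.sum _ fun i _ => (hw.bddMeas_fderiv _).mul (hv.bddMeas_fderiv _)

theorem ZeroLip.bddMeas_norm_gradient_sq {w : EuclideanSpace ℝ (Fin n) → ℝ} (hw : ZeroLip Ω w) :
    BddMeas Ω fun x => ‖gradient w x‖ ^ 2 := by
  simpa only [real_inner_self_eq_norm_sq] using hw.bddMeas_inner_gradient hw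

theorem ZeroLip.bddMeas_fderiv_sub {w : EuclideanSpace ℝ (Fin n) → ℝ} (hw : ZeroLip Ω w)
    (hΩ : IsOpen Ω) (hb : Bornology.IsBounded Ω) (x₀ : EuclideanSpace ℝ (Fin n)) :
    BddMeas Ω fun x => fderiv ℝ w x (x - x₀) := by
  simp only [fun x => fderiv_apply_eq_sum w x (x - x₀)]
  exact BddMeas.sum _ fun i _ => (bddMeas_sub_apply hΩ hb x₀ i).mul (hw.bddMeas_fderiv _)

theorem ZeroLip.mul_self {w : EuclideanSpace ℝ (Fin n) → ℝ} (hw : ZeroLip Ω w)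
    (hΩ : IsOpen Ω) (hb : Bornology.IsBounded Ω) : ZeroLip Ω fun x => w x * w x := by
  obtain ⟨B, hB⟩ := hw.1
  exact hw.mul_lipschitzOn hB.lipschitzOnWith hb hΩ.measurableSet

namespace IsDirichletC2

variable {v w : EuclideanSpace ℝ (Fin n) → ℝ}

theorem bddMeas_lap (hv : IsDirichletC2 Ω v) (hΩ : IsOpen Ω) : BddMeas Ω (lap v) := by
  unfold lap
  refine BddMeas.sum _ fun i _ => ?_
  obtain ⟨B, hB⟩ := hv.partial_lipschitz i
  exact hB.bddMeas_fderiv hΩ _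

theorem bddMeas_driftLap (hv : IsDirichletC2 Ω v) (hΩ : IsOpen Ω) (hb : Bornology.IsBounded Ω)
    (θ : ℝ) (x₀ : EuclideanSpace ℝ (Fin n)) : BddMeas Ω (driftLap θ x₀ v) := by
  unfold driftLap
  simp only [div_eq_inv_mul]
  exact (hv.bddMeas_lap hΩ).sub ((hv.zeroLip.bddMeas_fderiv_sub hΩ hb x₀).const_mul _)

/-- Green's formula for the heat weight. -/
theorem integral_inner_gradient (hv : IsDirichletC2 Ω v) (hw : ZeroLip Ω w) (hΩ : IsOpen Ω)
    (hb : Bornology.IsBounded Ω) (hc : Convex ℝ Ω) (θ : ℝ) (x₀ : EuclideanSpace ℝ (Fin n)) :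
    ∫ x in Ω, ⟪gradient w x, gradient v x⟫ * heatWeight θ x₀ x =
      -∫ x in Ω, w x * driftLap θ x₀ v x * heatWeight θ x₀ x := by
  have hm := hΩ.measurableSet
  obtain ⟨K, hK⟩ := exists_lipschitzOnWith_heatWeight (Ω := Ω) hb hc θ x₀
  have hGd : Differentiable ℝ (heatWeight θ x₀) :=
    (contDiff_heatWeight θ x₀).differentiable one_ne_zero
  have hG := bddMeas_heatWeight hΩ hb hc θ x₀
  have key : ∀ i : Fin n, ∫ x in Ω, fderiv ℝ w x (EuclideanSpace.single i 1) *
      (fderiv ℝ v x (EuclideanSpace.single i 1) * heatWeight θ x₀ x) =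
      -∫ x in Ω, w x * (fderiv ℝ (fun y => fderiv ℝ v y (EuclideanSpace.single i 1)) x
        (EuclideanSpace.single i 1) - (x - x₀) i * fderiv ℝ v x (EuclideanSpace.single i 1)
          * (2 * θ)⁻¹) * heatWeight θ x₀ x := by
    intro i
    obtain ⟨B, hB⟩ := hv.partial_lipschitz i
    obtain ⟨D, hD⟩ := hB.mul_of_bounded hK hb hm
    rw [hw.integral_fderiv_mul hΩ hb hc hD
      (fun x hx => (hv.partial_differentiableAt i x hx).mul (hGd x))]
    congr 1
    refine setIntegral_congr_fun hm fun x hx => ?_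
    simp only
    rw [fderiv_fun_mul (hv.partial_differentiableAt i x hx) (hGd x)]
    simp only [add_apply, smul_apply, smul_eq_mul,
      fderiv_heatWeight, EuclideanSpace.inner_single_right]
    simp
    ring
  have hL : ∀ x, ⟪gradient w x, gradient v x⟫ * heatWeight θ x₀ x =
      ∑ i, fderiv ℝ w x (EuclideanSpace.single i 1) *
      (fderiv ℝ v x (EuclideanSpace.single i 1) * heatWeight θ x₀ x) := fun x => by
    rw [inner_gradient_eq_sum, Finset.sum_mul]
    simp only [mul_assoc]
  have hR : ∀ x, w x * driftLap θ x₀ v x * heatWeight θ x₀ x =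
      ∑ i, w x * (fderiv ℝ (fun y => fderiv ℝ v y (EuclideanSpace.single i 1)) x
        (EuclideanSpace.single i 1) - (x - x₀) i * fderiv ℝ v x (EuclideanSpace.single i 1)
          * (2 * θ)⁻¹) * heatWeight θ x₀ x := fun x => by
    rw [driftLap, lap, fderiv_apply_eq_sum v x (x - x₀), ← Finset.sum_mul, ← Finset.mul_sum,
      Finset.sum_sub_distrib, ← Finset.sum_mul, div_eq_mul_inv]
  simp only [hL, hR]
  rw [integral_finsetSum, integral_finsetSum, ← Finset.sum_neg_distrib]
  · exact Finset.sum_congr rfl fun i _ => key i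
  · intro i _
    obtain ⟨B, hB⟩ := hv.partial_lipschitz i
    refine BddMeas.integrableOn ?_ hm hb
    refine ((hw.bddMeas hm hb).mul ((hB.bddMeas_fderiv hΩ _).sub ?_)).mul hG
    exact ((bddMeas_sub_apply hΩ hb x₀ i).mul (hv.zeroLip.bddMeas_fderiv _)).mul (BddMeas.const _)
  · intro i _
    exact ((hw.bddMeas_fderiv _).mul ((hv.zeroLip.bddMeas_fderiv _).mul hG)).integrableOn hm hb

/-- Integration by parts for the radial derivative. -/
theorem integral_mul_fderiv_sub (hv : IsDirichletC2 Ω v) (hΩ : IsOpen Ω)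
    (hb : Bornology.IsBounded Ω) (hc : Convex ℝ Ω) (θ : ℝ) (x₀ : EuclideanSpace ℝ (Fin n)) :
    2 * ∫ x in Ω, v x * fderiv ℝ v x (x - x₀) * heatWeight θ x₀ x =
      -∫ x in Ω, v x ^ 2 * ((n - ‖x - x₀‖ ^ 2 / (2 * θ)) * heatWeight θ x₀ x) := by
  have hm := hΩ.measurableSet
  obtain ⟨K, hK⟩ := exists_lipschitzOnWith_heatWeight (Ω := Ω) hb hc θ x₀
  have hGd : Differentiable ℝ (heatWeight θ x₀) :=
    (contDiff_heatWeight θ x₀).differentiable one_ne_zero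
  have hG := bddMeas_heatWeight hΩ hb hc θ x₀
  have hsq := hv.zeroLip.mul_self hΩ hb
  have key : ∀ i : Fin n, ∫ x in Ω, fderiv ℝ (fun x => v x * v x) x (EuclideanSpace.single i 1) *
      ((x - x₀) i * heatWeight θ x₀ x) =
      -∫ x in Ω, (v x * v x) * ((1 - (x - x₀) i ^ 2 * (2 * θ)⁻¹) * heatWeight θ x₀ x) := by
    intro i
    have hlin : ∀ x, HasFDerivAt (fun x : EuclideanSpace ℝ (Fin n) => (x - x₀) i)
        (EuclideanSpace.proj i : EuclideanSpace ℝ (Fin n) →L[ℝ] ℝ) x := fun x => by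
      simpa using ((EuclideanSpace.proj i : EuclideanSpace ℝ (Fin n) →L[ℝ] ℝ).hasFDerivAt
        (x := x)).sub_const (x₀ i)
    have hlip : LipschitzOnWith ‖(EuclideanSpace.proj i : EuclideanSpace ℝ (Fin n) →L[ℝ] ℝ)‖₊
        (fun x : EuclideanSpace ℝ (Fin n) => (x - x₀) i) Ω :=
      hc.lipschitzOnWith_of_nnnorm_hasFDerivWithin_le (fun x _ => (hlin x).hasFDerivWithinAt)
        fun _ _ => le_rfl
    obtain ⟨D, hD⟩ := hlip.mul_of_bounded hK hb hm
    rw [hsq.integral_fderiv_mul hΩ hb hc hD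
      (fun x hx => (hlin x).differentiableAt.mul (hGd x))]
    congr 1
    refine setIntegral_congr_fun hm fun x hx => ?_
    simp only
    rw [fderiv_fun_mul (hlin x).differentiableAt (hGd x), (hlin x).fderiv]
    simp only [add_apply, smul_apply, smul_eq_mul,
      fderiv_heatWeight, EuclideanSpace.inner_single_right]
    have h1 : (EuclideanSpace.proj i : EuclideanSpace ℝ (Fin n) →L[ℝ] ℝ)
        (EuclideanSpace.single i 1) = 1 := by simp
    simp only [h1, conj_trivial]
    ring
  have hL : ∀ x ∈ Ω, 2 * (v x * fderiv ℝ v x (x - x₀) * heatWeight θ x₀ x) =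
      ∑ i, fderiv ℝ (fun x => v x * v x) x (EuclideanSpace.single i 1) *
      ((x - x₀) i * heatWeight θ x₀ x) := fun x hx => by
    have hd := hv.differentiableAt x hx
    rw [fderiv_apply_eq_sum v x (x - x₀), Finset.mul_sum, Finset.sum_mul, Finset.mul_sum,
      fderiv_fun_mul hd hd]
    refine Finset.sum_congr rfl fun i _ => ?_
    simp
    ring
  have hR : ∀ x, v x ^ 2 * ((n - ‖x - x₀‖ ^ 2 / (2 * θ)) * heatWeight θ x₀ x) =
      ∑ i, (v x * v x) * ((1 - (x - x₀) i ^ 2 * (2 * θ)⁻¹) * heatWeight θ x₀ x) := fun x => by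
    rw [← Finset.mul_sum, ← Finset.sum_mul, Finset.sum_sub_distrib, ← Finset.sum_mul,
      ← EuclideanSpace.real_norm_sq_eq, div_eq_mul_inv, sq (v x)]
    simp
  rw [← integral_const_mul, setIntegral_congr_fun hm hL]
  simp only [hR]
  rw [integral_finsetSum, integral_finsetSum, ← Finset.sum_neg_distrib]
  · exact Finset.sum_congr rfl fun i _ => key i
  · intro i _
    refine BddMeas.integrableOn ?_ hm hb
    exact (hsq.bddMeas hm hb).mul (((BddMeas.const 1).sub
      (((bddMeas_sub_apply hΩ hb x₀ i).pow 2).mul (BddMeas.const _))).mul hG)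
  · intro i _
    exact ((hsq.bddMeas_fderiv _).mul ((bddMeas_sub_apply hΩ hb x₀ i).mul hG)).integrableOn hm hb

end IsDirichletC2
end Dirichlet

section Pohozaev

open Set Filter Topology
open scoped RealInnerProductSpace

variable {n : ℕ} {Ω : Set (EuclideanSpace ℝ (Fin n))}

theorem bddMeas_comp_norm_sub_sq (hΩ : IsOpen Ω) (hb : Bornology.IsBounded Ω)
    (x₀ : EuclideanSpace ℝ (Fin n)) {f : ℝ → ℝ} (hf : Continuous f) :
    BddMeas Ω fun x => f (‖x - x₀‖ ^ 2) := by
  obtain ⟨-, C, hC⟩ := bddMeas_norm_sub_sq hΩ hb x₀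
  obtain ⟨D, hD⟩ := (isCompact_Icc (a := (0 : ℝ)) (b := C)).exists_bound_of_continuousOn
    hf.continuousOn
  exact ⟨(show Continuous fun x => f (‖x - x₀‖ ^ 2) by fun_prop).aestronglyMeasurable, D,
    fun x hx => hD _ ⟨by positivity, (le_abs_self _).trans (hC x hx)⟩⟩

theorem hasDerivAt_integral_mul_radial {p : EuclideanSpace ℝ (Fin n) → ℝ} (hp : BddMeas Ω p)
    (hΩ : IsOpen Ω) (hb : Bornology.IsBounded Ω) (x₀ : EuclideanSpace ℝ (Fin n))
    {κ κ' : ℝ → ℝ → ℝ} {a b s₀ : ℝ} (hs₀ : s₀ ∈ Ioo a b)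
    (hd : ∀ s ∈ Ioo a b, ∀ r, HasDerivAt (fun s => κ s r) (κ' s r) s)
    (hκ : ∀ s ∈ Ioo a b, Continuous (κ s))
    (hκ' : ContinuousOn (fun q : ℝ × ℝ => κ' q.1 q.2) (Icc a b ×ˢ univ)) :
    HasDerivAt (fun s => ∫ x in Ω, p x * κ s (‖x - x₀‖ ^ 2))
      (∫ x in Ω, p x * κ' s₀ (‖x - x₀‖ ^ 2)) s₀ := by
  have hm := hΩ.measurableSet
  have : IsFiniteMeasure (volume.restrict Ω) := isFiniteMeasure_restrict.2 hb.measure_lt_top.ne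
  obtain ⟨hpm, C, hC⟩ := id hp
  obtain ⟨-, R, hR⟩ := bddMeas_norm_sub_sq hΩ hb x₀
  obtain ⟨D, hD⟩ := ((isCompact_Icc (a := a) (b := b)).prod
    (isCompact_Icc (a := (0 : ℝ)) (b := R))).exists_bound_of_continuousOn
    (hκ'.mono (prod_mono_right (subset_univ _)))
  have hκ₀ : Continuous (κ' s₀) := by
    have := hκ'.comp_continuous (f := fun r : ℝ => (s₀, r)) (by fun_prop)
      fun r => ⟨⟨hs₀.1.le, hs₀.2.le⟩, mem_univ _⟩
    exact this
  refine (hasDerivAt_integral_of_dominated_loc_of_deriv_le (bound := fun _ => |C| * |D|)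
    (F := fun s x => p x * κ s (‖x - x₀‖ ^ 2)) (F' := fun s x => p x * κ' s (‖x - x₀‖ ^ 2))
    (Ioo_mem_nhds hs₀.1 hs₀.2) ?_ ?_ ?_ ?_ (integrable_const _) ?_).2
  · filter_upwards [Ioo_mem_nhds hs₀.1 hs₀.2] with s hs
    exact (hp.mul (bddMeas_comp_norm_sub_sq hΩ hb x₀ (hκ s hs))).1
  · exact (hp.mul (bddMeas_comp_norm_sub_sq hΩ hb x₀ (hκ s₀ hs₀))).integrableOn hm hb
  · exact (hp.mul (bddMeas_comp_norm_sub_sq hΩ hb x₀ hκ₀)).1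
  · refine (ae_restrict_iff' hm).2 (Eventually.of_forall fun x hx s hs => ?_)
    rw [norm_mul]
    refine mul_le_mul ((hC x hx).trans (le_abs_self _)) (le_trans ?_ (le_abs_self _))
      (norm_nonneg _) (abs_nonneg _)
    exact hD (s, ‖x - x₀‖ ^ 2)
      ⟨⟨hs.1.le, hs.2.le⟩, by positivity, (le_abs_self _).trans (hR x hx)⟩
  · exact Eventually.of_forall fun x s hs => (hd s hs _).const_mul _

theorem gradient_comp_dilation (v : EuclideanSpace ℝ (Fin n) → ℝ)
    (x₀ x : EuclideanSpace ℝ (Fin n)) (s : ℝ) :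
    gradient (fun x => v (x₀ + s • (x - x₀))) x = s • gradient v (x₀ + s • (x - x₀)) := by
  have h : fderiv ℝ (fun x => v (x₀ + s • (x - x₀))) x = s • fderiv ℝ v (x₀ + s • (x - x₀)) := by
    have h1 := fderiv_comp_sub (𝕜 := ℝ) (f := fun y => v (x₀ + s • y)) (x := x) x₀
    have h2 := fderiv_comp_smul (𝕜 := ℝ) (f := fun y => v (x₀ + y)) (x := x - x₀) s
    have h3 := fderiv_comp_add_left (𝕜 := ℝ) (f := v) (x := s • (x - x₀)) x₀
    rw [h1, h2, ← h3]
  unfold gradient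
  rw [h, map_smul]

theorem norm_sq_sub_le_inner {E : Type*} [NormedAddCommGroup E] [InnerProductSpace ℝ E] (a b : E) :
    2 * (⟪a, b⟫ - ⟪b, b⟫) ≤ ‖a‖ ^ 2 - ‖b‖ ^ 2 := by
  have h := real_inner_self_nonneg (x := a - b)
  rw [inner_sub_sub_self, real_inner_comm a b] at h
  rw [← real_inner_self_eq_norm_sq, ← real_inner_self_eq_norm_sq]
  linarith [real_inner_comm a b]

theorem ZeroLip.comp_dilation {v : EuclideanSpace ℝ (Fin n) → ℝ} (hv : ZeroLip Ω v)
    (hc : Convex ℝ Ω) {x₀ : EuclideanSpace ℝ (Fin n)} (hx₀ : x₀ ∈ Ω) {s : ℝ} (hs : 1 ≤ s) :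
    ZeroLip Ω fun x => v (x₀ + s • (x - x₀)) := by
  obtain ⟨⟨B, hB⟩, hv0⟩ := hv
  refine ⟨⟨B * s.toNNReal, LipschitzWith.of_dist_le_mul fun x y => ?_⟩,
    fun x hx => hv0 _ fun h => ?_⟩
  · refine (hB.dist_le_mul _ _).trans (le_of_eq ?_)
    rw [dist_add_left, dist_smul₀, dist_sub_right, NNReal.coe_mul,
      Real.coe_toNNReal _ (by linarith),
      Real.norm_of_nonneg (by linarith), mul_assoc]
  · refine hx ?_
    have := hc.add_smul_sub_mem hx₀ h (t := s⁻¹) ⟨by positivity, inv_le_one_of_one_le₀ hs⟩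
    rwa [add_sub_cancel_left, smul_smul, inv_mul_cancel₀ (by positivity), one_smul,
      add_sub_cancel] at this

theorem ZeroLip.integral_norm_gradient_dilation {v : EuclideanSpace ℝ (Fin n) → ℝ}
    (hv : ZeroLip Ω v) (hc : Convex ℝ Ω) {x₀ : EuclideanSpace ℝ (Fin n)}
    (hx₀ : x₀ ∈ Ω) {s : ℝ} (hs : 1 ≤ s) (θ : ℝ) :
    ∫ x in Ω, ‖gradient (fun x => v (x₀ + s • (x - x₀))) x‖ ^ 2 * heatWeight θ x₀ x =
      ∫ x in Ω, ‖gradient v x‖ ^ 2 * (θ ^ (-(n : ℝ)/2) * (s ^ 2 * (s ^ n)⁻¹ *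
        Real.exp (-(‖x - x₀‖ ^ 2) / (4 * θ * s ^ 2)))) := by
  have hs0 : 0 < s := by linarith
  have hgz : ∀ {w : EuclideanSpace ℝ (Fin n) → ℝ}, ZeroLip Ω w →
      ∀ᵐ x, x ∉ Ω → ‖gradient w x‖ ^ 2 = 0 := fun hw => by
    filter_upwards [hw.ae_fderiv_eq_zero hc] with x hx hxΩ
    simp [gradient, hx hxΩ]
  rw [setIntegral_eq_integral_of_ae_compl_eq_zero, setIntegral_eq_integral_of_ae_compl_eq_zero]
  · set k : EuclideanSpace ℝ (Fin n) → ℝ := fun y => ‖gradient v (x₀ + y)‖ ^ 2 *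
      (θ ^ (-(n : ℝ)/2) * (s ^ 2 * Real.exp (-(‖y‖ ^ 2) / (4 * θ * s ^ 2)))) with hk
    have h1 : ∀ x, ‖gradient (fun x => v (x₀ + s • (x - x₀))) x‖ ^ 2 * heatWeight θ x₀ x =
        k (s • (x - x₀)) := fun x => by
      rw [gradient_comp_dilation, norm_smul, mul_pow, hk, heatWeight]
      simp only [norm_smul, mul_pow, Real.norm_eq_abs, sq_abs]
      rw [show -(s ^ 2 * ‖x - x₀‖ ^ 2) / (4 * θ * s ^ 2) = -‖x - x₀‖ ^ 2 / (4 * θ) by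
        rw [show -(s ^ 2 * ‖x - x₀‖ ^ 2) = -‖x - x₀‖ ^ 2 * s ^ 2 by ring,
          mul_div_mul_right _ _ (by positivity)]]
      ring
    simp only [h1]
    rw [integral_sub_right_eq_self (fun x => k (s • x)) x₀, Measure.integral_comp_smul,
      ← integral_sub_right_eq_self k x₀, smul_eq_mul, ← integral_const_mul]
    congr 1
    ext x
    rw [hk, finrank_euclideanSpace_fin, abs_of_pos (by positivity)]
    simp only [add_sub_cancel]
    ring
  · filter_upwards [hgz hv] with x hx hxΩ
    rw [hx hxΩ, zero_mul]
  · filter_upwards [hgz (hv.comp_dilation hc hx₀ hs)] with x hx hxΩ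
    rw [hx hxΩ, zero_mul]

/-- A Pohozaev-type inequality on convex domains. -/
theorem IsDirichletC2.pohozaev {v : EuclideanSpace ℝ (Fin n) → ℝ} (hv : IsDirichletC2 Ω v)
    (hΩ : IsOpen Ω) (hb : Bornology.IsBounded Ω) (hc : Convex ℝ Ω)
    {x₀ : EuclideanSpace ℝ (Fin n)} (hx₀ : x₀ ∈ Ω) {θ : ℝ} (hθ : 0 < θ) :
    ∫ x in Ω, ‖gradient v x‖ ^ 2 * ((n - ‖x - x₀‖ ^ 2 / (2 * θ)) * heatWeight θ x₀ x) ≤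
      2 * (∫ x in Ω, ‖gradient v x‖ ^ 2 * heatWeight θ x₀ x) +
      2 * ∫ x in Ω, fderiv ℝ v x (x - x₀) * driftLap θ x₀ v x * heatWeight θ x₀ x := by
  have hm := hΩ.measurableSet
  have hG := bddMeas_heatWeight hΩ hb hc θ x₀
  have hl := hv.bddMeas_driftLap hΩ hb θ x₀
  have hgr := hv.zeroLip.bddMeas_norm_gradient_sq
  have hvb := hv.zeroLip.bddMeas hm hb
  set κ : ℝ → ℝ → ℝ := fun s r => θ ^ (-(n : ℝ)/2) * (s ^ 2 * (s ^ n)⁻¹ *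
        Real.exp (-r / (4 * θ * s ^ 2))) with hκ
  set κ' : ℝ → ℝ → ℝ := fun s r => ((2 - n) / s + r / (2 * θ * s ^ 3)) * κ s r with hκ'
  set Φ : ℝ → ℝ := fun s => ∫ x in Ω, ‖gradient v x‖ ^ 2 * κ s (‖x - x₀‖ ^ 2) with hΦ
  have hκ1 : ∀ x, κ 1 (‖x - x₀‖ ^ 2) = heatWeight θ x₀ x := fun x => by simp [hκ, heatWeight]
  have hderiv : HasDerivAt Φ (∫ x in Ω, ‖gradient v x‖ ^ 2 * κ' 1 (‖x - x₀‖ ^ 2)) 1 := by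
    refine hasDerivAt_integral_mul_radial hgr hΩ hb x₀ (a := 1 / 2) (b := 2) (by norm_num) ?_ ?_ ?_
    · intro s hs r
      have hs0 : 0 < s := lt_trans (by norm_num) hs.1
      have e1 := (hasDerivAt_pow n s).inv (by positivity)
      have e2 : HasDerivAt (fun s : ℝ => -r / (4 * θ * s ^ 2)) (r / (2 * θ * s ^ 3)) s := by
        have := (((hasDerivAt_pow 2 s).const_mul (4 * θ)).inv (by positivity)).const_mul (-r)
        simp only [div_eq_mul_inv (-r)]
        refine this.congr_deriv ?_
        field_simp
        norm_num
        ring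
      have e3 := (((hasDerivAt_pow 2 s).mul e1).mul e2.exp).const_mul (θ ^ (-(n : ℝ)/2))
      refine e3.congr_deriv ?_
      rcases n.eq_zero_or_pos with h0 | h0
      · subst h0
        simp [hκ', hκ]
        generalize Real.exp (-r / (4 * θ * s ^ 2)) = z
        field_simp
      · have : s ^ n = s ^ (n - 1) * s := by rw [← pow_succ, Nat.sub_add_cancel h0]
        simp only [hκ', hκ, this, Pi.mul_apply, Pi.inv_apply]
        field_simp
        push_cast
        ring
    · intro s hs
      simp only [hκ]
      fun_prop
    · simp only [hκ', hκ]
      have hne : ∀ q ∈ Icc (1 / 2 : ℝ) 2 ×ˢ (univ : Set ℝ), q.1 ≠ 0 := fun q hq =>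
        ne_of_gt (lt_of_lt_of_le (by norm_num) hq.1.1)
      refine ContinuousOn.mul (.add (.div (by fun_prop) (by fun_prop) hne)
        (.div (by fun_prop) (by fun_prop) fun q hq => ?_)) (.mul (by fun_prop)
        (.mul (.mul (by fun_prop) (.inv₀ (by fun_prop) fun q hq => pow_ne_zero _ (hne q hq)))
        (.rexp (.div (by fun_prop) (by fun_prop) fun q hq => ?_))))
      · exact mul_ne_zero (by positivity) (pow_ne_zero _ (hne q hq))
      · exact mul_ne_zero (by positivity) (pow_ne_zero _ (hne q hq))
  have hineq : ∀ s, 1 < s → -2 * ∫ x in Ω, (s - 1)⁻¹ * (v (x₀ + s • (x - x₀)) - v x) *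
      (driftLap θ x₀ v x * heatWeight θ x₀ x) ≤ slope Φ 1 s := by
    intro s hs
    have hs' : 0 < s - 1 := by linarith
    have hvs := hv.zeroLip.comp_dilation hc hx₀ hs.le
    have hvsb := hvs.bddMeas hm hb
    have i1 : IntegrableOn _ Ω :=
      ((hvs.bddMeas_inner_gradient hv.zeroLip).mul hG).integrableOn hm hb
    have i2 : IntegrableOn _ Ω :=
      ((hv.zeroLip.bddMeas_inner_gradient hv.zeroLip).mul hG).integrableOn hm hb
    have i3 : IntegrableOn _ Ω := (hvs.bddMeas_norm_gradient_sq.mul hG).integrableOn hm hb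
    have i4 : IntegrableOn _ Ω := (hgr.mul hG).integrableOn hm hb
    have i5 : IntegrableOn _ Ω := ((hvsb.mul hl).mul hG).integrableOn hm hb
    have i6 : IntegrableOn _ Ω := ((hvb.mul hl).mul hG).integrableOn hm hb
    have hmono := setIntegral_mono ((i1.sub i2).const_mul 2) (i3.sub i4) fun x => by
      have := mul_le_mul_of_nonneg_right (norm_sq_sub_le_inner
        (gradient (fun x => v (x₀ + s • (x - x₀))) x) (gradient v x)) (heatWeight_pos hθ x₀ x).le
      simp only [Pi.sub_apply]
      linarith
    have hsub2 := integral_sub i3 i4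
    have hsub1 := integral_sub i1 i2
    have hsub3 := integral_sub i5 i6
    simp only [Pi.sub_apply] at hmono
    rw [integral_const_mul, hsub1, hsub2,
      hv.integral_inner_gradient hvs hΩ hb hc, hv.integral_inner_gradient hv.zeroLip hΩ hb hc,
      hv.zeroLip.integral_norm_gradient_dilation hc hx₀ hs.le] at hmono
    rw [slope_def_field, le_div_iff₀ hs']
    have hI : ∫ x in Ω, (s - 1)⁻¹ * (v (x₀ + s • (x - x₀)) - v x) *
      (driftLap θ x₀ v x * heatWeight θ x₀ x) = (s - 1)⁻¹ *
        ∫ x in Ω, (v (x₀ + s • (x - x₀)) * driftLap θ x₀ v x * heatWeight θ x₀ x -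
          v x * driftLap θ x₀ v x * heatWeight θ x₀ x) := by
      rw [← integral_const_mul]
      congr 1
      ext x
      ring
    have hΦ1 : Φ 1 = ∫ x in Ω, ‖gradient v x‖ ^ 2 * heatWeight θ x₀ x := by
      simp only [hΦ, hκ1]
    rw [hI, hsub3, hΦ1]
    have : (s - 1)⁻¹ * (s - 1) = 1 := inv_mul_cancel₀ hs'.ne'
    have h2 : Φ s = ∫ x in Ω, ‖gradient v x‖ ^ 2 * (θ ^ (-(n : ℝ)/2) * (s ^ 2 * (s ^ n)⁻¹ *
        Real.exp (-(‖x - x₀‖ ^ 2) / (4 * θ * s ^ 2)))) := rfl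
    rw [h2]
    refine le_trans (le_of_eq ?_) hmono
    linear_combination (-2 * ((∫ x in Ω, v (x₀ + s • (x - x₀)) * driftLap θ x₀ v x *
      heatWeight θ x₀ x) - ∫ x in Ω, v x * driftLap θ x₀ v x * heatWeight θ x₀ x)) * this
  have hlim : Tendsto (fun s : ℝ => ∫ x in Ω, (s - 1)⁻¹ * (v (x₀ + s • (x - x₀)) - v x) *
      (driftLap θ x₀ v x * heatWeight θ x₀ x)) (𝓝[>] 1)
      (𝓝 (∫ x in Ω, fderiv ℝ v x (x - x₀) * (driftLap θ x₀ v x * heatWeight θ x₀ x))) := by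
    obtain ⟨B, hB⟩ := hv.zeroLip.1
    obtain ⟨-, C, hC⟩ := hl.mul hG
    obtain ⟨-, R, hR⟩ := bddMeas_norm_sub_sq hΩ hb x₀
    have : IsFiniteMeasure (volume.restrict Ω) := isFiniteMeasure_restrict.2 hb.measure_lt_top.ne
    refine tendsto_integral_filter_of_dominated_convergence (fun _ => B * (1 + R) * |C|) ?_ ?_
      (integrable_const _) ?_
    · filter_upwards [self_mem_nhdsWithin] with s hs
      exact (((BddMeas.const _).mul (((hv.zeroLip.comp_dilation hc hx₀ (le_of_lt hs)).bddMeas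
        hm hb).sub hvb)).mul (hl.mul hG)).1
    · filter_upwards [self_mem_nhdsWithin] with s hs
      refine (ae_restrict_iff' hm).2 (Eventually.of_forall fun x hx => ?_)
      have hs' : 0 < s - 1 := sub_pos.2 hs
      rw [norm_mul, norm_mul, norm_inv, Real.norm_of_nonneg hs'.le]
      refine mul_le_mul ?_ ((hC x hx).trans (le_abs_self _)) (norm_nonneg _) ?_
      · rw [inv_mul_le_iff₀ hs', ← dist_eq_norm]
        refine (hB.dist_le_mul _ _).trans ?_
        have : dist (x₀ + s • (x - x₀)) x = (s - 1) * ‖x - x₀‖ := by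
          rw [dist_eq_norm, show x₀ + s • (x - x₀) - x = (s - 1) • (x - x₀) by
            rw [sub_smul, one_smul]; abel, norm_smul, Real.norm_of_nonneg hs'.le]
        have h3 : ‖x - x₀‖ ≤ 1 + R := by
          have := (le_abs_self _).trans (hR x hx)
          nlinarith [sq_nonneg (‖x - x₀‖ - 1)]
        rw [this]
        calc (B : ℝ) * ((s - 1) * ‖x - x₀‖) ≤ B * ((s - 1) * (1 + R)) := by gcongr
          _ = _ := by ring
      · have := (abs_nonneg _).trans (hR x hx)
        positivity
    · refine (ae_restrict_iff' hm).2 (Eventually.of_forall fun x hx => ?_)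
      refine Tendsto.mul_const _ ?_
      have h1 : HasDerivAt (fun s : ℝ => v (x₀ + s • (x - x₀))) (fderiv ℝ v x (x - x₀)) 1 := by
        have hl : HasDerivAt (fun s : ℝ => x₀ + s • (x - x₀)) (x - x₀) 1 := by
          simpa using ((hasDerivAt_id (1 : ℝ)).smul_const (x - x₀)).const_add x₀
        have hx1 : x₀ + (1 : ℝ) • (x - x₀) = x := by simp
        refine HasFDerivAt.comp_hasDerivAt_of_eq (1 : ℝ)
          (hv.differentiableAt x hx).hasFDerivAt hl hx1.symm
      have h2 := (hasDerivWithinAt_iff_tendsto_slope' (self_notMem_Ioi)).1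
        (h1.hasDerivWithinAt (s := Ioi 1))
      refine h2.congr fun s => ?_
      simp [slope_def_field, div_eq_inv_mul]
  have hslope := (hasDerivWithinAt_iff_tendsto_slope' (self_notMem_Ioi)).1
    (hderiv.hasDerivWithinAt (s := Ioi 1))
  have hfin := le_of_tendsto_of_tendsto (hlim.const_mul (-2)) hslope
    (by filter_upwards [self_mem_nhdsWithin] with s hs using hineq s hs)
  have e1 : ∫ x in Ω, ‖gradient v x‖ ^ 2 * κ' 1 (‖x - x₀‖ ^ 2) =
      2 * (∫ x in Ω, ‖gradient v x‖ ^ 2 * heatWeight θ x₀ x) -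
      ∫ x in Ω, ‖gradient v x‖ ^ 2 * ((n - ‖x - x₀‖ ^ 2 / (2 * θ)) * heatWeight θ x₀ x) := by
    rw [← integral_const_mul, ← integral_sub]
    · congr 1
      ext x
      simp only [hκ', hκ1]
      ring
    · exact ((hgr.mul hG).const_mul 2).integrableOn hm hb
    · simp only [div_eq_inv_mul]
      exact (hgr.mul (((BddMeas.const _).sub ((bddMeas_norm_sub_sq hΩ hb x₀).const_mul _)).mul
        hG)).integrableOn hm hb
  simp only [← mul_assoc] at hfin
  simp only [← mul_assoc] at e1 ⊢
  linarith

end Pohozaev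

section Ehrling

open Set Filter Topology
open scoped RealInnerProductSpace

variable {E : Type*} [NormedAddCommGroup E] [InnerProductSpace ℝ E] [FiniteDimensional ℝ E]
  [MeasurableSpace E] [BorelSpace E]

theorem LipschitzWith.integrable_norm_fderiv_sq {w : E → ℝ} {B : NNReal}
    (hw : LipschitzWith B w) (hc : HasCompactSupport w) :
    Integrable fun x => ‖fderiv ℝ w x‖ ^ 2 := by
  have hsupp : Function.support (fun x => ‖fderiv ℝ w x‖ ^ 2) ⊆ tsupport w := fun x hx => by
    refine support_fderiv_subset ℝ (f := w) fun h => hx ?_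
    simp [h]
  rw [← integrableOn_iff_integrable_of_support_subset hsupp]
  have : IsFiniteMeasure (volume.restrict (tsupport w)) :=
    isFiniteMeasure_restrict.2 hc.isCompact.measure_lt_top.ne
  refine Integrable.of_bound ((measurable_fderiv ℝ w).norm.pow_const 2).aestronglyMeasurable
    (B ^ 2) (Eventually.of_forall fun x => ?_)
  rw [norm_pow, norm_norm]
  have := norm_fderiv_le_of_lipschitz ℝ hw (x₀ := x)
  gcongr

/-- The autocorrelation of a compactly supported Lipschitz function decreases slowly. -/
theorem LipschitzWith.integral_sq_sub_autocorrelation_le {w : E → ℝ} {B : NNReal}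
    (hw : LipschitzWith B w) (hc : HasCompactSupport w) (h : E) :
    ∫ x, w x ^ 2 ≤ (∫ x, w x * w (x + h)) +
      ‖h‖ / 2 * ((∫ x, w x ^ 2) + ∫ x, ‖fderiv ℝ w x‖ ^ 2) := by
  have hwc := hw.continuous
  have iw : Integrable w := hwc.integrable_of_hasCompactSupport hc
  have iw2 : Integrable fun x => w x ^ 2 := by
    refine (hwc.pow 2).integrable_of_hasCompactSupport ?_
    simpa only [sq] using hc.mul_right (f' := w)
  have ig := hw.integrable_norm_fderiv_sq hc
  have hderiv : ∀ s : ℝ, HasDerivAt (fun s : ℝ => ∫ x, w x * w (x + s • h))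
      (∫ x, w x * fderiv ℝ w (x + s • h) h) s := fun s => by
    refine (hasDerivAt_integral_of_dominated_loc_of_lip (s := univ) univ_mem
      (bound := fun x => |w x| * (B * ‖h‖)) ?_ ?_ ?_ ?_ (iw.abs.mul_const _) ?_).2
    · exact Eventually.of_forall fun s =>
        (show Continuous fun x => w x * w (x + s • h) by fun_prop).aestronglyMeasurable
    · exact (show Continuous fun x => w x * w (x + s • h) by
        fun_prop).integrable_of_hasCompactSupport hc.mul_right
    · exact hwc.aestronglyMeasurable.mul ((measurable_fderiv_apply_const ℝ w h).comp
        (measurable_add_const _)).aestronglyMeasurable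
    · refine Eventually.of_forall fun x => LipschitzOnWith.of_dist_le_mul fun a _ b _ => ?_
      rw [Real.coe_nnabs, abs_of_nonneg (by positivity), Real.dist_eq, ← mul_sub, abs_mul,
        mul_assoc]
      refine mul_le_mul_of_nonneg_left ?_ (abs_nonneg _)
      have := hw.dist_le_mul (x + a • h) (x + b • h)
      rw [Real.dist_eq, dist_add_left, dist_eq_norm, ← sub_smul, norm_smul] at this
      rw [Real.dist_eq, ← Real.norm_eq_abs (a - b)]
      linarith
    · have hae := (quasiMeasurePreserving_add_right volume (s • h)).ae hw.ae_differentiableAt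
      filter_upwards [hae] with x hx
      refine HasDerivAt.const_mul _ (hx.hasFDerivAt.comp_hasDerivAt s ?_)
      simpa using ((hasDerivAt_id s).smul_const h).const_add x
  have hbound : ∀ s : ℝ, ‖∫ x, w x * fderiv ℝ w (x + s • h) h‖ ≤
      ‖h‖ / 2 * ((∫ x, w x ^ 2) + ∫ x, ‖fderiv ℝ w x‖ ^ 2) := fun s => by
    have ig' := ig.comp_add_right (s • h)
    rw [← integral_add_right_eq_self (fun x => ‖fderiv ℝ w x‖ ^ 2) (s • h), ← integral_add iw2 ig',
      ← integral_const_mul]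
    refine norm_integral_le_of_norm_le ((iw2.add ig').const_mul _)
      (Eventually.of_forall fun x => ?_)
    have h1 := (fderiv ℝ w (x + s • h)).le_opNorm h
    rw [norm_mul]
    calc ‖w x‖ * ‖fderiv ℝ w (x + s • h) h‖
        ≤ ‖w x‖ * (‖fderiv ℝ w (x + s • h)‖ * ‖h‖) := by gcongr
      _ ≤ ‖h‖ / 2 * (‖w x‖ ^ 2 + ‖fderiv ℝ w (x + s • h)‖ ^ 2) := by
        nlinarith [mul_nonneg (norm_nonneg h) (sq_nonneg (‖w x‖ - ‖fderiv ℝ w (x + s • h)‖))]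
      _ = _ := by rw [Real.norm_eq_abs, sq_abs]
  have := convex_univ.norm_image_sub_le_of_norm_hasDerivWithin_le
    (fun s _ => (hderiv s).hasDerivWithinAt) (fun s _ => hbound s) (mem_univ (0 : ℝ))
    (mem_univ (1 : ℝ))
  simp only [one_smul, zero_smul, add_zero, sub_zero, norm_one, mul_one, Real.norm_eq_abs,
    ← sq] at this
  linarith [(abs_le.1 this).1]

/-- An Ehrling-type inequality. -/
theorem LipschitzWith.integral_sq_le {w : E → ℝ} {B : NNReal}
    (hw : LipschitzWith B w) (hc : HasCompactSupport w) {r : ℝ} (hr : 0 < r) :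
    ∫ x, w x ^ 2 ≤ r / 2 * ((∫ x, w x ^ 2) + ∫ x, ‖fderiv ℝ w x‖ ^ 2) +
      (∫ x, |w x|) ^ 2 / volume.real (Metric.ball (0 : E) r) := by
  have hwc := hw.continuous
  have iw : Integrable w := hwc.integrable_of_hasCompactSupport hc
  set S := (∫ x, w x ^ 2) + ∫ x, ‖fderiv ℝ w x‖ ^ 2 with hS
  have hS0 : 0 ≤ S := by positivity
  set a := (∫ x, w x ^ 2) - r / 2 * S with ha
  have hball : 0 < volume (Metric.ball (0 : E) r) := Metric.measure_ball_pos _ _ hr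
  have hballfin : volume (Metric.ball (0 : E) r) ≠ ⊤ := measure_ball_lt_top.ne
  have hle : ∀ h ∈ Metric.ball (0 : E) r, a ≤ ∫ x, w x * w (x + h) := fun h hh => by
    have h1 := hw.integral_sq_sub_autocorrelation_le hc h
    have h2 : ‖h‖ / 2 * S ≤ r / 2 * S := by
      have : ‖h‖ < r := by simpa using hh
      gcongr
    linarith
  have hL : ∫⁻ h : E, ∫⁻ x : E, ‖w x * w (x + h)‖ₑ = (∫⁻ x, ‖w x‖ₑ) ^ 2 := by
    rw [lintegral_lintegral_swap]
    · have : ∀ x, ∫⁻ h : E, ‖w x * w (x + h)‖ₑ = ‖w x‖ₑ * ∫⁻ h, ‖w h‖ₑ := fun x => by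
        simp only [enorm_mul]
        rw [lintegral_const_mul' _ _ enorm_ne_top, lintegral_add_left_eq_self (fun h => ‖w h‖ₑ) x]
      simp only [this]
      rw [lintegral_mul_const _ hwc.enorm.measurable, sq]
    · exact (show Continuous (Function.uncurry fun h x : E => ‖w x * w (x + h)‖ₑ) by
        simp only [Function.uncurry_def]
        fun_prop).aemeasurable
  have hmain : ENNReal.ofReal a * volume (Metric.ball (0 : E) r) ≤ (∫⁻ x, ‖w x‖ₑ) ^ 2 := by
    rw [← hL, ← setLIntegral_const]
    refine (setLIntegral_mono' Metric.isOpen_ball.measurableSet fun h hh => ?_).trans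
      (setLIntegral_le_lintegral _ _)
    refine le_trans ?_ (enorm_integral_le_lintegral_enorm _)
    rw [Real.enorm_eq_ofReal_abs]
    exact ENNReal.ofReal_le_ofReal ((hle h hh).trans (le_abs_self _))
  have hfin : a * volume.real (Metric.ball (0 : E) r) ≤ (∫ x, |w x|) ^ 2 := by
    have e1 : ∫⁻ x, ‖w x‖ₑ = ENNReal.ofReal (∫ x, |w x|) :=
      (ofReal_integral_norm_eq_lintegral_enorm iw).symm
    rw [e1, ← ENNReal.ofReal_pow (by positivity), ← ofReal_measureReal hballfin,
      ← ENNReal.ofReal_mul' measureReal_nonneg,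
      ENNReal.ofReal_le_ofReal_iff (by positivity)] at hmain
    exact hmain
  have hpos : 0 < volume.real (Metric.ball (0 : E) r) := ENNReal.toReal_pos hball.ne' hballfin
  have := (le_div_iff₀ hpos).2 hfin
  linarith

/-- On a finite measure space, pointwise convergence and an `L²` bound imply `L¹` convergence. -/
theorem tendsto_integral_abs_of_sq_bounded {α : Type*} [MeasurableSpace α] {μ : Measure α}
    [IsFiniteMeasure μ] {w : ℕ → α → ℝ} (hm : ∀ j, Integrable (w j) μ)
    (hi : ∀ j, Integrable (fun x => w j x ^ 2) μ) {C : ℝ} (hC : ∀ j, ∫ x, w j x ^ 2 ∂μ ≤ C)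
    (hlim : ∀ᵐ x ∂μ, Tendsto (fun j => w j x) atTop (𝓝 0)) :
    Tendsto (fun j => ∫ x, |w j x| ∂μ) atTop (𝓝 0) := by
  have hC0 : 0 ≤ C := (by positivity : 0 ≤ ∫ x, w 0 x ^ 2 ∂μ).trans (hC 0)
  rw [Metric.tendsto_atTop]
  intro ε hε
  set m := 2 * (C + 1) / ε with hmdef
  have hm0 : 0 < m := by positivity
  have hmin : ∀ j, Integrable (fun x => min |w j x| m) μ := fun j =>
    (hm j).abs.inf (integrable_const m)
  have h1 : Tendsto (fun j => ∫ x, min |w j x| m ∂μ) atTop (𝓝 (∫ x, 0 ∂μ)) := by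
    refine tendsto_integral_of_dominated_convergence (fun _ => m) (fun j => (hmin j).1)
      (integrable_const m) (fun j => Eventually.of_forall fun x => ?_) ?_
    · rw [Real.norm_of_nonneg (by positivity)]
      exact min_le_right _ _
    · filter_upwards [hlim] with x hx
      have := (hx.abs.min (tendsto_const_nhds (x := m)))
      rwa [abs_zero, min_eq_left hm0.le] at this
  rw [integral_zero] at h1
  obtain ⟨N, hN⟩ := (Metric.tendsto_atTop.1 h1) (ε / 2) (by positivity)
  refine ⟨N, fun j hj => ?_⟩
  have h2 := hN j hj
  rw [Real.dist_eq, sub_zero, abs_of_nonneg (by positivity)] at h2 ⊢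
  have h3 : ∫ x, |w j x| ∂μ ≤ ∫ x, (min |w j x| m + m⁻¹ * w j x ^ 2) ∂μ := by
    refine integral_mono (hm j).abs ((hmin j).add ((hi j).const_mul _)) fun x => ?_
    rcases le_total |w j x| m with h | h
    · simp only [min_eq_left h]
      have : 0 ≤ m⁻¹ * w j x ^ 2 := by positivity
      linarith
    · simp only [min_eq_right h]
      have : |w j x| ≤ m⁻¹ * w j x ^ 2 := by
        rw [le_inv_mul_iff₀ hm0, ← sq_abs, sq]
        gcongr
      linarith
  rw [integral_add (hmin j) ((hi j).const_mul _), integral_const_mul] at h3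
  have h4 : m⁻¹ * ∫ x, w j x ^ 2 ∂μ ≤ m⁻¹ * C := by gcongr; exact hC j
  have h5 : m⁻¹ * C ≤ ε / 2 := by
    rw [inv_mul_le_iff₀ hm0, hmdef]
    field_simp
    linarith
  linarith

/-- A compactness criterion in `L²`. -/
theorem ZeroLip.tendsto_integral_sq {Ω : Set E} (hΩ : MeasurableSet Ω) (hb : Bornology.IsBounded Ω)
    (hc : Convex ℝ Ω) {w : ℕ → E → ℝ} (hw : ∀ j, ZeroLip Ω (w j)) {C : ℝ}
    (hC : ∀ j, ∫ x in Ω, w j x ^ 2 ≤ C) (hC' : ∀ j, ∫ x in Ω, ‖fderiv ℝ (w j) x‖ ^ 2 ≤ C)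
    (hlim : ∀ x ∈ Ω, Tendsto (fun j => w j x) atTop (𝓝 0)) :
    Tendsto (fun j => ∫ x in Ω, w j x ^ 2) atTop (𝓝 0) := by
  have hC0 : 0 ≤ C := (by positivity : 0 ≤ ∫ x in Ω, w 0 x ^ 2).trans (hC 0)
  have : IsFiniteMeasure (volume.restrict Ω) := isFiniteMeasure_restrict.2 hb.measure_lt_top.ne
  have hL1 := tendsto_integral_abs_of_sq_bounded (μ := volume.restrict Ω)
    (fun j => ((hw j).bddMeas hΩ hb).integrableOn hΩ hb)
    (fun j => (((hw j).bddMeas hΩ hb).pow 2).integrableOn hΩ hb) hC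
    ((ae_restrict_iff' hΩ).2 (Eventually.of_forall hlim))
  rw [Metric.tendsto_atTop]
  intro ε hε
  set r := ε / (2 * (C + 1)) with hr
  have hr0 : 0 < r := by positivity
  have hE : ∀ j, ∫ x in Ω, w j x ^ 2 ≤ r * C +
      (∫ x in Ω, |w j x|) ^ 2 / volume.real (Metric.ball (0 : E) r) := fun j => by
    obtain ⟨B, hB⟩ := (hw j).1
    have h1 := hB.integral_sq_le ((hw j).hasCompactSupport hb) hr0
    have e1 := setIntegral_eq_integral_of_forall_compl_eq_zero (μ := volume) (s := Ω)
      (f := fun x => w j x ^ 2) fun x hx => by simp [(hw j).2 x hx]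
    have e2 := setIntegral_eq_integral_of_forall_compl_eq_zero (μ := volume) (s := Ω)
      (f := fun x => |w j x|) fun x hx => by simp [(hw j).2 x hx]
    have e3 : ∫ x in Ω, ‖fderiv ℝ (w j) x‖ ^ 2 = ∫ x, ‖fderiv ℝ (w j) x‖ ^ 2 := by
      refine setIntegral_eq_integral_of_ae_compl_eq_zero ?_
      filter_upwards [(hw j).ae_fderiv_eq_zero hc] with x hx hxΩ
      simp [hx hxΩ]
    rw [← e1, ← e2, ← e3] at h1
    refine h1.trans ?_
    have : r / 2 * ((∫ x in Ω, w j x ^ 2) + ∫ x in Ω, ‖fderiv ℝ (w j) x‖ ^ 2) ≤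
        r / 2 * (C + C) := by
      gcongr
      exacts [hC j, hC' j]
    linarith
  have hlim2 : Tendsto (fun j => (∫ x in Ω, |w j x|) ^ 2 / volume.real (Metric.ball (0 : E) r))
      atTop (𝓝 0) := by
    simpa using (hL1.pow 2).div_const (volume.real (Metric.ball (0 : E) r))
  obtain ⟨N, hN⟩ := (Metric.tendsto_atTop.1 hlim2) (ε / 2) (by positivity)
  refine ⟨N, fun j hj => ?_⟩
  have h2 := hN j hj
  rw [Real.dist_eq, sub_zero] at h2
  replace h2 := (le_abs_self _).trans_lt h2
  rw [Real.dist_eq, sub_zero, abs_of_nonneg (by positivity)]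
  have h3 : r * C ≤ ε / 2 := by
    rw [hr, div_mul_eq_mul_div, div_le_div_iff₀ (by positivity) two_pos]
    nlinarith
  linarith [hE j]

end Ehrling

section LTwo

open Set Filter Topology
open scoped RealInnerProductSpace

variable {α : Type*} [MeasurableSpace α] {ν : Measure α} {f g : α → ℝ}

open Classical in
/-- The class of `f` in `L²`, and zero if `f` is not square integrable. -/
noncomputable def toL2 (ν : Measure α) (f : α → ℝ) : Lp ℝ 2 ν :=
  if h : MemLp f 2 ν then h.toLp f else 0

theorem toL2_eq (hf : MemLp f 2 ν) : toL2 ν f = hf.toLp f := dif_pos hf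

theorem coeFn_toL2 (hf : MemLp f 2 ν) : toL2 ν f =ᵐ[ν] f := by
  rw [toL2_eq hf]
  exact hf.coeFn_toLp

theorem toL2_sub (hf : MemLp f 2 ν) (hg : MemLp g 2 ν) :
    toL2 ν (fun x => f x - g x) = toL2 ν f - toL2 ν g := by
  rw [toL2_eq hf, toL2_eq hg, ← MemLp.toLp_sub]
  exact toL2_eq (hf.sub hg)

theorem toL2_const_mul (c : ℝ) (hf : MemLp f 2 ν) :
    toL2 ν (fun x => c * f x) = c • toL2 ν f := by
  rw [toL2_eq hf, ← MemLp.toLp_const_smul]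
  exact toL2_eq (hf.const_smul c)

theorem inner_toL2 (hf : MemLp f 2 ν) (hg : MemLp g 2 ν) :
    ⟪toL2 ν f, toL2 ν g⟫ = ∫ x, f x * g x ∂ν := by
  rw [L2.inner_def]
  refine integral_congr_ae ?_
  filter_upwards [coeFn_toL2 hf, coeFn_toL2 hg] with x h1 h2
  rw [h1, h2]
  simp [mul_comm]

theorem norm_toL2_sq (hf : MemLp f 2 ν) : ‖toL2 ν f‖ ^ 2 = ∫ x, f x ^ 2 ∂ν := by
  rw [← real_inner_self_eq_norm_sq, inner_toL2 hf hf]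
  simp only [sq]

theorem tendsto_toL2 [IsFiniteMeasure ν] {ι : Type*} {l : Filter ι} [l.IsCountablyGenerated]
    {F : ι → α → ℝ} {C : ℝ} (hF : ∀ᶠ i in l, AEStronglyMeasurable (F i) ν)
    (hC : ∀ᶠ i in l, ∀ᵐ x ∂ν, |F i x| ≤ C) (hf : AEStronglyMeasurable f ν)
    (hCf : ∀ᵐ x ∂ν, |f x| ≤ C) (hlim : ∀ᵐ x ∂ν, Tendsto (fun i => F i x) l (𝓝 (f x))) :
    Tendsto (fun i => toL2 ν (F i)) l (𝓝 (toL2 ν f)) := by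
  have hfm : MemLp f 2 ν := MemLp.of_bound hf C hCf
  have key : Tendsto (fun i => ∫ x, (F i x - f x) ^ 2 ∂ν) l (𝓝 (∫ _, 0 ∂ν)) := by
    refine tendsto_integral_filter_of_dominated_convergence (fun _ => (C + C) ^ 2) ?_ ?_
      (integrable_const _) ?_
    · filter_upwards [hF] with i hi using (hi.sub hf).pow 2
    · filter_upwards [hC] with i hi
      filter_upwards [hi, hCf] with x h1 h2
      rw [norm_pow, Real.norm_eq_abs]
      have : |F i x - f x| ≤ C + C := (abs_sub _ _).trans (add_le_add h1 h2)
      gcongr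
    · filter_upwards [hlim] with x hx
      simpa using ((hx.sub_const (f x)).pow 2)
  rw [integral_zero] at key
  rw [tendsto_iff_norm_sub_tendsto_zero]
  have h2 : Tendsto (fun i => √(∫ x, (F i x - f x) ^ 2 ∂ν)) l (𝓝 0) := by
    simpa using key.sqrt
  refine h2.congr' ?_
  filter_upwards [hF, hC] with i h1 h3
  have hFm : MemLp (F i) 2 ν := MemLp.of_bound h1 C h3
  have hsub : MemLp (fun x => F i x - f x) 2 ν := hFm.sub hfm
  rw [← toL2_sub hFm hfm, ← norm_toL2_sq hsub, Real.sqrt_sq (norm_nonneg _)]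

/-- Multiplication by the indicator function of a measurable set in `L²`. -/
noncomputable def indicatorL2 (ν : Measure α) (X : Set α) (hX : MeasurableSet X) :
    Lp ℝ 2 ν →L[ℝ] Lp ℝ 2 ν :=
  LinearMap.mkContinuous
    { toFun := fun f => ((Lp.memLp f).indicator hX).toLp (X.indicator f)
      map_add' := fun f g => by
        rw [← MemLp.toLp_add, MemLp.toLp_eq_toLp_iff, ← indicator_add']
        exact (Lp.coeFn_add f g).indicator
      map_smul' := fun c f => by
        rw [RingHom.id_apply, ← MemLp.toLp_const_smul, MemLp.toLp_eq_toLp_iff]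
        refine (Lp.coeFn_smul c f).indicator.trans (.of_eq ?_)
        exact indicator_const_smul X c f } 1 fun f => by
    rw [one_mul, LinearMap.coe_mk, AddHom.coe_mk]
    refine Lp.norm_le_norm_of_ae_le ?_
    filter_upwards [((Lp.memLp f).indicator hX).coeFn_toLp] with x hx
    rw [hx]
    exact norm_indicator_le_norm_self _ _

theorem coeFn_indicatorL2 {X : Set α} (hX : MeasurableSet X) (f : Lp ℝ 2 ν) :
    indicatorL2 ν X hX f =ᵐ[ν] X.indicator f :=
  ((Lp.memLp f).indicator hX).coeFn_toLp

theorem indicatorL2_toL2 {X : Set α} (hX : MeasurableSet X) (hf : MemLp f 2 ν) :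
    indicatorL2 ν X hX (toL2 ν f) = toL2 ν (X.indicator f) := by
  refine Lp.ext ?_
  filter_upwards [coeFn_indicatorL2 hX (toL2 ν f), coeFn_toL2 (hf.indicator hX),
    (coeFn_toL2 hf).indicator (s := X)] with x h1 h2 h3
  rw [h1, h2, h3]

theorem norm_indicatorL2_le {X : Set α} (hX : MeasurableSet X) (f : Lp ℝ 2 ν) :
    ‖indicatorL2 ν X hX f‖ ≤ ‖f‖ := by
  refine Lp.norm_le_norm_of_ae_le ?_
  filter_upwards [coeFn_indicatorL2 hX f] with x hx
  rw [hx]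
  exact norm_indicator_le_norm_self _ _

theorem inner_indicatorL2_comm {X : Set α} (hX : MeasurableSet X) (f g : Lp ℝ 2 ν) :
    ⟪indicatorL2 ν X hX f, g⟫ = ⟪f, indicatorL2 ν X hX g⟫ := by
  rw [L2.inner_def, L2.inner_def]
  refine integral_congr_ae ?_
  filter_upwards [coeFn_indicatorL2 hX f, coeFn_indicatorL2 hX g] with x h1 h2
  rw [h1, h2]
  by_cases hx : x ∈ X <;> simp [hx]

theorem tendsto_indicatorL2 {X : ℕ → Set α} (hX : ∀ m, MeasurableSet (X m))
    (hmem : ∀ᵐ x ∂ν, ∀ᶠ m in atTop, x ∈ X m) (f : Lp ℝ 2 ν) :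
    Tendsto (fun m => indicatorL2 ν (X m) (hX m) f) atTop (𝓝 f) := by
  have hf := Lp.memLp f
  have hsq : Integrable (fun x => (f x) ^ 2) ν := hf.integrable_sq
  have hcoe : toL2 ν f = f := by rw [toL2_eq hf]; exact Lp.toLp_coeFn f hf
  have hd : ∀ m, ‖indicatorL2 ν (X m) (hX m) f - f‖ ^ 2 =
      ∫ x, ((X m).indicator f x - f x) ^ 2 ∂ν := fun m => by
    have h1 := toL2_sub (hf.indicator (hX m)) hf
    have hsub : MemLp (fun x => (X m).indicator f x - f x) 2 ν := (hf.indicator (hX m)).sub hf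
    rw [← norm_toL2_sq hsub]
    rw [h1, ← indicatorL2_toL2 (hX m) hf, hcoe]
  have key : Tendsto (fun m => ∫ x, ((X m).indicator f x - f x) ^ 2 ∂ν) atTop (𝓝 (∫ _, 0 ∂ν)) := by
    refine tendsto_integral_of_dominated_convergence (fun x => f x ^ 2) (fun m => ?_) hsq
      (fun m => Eventually.of_forall fun x => ?_) ?_
    · exact ((hf.1.indicator (hX m)).sub hf.1).pow 2
    · by_cases hx : x ∈ X m <;> simp [hx, sq_nonneg]
    · filter_upwards [hmem] with x hx
      refine tendsto_const_nhds.congr' ?_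
      filter_upwards [hx] with m hm
      simp [hm]
  rw [integral_zero] at key
  rw [tendsto_iff_norm_sub_tendsto_zero]
  have h2 : Tendsto (fun m => √(∫ x, ((X m).indicator f x - f x) ^ 2 ∂ν)) atTop (𝓝 0) := by
    simpa using key.sqrt
  refine h2.congr fun m => ?_
  rw [← hd, Real.sqrt_sq (norm_nonneg _)]

end LTwo

section HeatMeasure

open Set Filter Topology
open scoped RealInnerProductSpace

variable {n : ℕ} {Ω : Set (EuclideanSpace ℝ (Fin n))} {θ : ℝ} {x₀ : EuclideanSpace ℝ (Fin n)}
  {f g : EuclideanSpace ℝ (Fin n) → ℝ}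

/-- The measure on `Ω` with density `heatWeight θ x₀`. -/
noncomputable def heatMeasure (Ω : Set (EuclideanSpace ℝ (Fin n))) (θ : ℝ)
    (x₀ : EuclideanSpace ℝ (Fin n)) : Measure (EuclideanSpace ℝ (Fin n)) :=
  (volume.restrict Ω).withDensity fun x => ENNReal.ofReal (heatWeight θ x₀ x)

theorem heatMeasure_absolutelyContinuous : heatMeasure Ω θ x₀ ≪ volume.restrict Ω :=
  withDensity_absolutelyContinuous _ _

theorem ae_heatMeasure_of_forall (hΩ : IsOpen Ω) {p : EuclideanSpace ℝ (Fin n) → Prop}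
    (hp : ∀ x ∈ Ω, p x) : ∀ᵐ x ∂(heatMeasure Ω θ x₀), p x :=
  heatMeasure_absolutelyContinuous.ae_le
    ((ae_restrict_iff' hΩ.measurableSet).2 (Eventually.of_forall hp))

theorem integral_heatMeasure (hθ : 0 < θ) (f : EuclideanSpace ℝ (Fin n) → ℝ) :
    ∫ x, f x ∂(heatMeasure Ω θ x₀) = ∫ x in Ω, f x * heatWeight θ x₀ x := by
  rw [heatMeasure, integral_withDensity_eq_integral_toReal_smul]
  · refine integral_congr_ae (Eventually.of_forall fun x => ?_)
    simp only [smul_eq_mul, ENNReal.toReal_ofReal (heatWeight_pos hθ x₀ x).le, mul_comm]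
  · exact ((contDiff_heatWeight θ x₀).continuous.measurable).ennreal_ofReal
  · exact Eventually.of_forall fun x => ENNReal.ofReal_lt_top

theorem isFiniteMeasure_heatMeasure (hΩ : IsOpen Ω) (hb : Bornology.IsBounded Ω)
    (hc : Convex ℝ Ω) : IsFiniteMeasure (heatMeasure Ω θ x₀) :=
  isFiniteMeasure_withDensity_ofReal
    ((bddMeas_heatWeight hΩ hb hc θ x₀).integrableOn hΩ.measurableSet hb).2

theorem BddMeas.memLp_heatMeasure (hf : BddMeas Ω f) (hΩ : IsOpen Ω) (hb : Bornology.IsBounded Ω)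
    (hc : Convex ℝ Ω) : MemLp f 2 (heatMeasure Ω θ x₀) := by
  have := isFiniteMeasure_heatMeasure (θ := θ) (x₀ := x₀) hΩ hb hc
  obtain ⟨hm, C, hC⟩ := hf
  exact MemLp.of_bound (hm.mono_ac heatMeasure_absolutelyContinuous) C
    (ae_heatMeasure_of_forall hΩ hC)

theorem inner_toL2_heatMeasure (hf : BddMeas Ω f) (hg : BddMeas Ω g) (hθ : 0 < θ) (hΩ : IsOpen Ω)
    (hb : Bornology.IsBounded Ω) (hc : Convex ℝ Ω) :
    ⟪toL2 (heatMeasure Ω θ x₀) f, toL2 (heatMeasure Ω θ x₀) g⟫ =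
      ∫ x in Ω, f x * g x * heatWeight θ x₀ x := by
  rw [inner_toL2 (hf.memLp_heatMeasure hΩ hb hc) (hg.memLp_heatMeasure hΩ hb hc),
    integral_heatMeasure hθ]

theorem norm_toL2_heatMeasure_sq (hf : BddMeas Ω f) (hθ : 0 < θ) (hΩ : IsOpen Ω)
    (hb : Bornology.IsBounded Ω) (hc : Convex ℝ Ω) :
    ‖toL2 (heatMeasure Ω θ x₀) f‖ ^ 2 = ∫ x in Ω, f x ^ 2 * heatWeight θ x₀ x := by
  rw [norm_toL2_sq (hf.memLp_heatMeasure hΩ hb hc), integral_heatMeasure hθ]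

/-- The heat weight is bounded below on bounded sets. -/
theorem exists_le_heatWeight (hb : Bornology.IsBounded Ω) (hθ : 0 < θ)
    (x₀ : EuclideanSpace ℝ (Fin n)) : ∃ m > 0, ∀ x ∈ Ω, m ≤ heatWeight θ x₀ x := by
  rcases Ω.eq_empty_or_nonempty with rfl | hne
  · exact ⟨1, one_pos, by simp⟩
  obtain ⟨z, -, hz⟩ := hb.isCompact_closure.exists_isMinOn hne.closure
    (contDiff_heatWeight θ x₀).continuous.continuousOn
  exact ⟨_, heatWeight_pos hθ x₀ z, fun x hx => hz (subset_closure hx)⟩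

theorem setIntegral_le_div_of_le_heatWeight {m : ℝ} (hm : 0 < m)
    (hmG : ∀ x ∈ Ω, m ≤ heatWeight θ x₀ x) (hf : BddMeas Ω f) (hf0 : ∀ x, 0 ≤ f x) (hΩ : IsOpen Ω)
    (hb : Bornology.IsBounded Ω) (hc : Convex ℝ Ω) :
    ∫ x in Ω, f x ≤ (∫ x in Ω, f x * heatWeight θ x₀ x) / m := by
  rw [le_div_iff₀ hm, ← integral_mul_const]
  refine setIntegral_mono_on ((hf.mul (BddMeas.const m)).integrableOn hΩ.measurableSet hb)
    ((hf.mul (bddMeas_heatWeight hΩ hb hc θ x₀)).integrableOn hΩ.measurableSet hb)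
    hΩ.measurableSet fun x hx => ?_
  exact mul_le_mul_of_nonneg_left (hmG x hx) (hf0 x)

end HeatMeasure

section Solution

open Set Filter Topology
open scoped RealInnerProductSpace

variable {n : ℕ} {Ω : Set (EuclideanSpace ℝ (Fin n))}

/-- A solution of the parabolic differential inequality on `Ω × (0,T)` with vanishing boundary
values, extended by zero outside `Ω`, with time derivative `w`. -/
structure DirichletSolution (Ω : Set (EuclideanSpace ℝ (Fin n))) (T M : ℝ)
    (u w : EuclideanSpace ℝ (Fin n) → ℝ → ℝ) : Prop where
  regular : ∀ t ∈ Ioo 0 T, IsDirichletC2 Ω fun x => u x t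
  hasDerivAt : ∀ x ∈ Ω, ∀ t ∈ Ioo 0 T, HasDerivAt (u x) (w x t) t
  continuousOn : ∀ x ∈ Ω, ContinuousOn (w x) (Ioo 0 T)
  abs_sub_lap_le : ∀ x ∈ Ω, ∀ t ∈ Ioo 0 T,
    |w x t - lap (fun y => u y t) x| ≤ M * (‖gradient (fun y => u y t) x‖ + |u x t|)

namespace DirichletSolution

variable {T M : ℝ} {u w : EuclideanSpace ℝ (Fin n) → ℝ → ℝ} {t α β : ℝ}

theorem measurable_indicator (h : DirichletSolution Ω T M u w) (hΩ : IsOpen Ω) (ht : t ∈ Ioo 0 T) :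
    Measurable (Ω.indicator fun x => w x t) := by
  obtain ⟨δ, hδ, hδT⟩ : ∃ δ > 0, t + δ < T := ⟨(T - t) / 2, by linarith [ht.2], by linarith [ht.2]⟩
  set s : ℕ → ℝ := fun k => t + δ / ((k : ℝ) + 1) with hs
  have hpos : ∀ k : ℕ, 0 < δ / ((k : ℝ) + 1) := fun k => by positivity
  have hs0 : Tendsto s atTop (𝓝[≠] t) := by
    refine tendsto_nhdsWithin_iff.2 ⟨?_, Eventually.of_forall fun k => ?_⟩
    · have := (tendsto_one_div_add_atTop_nhds_zero_nat (𝕜 := ℝ)).const_mul δ |>.const_add t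
      simpa [hs, div_eq_mul_inv] using this
    · simpa [hs] using (hpos k).ne'
  have hsT : ∀ k, s k ∈ Ioo 0 T := fun k => by
    have : δ / ((k : ℝ) + 1) ≤ δ := div_le_self hδ.le (by simp)
    exact ⟨by linarith [hpos k, ht.1], by simp only [hs]; linarith⟩
  have hcont : ∀ τ ∈ Ioo 0 T, Measurable fun x => u x τ := fun τ hτ => by
    obtain ⟨B, hB⟩ := (h.regular τ hτ).zeroLip.1
    exact hB.continuous.measurable
  refine measurable_of_tendsto_metrizable
    (f := fun k => Ω.indicator fun x => (s k - t)⁻¹ * (u x (s k) - u x t))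
    (fun k => (((hcont _ (hsT k)).sub (hcont t ht)).const_mul _).indicator hΩ.measurableSet)
    (tendsto_pi_nhds.2 fun x => ?_)
  by_cases hx : x ∈ Ω
  · have := (hasDerivAt_iff_tendsto_slope.1 (h.hasDerivAt x hx t ht)).comp hs0
    simpa [hx, Function.comp_def, slope_def_module] using this
  · simp [hx]

theorem bddMeas_deriv (h : DirichletSolution Ω T M u w) (hΩ : IsOpen Ω)
    (hb : Bornology.IsBounded Ω) (hM : 0 ≤ M) (ht : t ∈ Ioo 0 T) :
    BddMeas Ω fun x => w x t := by
  refine ⟨((h.measurable_indicator hΩ ht).aestronglyMeasurable.congr ?_), ?_⟩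
  · exact (ae_restrict_iff' hΩ.measurableSet).2 (Eventually.of_forall fun x hx => by simp [hx])
  · obtain ⟨-, C₁, h₁⟩ := (h.regular t ht).bddMeas_lap hΩ
    obtain ⟨-, C₂, h₂⟩ := (h.regular t ht).zeroLip.bddMeas hΩ.measurableSet hb
    obtain ⟨-, C₃, h₃⟩ := (h.regular t ht).zeroLip.bddMeas_norm_gradient_sq
    refine ⟨M * ((C₃ + 1) + C₂) + C₁, fun x hx => ?_⟩
    have e3 : ‖gradient (fun y => u y t) x‖ ≤ C₃ + 1 := by
      have := (le_abs_self _).trans (h₃ x hx)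
      nlinarith [sq_nonneg (‖gradient (fun y => u y t) x‖ - 1)]
    have := h.abs_sub_lap_le x hx t ht
    have e4 : M * (‖gradient (fun y => u y t) x‖ + |u x t|) ≤ M * ((C₃ + 1) + C₂) :=
      mul_le_mul_of_nonneg_left (add_le_add e3 (h₂ x hx)) hM
    have := h₁ x hx
    have := abs_sub_abs_le_abs_sub (w x t) (lap (fun y => u y t) x)
    linarith

/-- The points of `Ω` at which the time derivative is bounded by `m` on a time interval. -/
def sublevel (Ω : Set (EuclideanSpace ℝ (Fin n))) (w : EuclideanSpace ℝ (Fin n) → ℝ → ℝ)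
    (α β : ℝ) (m : ℕ) : Set (EuclideanSpace ℝ (Fin n)) :=
  {x | x ∈ Ω ∧ ∀ τ ∈ Icc α β, |w x τ| ≤ m}

theorem measurableSet_sublevel (h : DirichletSolution Ω T M u w) (hΩ : IsOpen Ω)
    (hαβ : α ≤ β) (hI : Icc α β ⊆ Ioo 0 T) (m : ℕ) : MeasurableSet (sublevel Ω w α β m) := by
  have : Nonempty (Icc α β) := ⟨⟨α, left_mem_Icc.2 hαβ⟩⟩
  set q := TopologicalSpace.denseSeq (Icc α β)
  have heq : sublevel Ω w α β m =
      Ω ∩ ⋂ k, {x | |Ω.indicator (fun x => w x (q k)) x| ≤ m} := by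
    ext x
    simp only [sublevel, mem_ofPred_eq, mem_inter_iff, mem_iInter]
    refine and_congr_right fun hx => ⟨fun hxm k => ?_, fun hxm τ hτ => ?_⟩
    · simpa [hx] using hxm _ (q k).2
    · have hcl : IsClosed {τ : Icc α β | |w x τ| ≤ m} := by
        refine isClosed_le ?_ continuous_const
        exact (continuousOn_iff_continuous_domRestrict.1 ((h.continuousOn x hx).mono hI)).abs
      exact (TopologicalSpace.denseRange_denseSeq (Icc α β)).induction_on
        (p := fun τ : Icc α β => |w x τ| ≤ m) ⟨τ, hτ⟩ hcl fun k => by simpa [hx] using hxm k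
  rw [heq]
  refine hΩ.measurableSet.inter (MeasurableSet.iInter fun k => ?_)
  exact measurableSet_le (h.measurable_indicator hΩ (hI (q k).2)).norm measurable_const

theorem eventually_mem_sublevel (h : DirichletSolution Ω T M u w) (hI : Icc α β ⊆ Ioo 0 T)
    {x : EuclideanSpace ℝ (Fin n)} (hx : x ∈ Ω) : ∀ᶠ m in atTop, x ∈ sublevel Ω w α β m := by
  obtain ⟨C, hC⟩ := isCompact_Icc.exists_bound_of_continuousOn ((h.continuousOn x hx).mono hI)
  obtain ⟨m₀, hm₀⟩ := exists_nat_ge C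
  filter_upwards [eventually_ge_atTop m₀] with m hm
  exact ⟨hx, fun τ hτ => (hC τ hτ).trans (hm₀.trans (by exact_mod_cast hm))⟩

end DirichletSolution
end Solution

section Solution

open Set Filter Topology
open scoped RealInnerProductSpace

variable {n : ℕ} {Ω : Set (EuclideanSpace ℝ (Fin n))}

namespace IsDirichletC2

variable {v : EuclideanSpace ℝ (Fin n) → ℝ} {θ : ℝ} {x₀ : EuclideanSpace ℝ (Fin n)}

theorem inner_toL2_driftLap (hv : IsDirichletC2 Ω v) {p : EuclideanSpace ℝ (Fin n) → ℝ}
    (hp : ZeroLip Ω p) (hθ : 0 < θ) (hΩ : IsOpen Ω) (hb : Bornology.IsBounded Ω)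
    (hc : Convex ℝ Ω) :
    ⟪toL2 (heatMeasure Ω θ x₀) p, toL2 (heatMeasure Ω θ x₀) (driftLap θ x₀ v)⟫ =
      -∫ x in Ω, ⟪gradient p x, gradient v x⟫ * heatWeight θ x₀ x := by
  rw [inner_toL2_heatMeasure (hp.bddMeas hΩ.measurableSet hb) (hv.bddMeas_driftLap hΩ hb θ x₀)
    hθ hΩ hb hc, hv.integral_inner_gradient hp hΩ hb hc, neg_neg]

theorem neg_inner_toL2_driftLap_self (hv : IsDirichletC2 Ω v) (hθ : 0 < θ) (hΩ : IsOpen Ω)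
    (hb : Bornology.IsBounded Ω) (hc : Convex ℝ Ω) :
    -⟪toL2 (heatMeasure Ω θ x₀) v, toL2 (heatMeasure Ω θ x₀) (driftLap θ x₀ v)⟫ =
      ∫ x in Ω, ‖gradient v x‖ ^ 2 * heatWeight θ x₀ x := by
  rw [hv.inner_toL2_driftLap hv.zeroLip hθ hΩ hb hc, neg_neg]
  simp only [real_inner_self_eq_norm_sq]

end IsDirichletC2

namespace DirichletSolution

variable {T M : ℝ} {u w : EuclideanSpace ℝ (Fin n) → ℝ → ℝ} {t s α β θ : ℝ}
  {x₀ : EuclideanSpace ℝ (Fin n)}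

theorem hasDerivWithinAt_indicatorL2 (h : DirichletSolution Ω T M u w) (hΩ : IsOpen Ω)
    (hb : Bornology.IsBounded Ω) (hc : Convex ℝ Ω) (hM : 0 ≤ M) (hI : Icc α β ⊆ Ioo 0 T)
    {m : ℕ} (hm : MeasurableSet (sublevel Ω w α β m)) (ht : t ∈ Icc α β) :
    HasDerivWithinAt (fun s => indicatorL2 (heatMeasure Ω θ x₀) _ hm
        (toL2 (heatMeasure Ω θ x₀) fun x => u x s))
      (indicatorL2 (heatMeasure Ω θ x₀) _ hm (toL2 (heatMeasure Ω θ x₀) fun x => w x t))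
      (Icc α β) t := by
  set ν := heatMeasure Ω θ x₀
  set X := sublevel Ω w α β m
  have hfin : IsFiniteMeasure ν := isFiniteMeasure_heatMeasure hΩ hb hc
  have hu : ∀ s ∈ Icc α β, MemLp (fun x => u x s) 2 ν := fun s hs =>
    ((h.regular s (hI hs)).zeroLip.bddMeas hΩ.measurableSet hb).memLp_heatMeasure hΩ hb hc
  have hw : MemLp (fun x => w x t) 2 ν :=
    (h.bddMeas_deriv hΩ hb hM (hI ht)).memLp_heatMeasure hΩ hb hc
  rw [hasDerivWithinAt_iff_tendsto_slope, indicatorL2_toL2 hm hw]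
  have key : Tendsto (fun s => toL2 ν fun x => (s - t)⁻¹ * (X.indicator (fun x => u x s) x -
      X.indicator (fun x => u x t) x)) (𝓝[Icc α β \ {t}] t)
      (𝓝 (toL2 ν (X.indicator fun x => w x t))) := by
    refine tendsto_toL2 (C := m) ?_ ?_ (hw.indicator hm).1 ?_ ?_
    · filter_upwards [self_mem_nhdsWithin] with s hs
      exact (((hu s hs.1).indicator hm).1.sub ((hu t ht).indicator hm).1).const_mul _
    · filter_upwards [self_mem_nhdsWithin] with s hs
      refine Eventually.of_forall fun x => ?_
      by_cases hx : x ∈ X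
      · have hst : 0 < |s - t| := abs_pos.2 (sub_ne_zero.2 hs.2)
        have := (convex_Icc α β).norm_image_sub_le_of_norm_hasDerivWithin_le
          (fun τ hτ => (h.hasDerivAt x hx.1 τ (hI hτ)).hasDerivWithinAt) hx.2 ht hs.1
        simp only [hx, indicator_of_mem, abs_mul, abs_inv]
        rw [inv_mul_le_iff₀ hst, mul_comm]
        exact this
      · simp [hx]
    · refine Eventually.of_forall fun x => ?_
      by_cases hx : x ∈ X
      · simpa [hx] using hx.2 t ht
      · simp [hx]
    · refine Eventually.of_forall fun x => ?_
      by_cases hx : x ∈ X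
      · have := (hasDerivAt_iff_tendsto_slope.1 (h.hasDerivAt x hx.1 t (hI ht))).mono_left
          (nhdsWithin_mono t fun s (hs : s ∈ Icc α β \ {t}) => hs.2)
        simpa [hx, slope_fun_def, vsub_eq_sub] using this
      · simpa [hx] using tendsto_const_nhds
  refine key.congr' ?_
  filter_upwards [self_mem_nhdsWithin] with s hs
  have hsub : MemLp
      (fun x => X.indicator (fun x => u x s) x - X.indicator (fun x => u x t) x) 2 ν :=
    ((hu s hs.1).indicator hm).sub ((hu t ht).indicator hm)
  rw [slope_def_module, indicatorL2_toL2 hm (hu s hs.1), indicatorL2_toL2 hm (hu t ht),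
    ← toL2_sub ((hu s hs.1).indicator hm) ((hu t ht).indicator hm), ← toL2_const_mul _ hsub]

theorem continuousOn_indicatorL2 (h : DirichletSolution Ω T M u w) (hΩ : IsOpen Ω)
    (hb : Bornology.IsBounded Ω) (hc : Convex ℝ Ω) (hM : 0 ≤ M) (hI : Icc α β ⊆ Ioo 0 T)
    {m : ℕ} (hm : MeasurableSet (sublevel Ω w α β m)) :
    ContinuousOn (fun t => indicatorL2 (heatMeasure Ω θ x₀) _ hm
      (toL2 (heatMeasure Ω θ x₀) fun x => w x t)) (Icc α β) := by
  intro t ht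
  set ν := heatMeasure Ω θ x₀
  set X := sublevel Ω w α β m
  have hfin : IsFiniteMeasure ν := isFiniteMeasure_heatMeasure hΩ hb hc
  have hw : ∀ s ∈ Icc α β, MemLp (fun x => w x s) 2 ν := fun s hs =>
    (h.bddMeas_deriv hΩ hb hM (hI hs)).memLp_heatMeasure hΩ hb hc
  have hbd : ∀ s ∈ Icc α β, ∀ᵐ x ∂ν, |X.indicator (fun x => w x s) x| ≤ m := fun s hs => by
    refine Eventually.of_forall fun x => ?_
    by_cases hx : x ∈ X
    · simpa [hx] using hx.2 s hs
    · simp [hx]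
  rw [ContinuousWithinAt, indicatorL2_toL2 hm (hw t ht)]
  have key : Tendsto (fun s => toL2 ν (X.indicator fun x => w x s)) (𝓝[Icc α β] t)
      (𝓝 (toL2 ν (X.indicator fun x => w x t))) := by
    refine tendsto_toL2 (C := m) ?_ ?_ ((hw t ht).indicator hm).1 (hbd t ht) ?_
    · filter_upwards [self_mem_nhdsWithin] with s hs using ((hw s hs).indicator hm).1
    · filter_upwards [self_mem_nhdsWithin] with s hs using hbd s hs
    · refine Eventually.of_forall fun x => ?_
      by_cases hx : x ∈ X
      · have := ((h.continuousOn x hx.1).mono hI) t ht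
        simpa [hx] using this.tendsto
      · simpa [hx] using tendsto_const_nhds
  refine key.congr' ?_
  filter_upwards [self_mem_nhdsWithin] with s hs
  rw [indicatorL2_toL2 hm (hw s hs)]

theorem abs_sub_driftLap_le (h : DirichletSolution Ω T M u w) (ht : t ∈ Ioo 0 T) (hθ : 0 < θ)
    {R : ℝ} {x : EuclideanSpace ℝ (Fin n)} (hx : x ∈ Ω) (hR : ‖x - x₀‖ ≤ R) :
    |w x t - driftLap θ x₀ (fun y => u y t) x| ≤
      (M + R / (2 * θ)) * ‖gradient (fun y => u y t) x‖ + M * |u x t| := by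
  have h1 := h.abs_sub_lap_le x hx t ht
  have h2 : |fderiv ℝ (fun y => u y t) x (x - x₀)| ≤ ‖gradient (fun y => u y t) x‖ * R := by
    rw [← inner_gradient_left]
    exact (abs_real_inner_le_norm _ _).trans (by gcongr)
  have h3 : |fderiv ℝ (fun y => u y t) x (x - x₀) / (2 * θ)| ≤
      R / (2 * θ) * ‖gradient (fun y => u y t) x‖ := by
    rw [abs_div, abs_of_pos (by positivity : 0 < 2 * θ), div_mul_eq_mul_div]
    gcongr
    linarith
  have h4 := abs_add_le (w x t - lap (fun y => u y t) x)
    (fderiv ℝ (fun y => u y t) x (x - x₀) / (2 * θ))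
  rw [driftLap, ← sub_add]
  linarith

end DirichletSolution
end Solution

section Solution

open Set Filter Topology
open scoped RealInnerProductSpace

variable {n : ℕ} {Ω : Set (EuclideanSpace ℝ (Fin n))}

namespace DirichletSolution

variable {T M : ℝ} {u w : EuclideanSpace ℝ (Fin n) → ℝ → ℝ} {t s α β θ : ℝ}
  {x₀ : EuclideanSpace ℝ (Fin n)}

theorem tendsto_toL2_of_bounded (h : DirichletSolution Ω T M u w) (hΩ : IsOpen Ω)
    (hb : Bornology.IsBounded Ω) (hc : Convex ℝ Ω) (hI : Icc α β ⊆ Ioo 0 T) (hθ : 0 < θ) {K : ℝ}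
    (hK : 0 ≤ K)
    (hE : ∀ t ∈ Icc α β, ∫ x in Ω, ‖gradient (fun y => u y t) x‖ ^ 2 * heatWeight θ x₀ x ≤
      K * ∫ x in Ω, u x t ^ 2 * heatWeight θ x₀ x)
    (ht : t ∈ Icc α β) {s : ℕ → ℝ} (hs : ∀ j, s j ∈ Icc α β) (hst : Tendsto s atTop (𝓝 t)) {C : ℝ}
    (hC : ∀ j, ‖toL2 (heatMeasure Ω θ x₀) fun x => u x (s j)‖ ≤ C) :
    Tendsto (fun j => toL2 (heatMeasure Ω θ x₀) fun x => u x (s j)) atTop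
      (𝓝 (toL2 (heatMeasure Ω θ x₀) fun x => u x t)) := by
  set ν := heatMeasure Ω θ x₀
  obtain ⟨m, hm, hmG⟩ := exists_le_heatWeight hb hθ x₀
  have hbu : ∀ s ∈ Icc α β, BddMeas Ω fun x => u x s := fun s hs =>
    (h.regular s (hI hs)).zeroLip.bddMeas hΩ.measurableSet hb
  have hLu : ∀ s ∈ Icc α β, MemLp (fun x => u x s) 2 ν := fun s hs =>
    (hbu s hs).memLp_heatMeasure hΩ hb hc
  set w' : ℕ → EuclideanSpace ℝ (Fin n) → ℝ := fun j x => u x (s j) - u x t with hw'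
  have hz : ∀ j, ZeroLip Ω (w' j) := fun j =>
    (h.regular _ (hI (hs j))).zeroLip.sub (h.regular t (hI ht)).zeroLip
  have hzb : ∀ j, BddMeas Ω (w' j) := fun j => (hz j).bddMeas hΩ.measurableSet hb
  have hnorm : ∀ j, ‖toL2 ν (fun x => u x (s j)) - toL2 ν (fun x => u x t)‖ ^ 2 =
      ∫ x in Ω, w' j x ^ 2 * heatWeight θ x₀ x := fun j => by
    rw [← toL2_sub (hLu _ (hs j)) (hLu t ht)]
    exact norm_toL2_heatMeasure_sq (hzb j) hθ hΩ hb hc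
  set B := ‖toL2 ν fun x => u x t‖
  have hC0 : 0 ≤ C := (norm_nonneg _).trans (hC 0)
  have h1 : ∀ j, ∫ x in Ω, w' j x ^ 2 ≤ (C + B) ^ 2 / m := fun j => by
    refine (setIntegral_le_div_of_le_heatWeight hm hmG ((hzb j).pow 2)
      (fun x => sq_nonneg _) hΩ hb hc).trans ?_
    rw [← hnorm j]
    gcongr
    exact (norm_sub_le _ _).trans (add_le_add_left (hC j) _)
  have hgrad : ∀ s ∈ Icc α β, ∫ x in Ω, ‖gradient (fun y => u y s) x‖ ^ 2 ≤
      K * ‖toL2 ν fun x => u x s‖ ^ 2 / m := fun s hs => by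
    refine (setIntegral_le_div_of_le_heatWeight hm hmG
      (h.regular s (hI hs)).zeroLip.bddMeas_norm_gradient_sq (fun x => sq_nonneg _)
        hΩ hb hc).trans ?_
    rw [norm_toL2_heatMeasure_sq (hbu s hs) hθ hΩ hb hc]
    gcongr
    exact hE s hs
  have hgi : ∀ s ∈ Icc α β, IntegrableOn (fun x => ‖gradient (fun y => u y s) x‖ ^ 2) Ω :=
    fun s hs => (h.regular s (hI hs)).zeroLip.bddMeas_norm_gradient_sq.integrableOn
      hΩ.measurableSet hb
  have h2 : ∀ j, ∫ x in Ω, ‖fderiv ℝ (w' j) x‖ ^ 2 ≤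
      2 * (K * C ^ 2 / m) + 2 * (K * B ^ 2 / m) := fun j => by
    have e1 : ∫ x in Ω, ‖fderiv ℝ (w' j) x‖ ^ 2 ≤
        ∫ x in Ω, (2 * ‖gradient (fun y => u y (s j)) x‖ ^ 2 +
          2 * ‖gradient (fun y => u y t) x‖ ^ 2) := by
      refine setIntegral_mono_on ?_ (((hgi _ (hs j)).const_mul 2).add ((hgi t ht).const_mul 2))
        hΩ.measurableSet fun x hx => ?_
      · have := (hz j).bddMeas_norm_gradient_sq.integrableOn hΩ.measurableSet hb
        simpa only [gradient, LinearIsometryEquiv.norm_map] using this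
      · have hd : fderiv ℝ (w' j) x = fderiv ℝ (fun y => u y (s j)) x -
            fderiv ℝ (fun y => u y t) x :=
          fderiv_fun_sub ((h.regular _ (hI (hs j))).differentiableAt x hx)
            ((h.regular t (hI ht)).differentiableAt x hx)
        rw [hd]
        simp only [gradient, LinearIsometryEquiv.norm_map]
        have := norm_sub_le (fderiv ℝ (fun y => u y (s j)) x) (fderiv ℝ (fun y => u y t) x)
        nlinarith [norm_nonneg (fderiv ℝ (fun y => u y (s j)) x - fderiv ℝ (fun y => u y t) x),
          sq_nonneg (‖fderiv ℝ (fun y => u y (s j)) x‖ - ‖fderiv ℝ (fun y => u y t) x‖)]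
    rw [integral_add ((hgi _ (hs j)).const_mul 2) ((hgi t ht).const_mul 2), integral_const_mul,
      integral_const_mul] at e1
    refine e1.trans (add_le_add (mul_le_mul_of_nonneg_left ?_ two_pos.le)
      (mul_le_mul_of_nonneg_left (hgrad t ht) two_pos.le))
    refine (hgrad _ (hs j)).trans ?_
    gcongr
    exact hC j
  have hlim : ∀ x ∈ Ω, Tendsto (fun j => w' j x) atTop (𝓝 0) := fun x hx => by
    have := ((h.hasDerivAt x hx t (hI ht)).continuousAt.tendsto.comp hst).sub_const (u x t)
    simpa [hw', Function.comp_def] using this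
  have h3 := ZeroLip.tendsto_integral_sq hΩ.measurableSet hb hc hz
    (C := (C + B) ^ 2 / m + (2 * (K * C ^ 2 / m) + 2 * (K * B ^ 2 / m)))
    (fun j => (h1 j).trans (le_add_of_nonneg_right (by positivity)))
    (fun j => (h2 j).trans (le_add_of_nonneg_left (by positivity))) hlim
  obtain ⟨-, G, hG⟩ := bddMeas_heatWeight hΩ hb hc θ x₀
  have h4 : Tendsto (fun j => ∫ x in Ω, w' j x ^ 2 * heatWeight θ x₀ x) atTop (𝓝 0) := by
    refine squeeze_zero (fun j => integral_nonneg fun x =>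
      mul_nonneg (sq_nonneg _) (heatWeight_pos hθ x₀ x).le) (fun j => ?_)
      (by simpa using h3.mul_const G)
    rw [← integral_mul_const]
    refine setIntegral_mono_on
      ((((hzb j).pow 2).mul (bddMeas_heatWeight hΩ hb hc θ x₀)).integrableOn hΩ.measurableSet hb)
      ((((hzb j).pow 2).mul (BddMeas.const G)).integrableOn hΩ.measurableSet hb)
      hΩ.measurableSet fun x hx => ?_
    exact mul_le_mul_of_nonneg_left ((le_abs_self _).trans (hG x hx)) (sq_nonneg _)
  rw [tendsto_iff_norm_sub_tendsto_zero]
  have h5 := h4.sqrt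
  rw [Real.sqrt_zero] at h5
  refine h5.congr fun j => ?_
  rw [← hnorm j, Real.sqrt_sq (norm_nonneg _)]

theorem evolutionData (h : DirichletSolution Ω T M u w) (hΩ : IsOpen Ω)
    (hb : Bornology.IsBounded Ω) (hc : Convex ℝ Ω) (hM : 0 ≤ M) (hαβ : α ≤ β)
    (hI : Icc α β ⊆ Ioo 0 T) (hθ : 0 < θ) {R K c : ℝ} (hR : ∀ x ∈ Ω, ‖x - x₀‖ ≤ R)
    (hK : 0 ≤ K)
    (hE : ∀ t ∈ Icc α β, ∫ x in Ω, ‖gradient (fun y => u y t) x‖ ^ 2 * heatWeight θ x₀ x ≤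
      K * ∫ x in Ω, u x t ^ 2 * heatWeight θ x₀ x)
    (hc0 : 0 ≤ c) (hcc : 2 * (M + R / (2 * θ)) ^ 2 * K + 2 * M ^ 2 ≤ c ^ 2)
    (hshort : (7 * K + 1 + 2 * c ^ 2) * (β - α) ≤ 1 / 2) :
    EvolutionData α β (fun t => toL2 (heatMeasure Ω θ x₀) fun x => u x t)
      (fun t => toL2 (heatMeasure Ω θ x₀) fun x => w x t)
      (fun t => toL2 (heatMeasure Ω θ x₀) (driftLap θ x₀ fun x => u x t))
      (fun m => indicatorL2 (heatMeasure Ω θ x₀) _ (h.measurableSet_sublevel hΩ hαβ hI m)) K c := by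
  have hr : ∀ t ∈ Icc α β, IsDirichletC2 Ω fun x => u x t := fun t ht => h.regular t (hI ht)
  have hbu : ∀ t ∈ Icc α β, BddMeas Ω fun x => u x t := fun t ht =>
    (hr t ht).zeroLip.bddMeas hΩ.measurableSet hb
  have hG := bddMeas_heatWeight hΩ hb hc θ x₀
  have hD : ∀ t ∈ Icc α β, BddMeas Ω fun x =>
      ‖gradient (fun y => u y t) x‖ ^ 2 * heatWeight θ x₀ x := fun t ht =>
    (hr t ht).zeroLip.bddMeas_norm_gradient_sq.mul hG
  have hint : ∀ {f : EuclideanSpace ℝ (Fin n) → ℝ}, BddMeas Ω f → IntegrableOn f Ω := fun hf =>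
    hf.integrableOn hΩ.measurableSet hb
  refine
    { K_nonneg := hK
      c_nonneg := hc0
      P_symm := fun m x y => inner_indicatorL2_comm _ x y
      P_le := fun m x => norm_indicatorL2_le _ x
      P_tendsto := fun x => tendsto_indicatorL2 _
        (ae_heatMeasure_of_forall hΩ fun x hx => h.eventually_mem_sublevel hI hx) x
      hasDeriv := fun m t ht => h.hasDerivWithinAt_indicatorL2 hΩ hb hc hM hI _ ht
      cont := fun m => h.continuousOn_indicatorL2 hΩ hb hc hM hI _
      symm := fun s hs t ht => ?_
      cross := fun s hs t ht => ?_
      err := fun t ht => ?_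
      energy := fun t ht => ?_
      compact := fun t ht s hs hst ⟨C, hC⟩ =>
        h.tendsto_toL2_of_bounded hΩ hb hc hI hθ hK hE ht hs hst hC
      short := hshort }
  · rw [(hr t ht).inner_toL2_driftLap (hr s hs).zeroLip hθ hΩ hb hc,
      (hr s hs).inner_toL2_driftLap (hr t ht).zeroLip hθ hΩ hb hc]
    simp only [real_inner_comm]
  · rw [(hr s hs).neg_inner_toL2_driftLap_self hθ hΩ hb hc,
      (hr t ht).neg_inner_toL2_driftLap_self hθ hΩ hb hc,
      (hr t ht).inner_toL2_driftLap (hr s hs).zeroLip hθ hΩ hb hc, abs_neg,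
      ← integral_add (hint (hD s hs)) (hint (hD t ht)), ← integral_div]
    refine (abs_integral_le_integral_abs).trans (setIntegral_mono_on
      (hint ((((hr s hs).zeroLip.bddMeas_inner_gradient (hr t ht).zeroLip).mul hG).abs))
      (((hint (hD s hs)).add (hint (hD t ht))).div_const 2) hΩ.measurableSet fun x _ => ?_)
    have hG0 := (heatWeight_pos hθ x₀ x).le
    have h1 := abs_real_inner_le_norm (gradient (fun y => u y s) x) (gradient (fun y => u y t) x)
    rw [abs_mul, abs_of_nonneg hG0, ← add_mul, mul_div_right_comm]
    refine mul_le_mul_of_nonneg_right ?_ hG0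
    nlinarith [sq_nonneg (‖gradient (fun y => u y s) x‖ - ‖gradient (fun y => u y t) x‖)]
  · have hbd := (h.bddMeas_deriv hΩ hb hM (hI ht)).sub ((hr t ht).bddMeas_driftLap hΩ hb θ x₀)
    refine abs_le_of_sq_le_sq' ?_ (by positivity) |>.2
    rw [← toL2_sub ((h.bddMeas_deriv hΩ hb hM (hI ht)).memLp_heatMeasure hΩ hb hc)
      (((hr t ht).bddMeas_driftLap hΩ hb θ x₀).memLp_heatMeasure hΩ hb hc),
      norm_toL2_heatMeasure_sq hbd hθ hΩ hb hc, mul_pow,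
      norm_toL2_heatMeasure_sq (hbu t ht) hθ hΩ hb hc]
    have hu2 := ((hbu t ht).pow 2).mul hG
    have hpos : 0 ≤ ∫ x in Ω, u x t ^ 2 * heatWeight θ x₀ x := integral_nonneg fun x =>
      mul_nonneg (sq_nonneg _) (heatWeight_pos hθ x₀ x).le
    have e1 : ∫ x in Ω, (w x t - driftLap θ x₀ (fun y => u y t) x) ^ 2 * heatWeight θ x₀ x ≤
        ∫ x in Ω, (2 * (M + R / (2 * θ)) ^ 2 *
          (‖gradient (fun y => u y t) x‖ ^ 2 * heatWeight θ x₀ x) +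
          2 * M ^ 2 * (u x t ^ 2 * heatWeight θ x₀ x)) := by
      refine setIntegral_mono_on (hint ((hbd.pow 2).mul hG))
        (((hint (hD t ht)).const_mul _).add ((hint hu2).const_mul _)) hΩ.measurableSet
        fun x hx => ?_
      have h1 := h.abs_sub_driftLap_le (hI ht) hθ hx (hR x hx)
      have h2 : (w x t - driftLap θ x₀ (fun y => u y t) x) ^ 2 ≤
          2 * (M + R / (2 * θ)) ^ 2 * ‖gradient (fun y => u y t) x‖ ^ 2 +
          2 * M ^ 2 * u x t ^ 2 := by
        rw [← sq_abs (w x t - _), ← sq_abs (u x t)]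
        refine (pow_le_pow_left₀ (abs_nonneg _) h1 2).trans ?_
        nlinarith [sq_nonneg ((M + R / (2 * θ)) * ‖gradient (fun y => u y t) x‖ - M * |u x t|)]
      have := mul_le_mul_of_nonneg_right h2 (heatWeight_pos hθ x₀ x).le
      linarith
    rw [integral_add ((hint (hD t ht)).const_mul _) ((hint hu2).const_mul _), integral_const_mul,
      integral_const_mul] at e1
    refine e1.trans ?_
    have := mul_le_mul_of_nonneg_left (hE t ht)
      (by positivity : 0 ≤ 2 * (M + R / (2 * θ)) ^ 2)
    have := mul_le_mul_of_nonneg_right hcc hpos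
    linarith
  · rw [(hr t ht).neg_inner_toL2_driftLap_self hθ hΩ hb hc,
      norm_toL2_heatMeasure_sq (hbu t ht) hθ hΩ hb hc]
    exact hE t ht

end DirichletSolution
end Solution

section Solution

open Set Filter Topology
open scoped RealInnerProductSpace

variable {n : ℕ} {Ω : Set (EuclideanSpace ℝ (Fin n))}

theorem heatWeight_eq_exp {θ : ℝ} (hθ : 0 < θ) (x₀ x : EuclideanSpace ℝ (Fin n)) :
    heatWeight θ x₀ x = rexp (log θ * (-(n : ℝ) / 2) - ‖x - x₀‖ ^ 2 / (4 * θ)) := by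
  rw [heatWeight, Real.rpow_def_of_pos hθ, ← Real.exp_add]
  congr 1
  ring

theorem heatWeight_comparison {θ ℓ R : ℝ} (hθ : 0 < θ) (hℓ : 0 ≤ ℓ)
    {x₀ x : EuclideanSpace ℝ (Fin n)} (hR : ‖x - x₀‖ ≤ R) :
    heatWeight (θ + ℓ) x₀ x ≤
        rexp ((n / (2 * θ) + R ^ 2 / (4 * θ ^ 2)) * ℓ) * heatWeight θ x₀ x ∧
      heatWeight θ x₀ x ≤
        rexp ((n / (2 * θ) + R ^ 2 / (4 * θ ^ 2)) * ℓ) * heatWeight (θ + ℓ) x₀ x := by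
  have hθℓ : 0 < θ + ℓ := by linarith
  have hlog0 : log θ ≤ log (θ + ℓ) := Real.log_le_log hθ (by linarith)
  have hlog1 : log (θ + ℓ) - log θ ≤ ℓ / θ := by
    rw [← Real.log_div hθℓ.ne' hθ.ne']
    refine (Real.log_le_sub_one_of_pos (by positivity)).trans (le_of_eq ?_)
    field_simp
    ring
  have hr : ‖x - x₀‖ ^ 2 ≤ R ^ 2 := by gcongr
  have hq0 : ‖x - x₀‖ ^ 2 / (4 * (θ + ℓ)) ≤ ‖x - x₀‖ ^ 2 / (4 * θ) := by gcongr; linarith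
  have hq1 : ‖x - x₀‖ ^ 2 / (4 * θ) - ‖x - x₀‖ ^ 2 / (4 * (θ + ℓ)) ≤
      R ^ 2 / (4 * θ ^ 2) * ℓ := by
    have e : ‖x - x₀‖ ^ 2 / (4 * θ) - ‖x - x₀‖ ^ 2 / (4 * (θ + ℓ)) =
        ‖x - x₀‖ ^ 2 / (4 * (θ * (θ + ℓ))) * ℓ := by field_simp; ring
    rw [e]
    gcongr
    nlinarith
  have hn : (0 : ℝ) ≤ n := Nat.cast_nonneg n
  have hA : (n : ℝ) / (2 * θ) * ℓ = n / 2 * (ℓ / θ) := by field_simp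
  have hA0 : (0 : ℝ) ≤ n / (2 * θ) * ℓ := by positivity
  have hB0 : 0 ≤ R ^ 2 / (4 * θ ^ 2) * ℓ := by positivity
  rw [heatWeight_eq_exp hθ, heatWeight_eq_exp hθℓ, ← Real.exp_add, ← Real.exp_add]
  refine ⟨Real.exp_le_exp.2 ?_, Real.exp_le_exp.2 ?_⟩
  · nlinarith
  · nlinarith

theorem exp_le_one_add_mul {a ℓ : ℝ} (ha : 0 ≤ a) (hℓ : 0 ≤ ℓ) (hℓ1 : ℓ ≤ 1) :
    rexp (a * ℓ) ≤ 1 + a * rexp a * ℓ := by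
  have h1 : 1 - a * ℓ ≤ rexp (-(a * ℓ)) := by linarith [Real.add_one_le_exp (-(a * ℓ))]
  have h2 : rexp (a * ℓ) * rexp (-(a * ℓ)) = 1 := by rw [← Real.exp_add, add_neg_cancel, exp_zero]
  have h3 : rexp (a * ℓ) ≤ rexp a := Real.exp_le_exp.2 (by nlinarith)
  have h4 := mul_le_mul_of_nonneg_left h1 (Real.exp_pos (a * ℓ)).le
  have h5 := mul_le_mul_of_nonneg_left h3 (mul_nonneg ha hℓ)
  nlinarith

theorem exists_norm_sub_le (hb : Bornology.IsBounded Ω) (x₀ : EuclideanSpace ℝ (Fin n)) :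
    ∃ R, 0 ≤ R ∧ ∀ x ∈ Ω, ‖x - x₀‖ ≤ R := by
  obtain ⟨R, hR⟩ := hb.subset_closedBall x₀
  exact ⟨max R 0, le_max_right _ _, fun x hx =>
    (mem_closedBall_iff_norm.1 (hR hx)).trans (le_max_left _ _)⟩

namespace DirichletSolution

variable {T M : ℝ} {u w : EuclideanSpace ℝ (Fin n) → ℝ → ℝ} {lam t₀ : ℝ}
  {x₀ : EuclideanSpace ℝ (Fin n)}

theorem energy_le_of_frequency_le (h : DirichletSolution Ω T M u w) (hΩ : IsOpen Ω)
    (hb : Bornology.IsBounded Ω) (hc : Convex ℝ Ω) (hlam : 0 < lam) {R : ℝ}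
    (hR : ∀ x ∈ Ω, ‖x - x₀‖ ≤ R) (ht₀ : t₀ ∈ Ioo 0 T) {t : ℝ} (ht : t ∈ Ioo 0 T) (htt : t ≤ t₀)
    (hH : 0 < Hfun Ω T lam x₀ u t) :
    ∫ x in Ω, ‖gradient (fun y => u y t) x‖ ^ 2 * heatWeight (T - t₀ + lam) x₀ x ≤
      rexp (2 * (n / (2 * (T - t₀ + lam)) + R ^ 2 / (4 * (T - t₀ + lam) ^ 2)) * (t₀ - t)) *
        (Nfun Ω T lam x₀ u t / 2) *
        ∫ x in Ω, u x t ^ 2 * heatWeight (T - t₀ + lam) x₀ x := by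
  set θ := T - t₀ + lam with hθdef
  have hθ : 0 < θ := by linarith [ht₀.2]
  have hℓ : 0 ≤ t₀ - t := by linarith
  have hθt : T - t + lam = θ + (t₀ - t) := by rw [hθdef]; ring
  set e := rexp ((n / (2 * θ) + R ^ 2 / (4 * θ ^ 2)) * (t₀ - t)) with he
  have he2 : rexp (2 * (n / (2 * θ) + R ^ 2 / (4 * θ ^ 2)) * (t₀ - t)) = e * e := by
    rw [he, ← Real.exp_add]; congr 1; ring
  have he0 : 0 < e := Real.exp_pos _
  have hint : ∀ {f : EuclideanSpace ℝ (Fin n) → ℝ}, BddMeas Ω f → IntegrableOn f Ω := fun hf =>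
    hf.integrableOn hΩ.measurableSet hb
  have hg := (h.regular t ht).zeroLip.bddMeas_norm_gradient_sq
  have hu := ((h.regular t ht).zeroLip.bddMeas hΩ.measurableSet hb).pow 2
  have hD : ∫ x in Ω, ‖gradient (fun y => u y t) x‖ ^ 2 * heatWeight θ x₀ x ≤
      e * Dfun Ω T lam x₀ u t := by
    rw [Dfun, ← integral_const_mul]
    refine setIntegral_mono_on (hint (hg.mul (bddMeas_heatWeight hΩ hb hc θ x₀)))
      ((hint (hg.mul (bddMeas_heatWeight hΩ hb hc (T - t + lam) x₀))).const_mul _)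
      hΩ.measurableSet fun x hx => ?_
    change _ ≤ e * (_ * heatWeight (T - t + lam) x₀ x)
    rw [hθt]
    have := mul_le_mul_of_nonneg_left (heatWeight_comparison hθ hℓ (hR x hx)).2
      (sq_nonneg ‖gradient (fun y => u y t) x‖)
    linarith
  have hHle : Hfun Ω T lam x₀ u t ≤ e * ∫ x in Ω, u x t ^ 2 * heatWeight θ x₀ x := by
    rw [Hfun, ← integral_const_mul]
    refine setIntegral_mono_on (hint (hu.mul (bddMeas_heatWeight hΩ hb hc (T - t + lam) x₀)))
      ((hint (hu.mul (bddMeas_heatWeight hΩ hb hc θ x₀))).const_mul _)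
      hΩ.measurableSet fun x hx => ?_
    change _ * heatWeight (T - t + lam) x₀ x ≤ _
    rw [hθt]
    have := mul_le_mul_of_nonneg_left (heatWeight_comparison hθ hℓ (hR x hx)).1
      (sq_nonneg (u x t))
    linarith
  have hDN : Dfun Ω T lam x₀ u t = Nfun Ω T lam x₀ u t / 2 * Hfun Ω T lam x₀ u t := by
    rw [Nfun]; field_simp
  have hD0 : 0 ≤ Dfun Ω T lam x₀ u t := integral_nonneg fun x =>
    mul_nonneg (sq_nonneg _) (heatWeight_pos (by rw [hθt]; linarith) x₀ x).le
  have hN0 : 0 ≤ Nfun Ω T lam x₀ u t := by rw [Nfun]; positivity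
  rw [he2]
  calc _ ≤ e * Dfun Ω T lam x₀ u t := hD
    _ = e * (Nfun Ω T lam x₀ u t / 2) * Hfun Ω T lam x₀ u t := by rw [hDN]; ring
    _ ≤ e * (Nfun Ω T lam x₀ u t / 2) * (e * ∫ x in Ω, u x t ^ 2 * heatWeight θ x₀ x) :=
        mul_le_mul_of_nonneg_left hHle (by positivity)
    _ = _ := by ring

/-- A solution whose frequency grows at most linearly backwards from `t₀` is Lipschitz from the
left at `t₀`, in the `L²` sense. -/
theorem exists_integral_sub_sq_le (h : DirichletSolution Ω T M u w) (hΩ : IsOpen Ω)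
    (hb : Bornology.IsBounded Ω) (hc : Convex ℝ Ω) (hM : 0 ≤ M) (hlam : 0 < lam)
    (ht₀ : t₀ ∈ Ioo 0 T) (hH : ∀ t ∈ Ioo 0 T, 0 < Hfun Ω T lam x₀ u t) {a : ℝ}
    (hN : ∀ᶠ t in 𝓝[≤] t₀, Nfun Ω T lam x₀ u t ≤ Nfun Ω T lam x₀ u t₀ + a * (t₀ - t)) :
    ∃ C, ∀ᶠ t in 𝓝[<] t₀, ∫ x in Ω, (u x t₀ - u x t) ^ 2 ≤ C * (t₀ - t) ^ 2 := by
  obtain ⟨R, hR0, hR⟩ := exists_norm_sub_le hb x₀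
  set θ := T - t₀ + lam with hθdef
  have hθ : 0 < θ := by linarith [ht₀.2]
  set A₁ := 2 * (n / (2 * θ) + R ^ 2 / (4 * θ ^ 2)) with hA₁
  have hA₁0 : 0 ≤ A₁ := by positivity
  set A₃ := A₁ * rexp A₁
  have hA₃0 : 0 ≤ A₃ := by positivity
  set κ := Nfun Ω T lam x₀ u t₀ / 2
  have hD0 : 0 ≤ Dfun Ω T lam x₀ u t₀ := integral_nonneg fun x =>
    mul_nonneg (sq_nonneg _) (heatWeight_pos hθ x₀ x).le
  have hκ : 0 ≤ κ := by
    have := hH t₀ ht₀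
    simp only [κ, Nfun]; positivity
  set A₂ := |a| / 2
  have hA₂0 : 0 ≤ A₂ := by positivity
  set A := A₃ * κ + A₂ + A₃ * A₂ with hA
  have hA0 : 0 ≤ A := by positivity
  set K := κ + A with hK
  set c := √(2 * (M + R / (2 * θ)) ^ 2 * K + 2 * M ^ 2) with hcdef
  have hK0 : 0 ≤ K := by positivity
  set S := 7 * K + 1 + 2 * c ^ 2
  have hS : 0 < S := by positivity
  obtain ⟨ε, hε, hεN⟩ := mem_nhdsLE_iff_exists_Icc_subset.1 hN
  obtain ⟨δ, hδ0, hδ1, hδt, hδε, hδS⟩ : ∃ δ > 0, δ ≤ 1 ∧ 0 < t₀ - δ ∧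
      ε ≤ t₀ - δ ∧ δ ≤ 1 / 2 / S := by
    have hε2 : ε < t₀ := hε
    have := ht₀.1
    refine ⟨min (min 1 (t₀ / 2)) (min (t₀ - ε) (1 / 2 / S)), ?_, ?_, ?_, ?_, ?_⟩
    · refine lt_min (lt_min one_pos (by linarith)) (lt_min (by linarith) (by positivity))
    · exact (min_le_left _ _).trans (min_le_left _ _)
    · linarith [min_le_left (min 1 (t₀ / 2)) (min (t₀ - ε) (1 / 2 / S)), min_le_right 1 (t₀ / 2)]
    · linarith [min_le_right (min 1 (t₀ / 2)) (min (t₀ - ε) (1 / 2 / S)),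
        min_le_left (t₀ - ε) (1 / 2 / S)]
    · exact (min_le_right _ _).trans (min_le_right _ _)
  have hI : Icc (t₀ - δ) t₀ ⊆ Ioo 0 T := fun t ht =>
    ⟨hδt.trans_le ht.1, ht.2.trans_lt ht₀.2⟩
  have hu2 : ∀ t, 0 ≤ ∫ x in Ω, u x t ^ 2 * heatWeight θ x₀ x := fun t => integral_nonneg fun x =>
    mul_nonneg (sq_nonneg _) (heatWeight_pos hθ x₀ x).le
  have hE : ∀ t ∈ Icc (t₀ - δ) t₀,
      ∫ x in Ω, ‖gradient (fun y => u y t) x‖ ^ 2 * heatWeight θ x₀ x ≤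
        (κ + A * (t₀ - t)) * ∫ x in Ω, u x t ^ 2 * heatWeight θ x₀ x := fun t ht => by
    refine (h.energy_le_of_frequency_le hΩ hb hc hlam hR ht₀ (hI ht) ht.2 (hH t (hI ht))).trans ?_
    refine mul_le_mul_of_nonneg_right ?_ (hu2 t)
    have hℓ0 : 0 ≤ t₀ - t := by linarith [ht.2]
    have hℓ1 : t₀ - t ≤ 1 := by linarith [ht.1]
    have h1 : Nfun Ω T lam x₀ u t / 2 ≤ κ + A₂ * (t₀ - t) := by
      have h2 : Nfun Ω T lam x₀ u t ≤ Nfun Ω T lam x₀ u t₀ + a * (t₀ - t) :=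
        hεN ⟨hδε.trans ht.1, ht.2⟩
      have h3 := mul_le_mul_of_nonneg_right (le_abs_self a) hℓ0
      simp only [κ, A₂]
      linarith
    calc _ ≤ (1 + A₃ * (t₀ - t)) * (κ + A₂ * (t₀ - t)) :=
          (mul_le_mul_of_nonneg_left h1 (Real.exp_pos _).le).trans
            (mul_le_mul_of_nonneg_right (exp_le_one_add_mul hA₁0 hℓ0 hℓ1) (by positivity))
      _ ≤ κ + A * (t₀ - t) := by
          have := mul_nonneg (mul_nonneg hA₃0 hA₂0) (mul_nonneg hℓ0 (sub_nonneg.2 hℓ1))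
          rw [hA]
          nlinarith
  have hev := h.evolutionData (x₀ := x₀) hΩ hb hc hM (by linarith) hI hθ hR hK0
    (c := c) (fun t ht => (hE t ht).trans (mul_le_mul_of_nonneg_right (by
      have : t₀ - t ≤ 1 := by linarith [ht.1]
      nlinarith) (hu2 t)))
    (Real.sqrt_nonneg _) (Real.sq_sqrt (by positivity)).ge (by
      have := (le_div_iff₀ hS).1 hδS
      linarith)
  have hbu : ∀ t ∈ Icc (t₀ - δ) t₀, BddMeas Ω fun x => u x t := fun t ht =>
    (h.regular t (hI ht)).zeroLip.bddMeas hΩ.measurableSet hb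
  have ht₀I : t₀ ∈ Icc (t₀ - δ) t₀ := ⟨by linarith, le_rfl⟩
  obtain ⟨C, hC⟩ := hev.norm_sub_right_le (by linarith) hκ hA0 (fun t ht => by
      rw [(h.regular t (hI ht)).neg_inner_toL2_driftLap_self hθ hΩ hb hc,
        norm_toL2_heatMeasure_sq (hbu t ht) hθ hΩ hb hc]
      exact hE t ht) (by
      rw [(h.regular t₀ ht₀).neg_inner_toL2_driftLap_self hθ hΩ hb hc,
        norm_toL2_heatMeasure_sq (hbu t₀ ht₀I) hθ hΩ hb hc]
      have := (hH t₀ ht₀).ne'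
      change Dfun Ω T lam x₀ u t₀ = κ * Hfun Ω T lam x₀ u t₀
      simp only [κ, Nfun]
      field_simp)
  obtain ⟨m, hm, hmG⟩ := exists_le_heatWeight hb hθ x₀
  refine ⟨C ^ 2 / m, ?_⟩
  filter_upwards [Ioo_mem_nhdsLT (show t₀ - δ < t₀ by linarith)] with t ht
  have htI : t ∈ Icc (t₀ - δ) t₀ := ⟨ht.1.le, ht.2.le⟩
  have hsub := (hbu t₀ ht₀I).sub (hbu t htI)
  refine (setIntegral_le_div_of_le_heatWeight hm hmG (hsub.pow 2) (fun x => sq_nonneg _)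
    hΩ hb hc).trans ?_
  rw [← norm_toL2_heatMeasure_sq hsub hθ hΩ hb hc,
    toL2_sub ((hbu t₀ ht₀I).memLp_heatMeasure hΩ hb hc) ((hbu t htI).memLp_heatMeasure hΩ hb hc),
    norm_sub_rev, div_mul_eq_mul_div, ← mul_pow]
  gcongr
  exact hC t htI

end DirichletSolution
end Solution

section Solution

open Set Filter Topology
open scoped RealInnerProductSpace

variable {n : ℕ} {Ω : Set (EuclideanSpace ℝ (Fin n))}

theorem hasDerivAt_rpow_mul_exp {T lam s r : ℝ} (hs : 0 < T - s + lam) (a : ℝ) :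
    HasDerivAt (fun s => (T - s + lam) ^ a * rexp (-r / (4 * (T - s + lam))))
      ((T - s + lam) ^ a * rexp (-r / (4 * (T - s + lam))) *
        (-a / (T - s + lam) - r / (4 * (T - s + lam) ^ 2))) s := by
  have h1 : HasDerivAt (fun s : ℝ => T - s + lam) (-1) s := by
    simpa using ((hasDerivAt_id s).const_sub T).add_const lam
  have h2 := h1.rpow_const (p := a) (Or.inl hs.ne')
  have h3 := ((h1.const_mul 4).fun_inv (by positivity)).const_mul (-r)
  refine (h2.fun_mul h3.exp).congr_deriv ?_
  rw [Real.rpow_sub_one hs.ne']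
  simp only [div_eq_mul_inv]
  field_simp
  ring

theorem hasDerivAt_integral_mul_heatWeight {p : EuclideanSpace ℝ (Fin n) → ℝ} (hp : BddMeas Ω p)
    (hΩ : IsOpen Ω) (hb : Bornology.IsBounded Ω) (x₀ : EuclideanSpace ℝ (Fin n)) {T lam t₀ : ℝ}
    (ht₀ : 0 < T - t₀ + lam) :
    HasDerivAt (fun t => ∫ x in Ω, p x * heatWeight (T - t + lam) x₀ x)
      (∫ x in Ω, p x * (heatWeight (T - t₀ + lam) x₀ x *
        (n / (2 * (T - t₀ + lam)) - ‖x - x₀‖ ^ 2 / (4 * (T - t₀ + lam) ^ 2)))) t₀ := by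
  have hpos : ∀ s ∈ Icc (t₀ - 1) (t₀ + (T - t₀ + lam) / 2), 0 < T - s + lam := fun s hs => by
    linarith [hs.2]
  have key := hasDerivAt_integral_mul_radial hp hΩ hb x₀
    (κ := fun s r => (T - s + lam) ^ (-(n : ℝ) / 2) * rexp (-r / (4 * (T - s + lam))))
    (κ' := fun s r => (T - s + lam) ^ (-(n : ℝ) / 2) * rexp (-r / (4 * (T - s + lam))) *
        (-(-(n : ℝ) / 2) / (T - s + lam) - r / (4 * (T - s + lam) ^ 2)))
    (a := t₀ - 1) (b := t₀ + (T - t₀ + lam) / 2) (s₀ := t₀) ⟨by linarith, by linarith⟩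
    (fun s hs r => hasDerivAt_rpow_mul_exp (hpos s (Ioo_subset_Icc_self hs)) _)
    (fun s hs => by fun_prop) ?_
  · refine key.congr_deriv (integral_congr_ae (Eventually.of_forall fun x => ?_))
    simp only [heatWeight]
    congr 2
    field_simp
  · have hne : ∀ q ∈ Icc (t₀ - 1) (t₀ + (T - t₀ + lam) / 2) ×ˢ (univ : Set ℝ),
        T - q.1 + lam ≠ 0 := fun q hq => (hpos q.1 hq.1).ne'
    have hne4 : ∀ q ∈ Icc (t₀ - 1) (t₀ + (T - t₀ + lam) / 2) ×ˢ (univ : Set ℝ),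
        4 * (T - q.1 + lam) ≠ 0 := fun q hq => mul_ne_zero four_ne_zero (hne q hq)
    have hne5 : ∀ q ∈ Icc (t₀ - 1) (t₀ + (T - t₀ + lam) / 2) ×ˢ (univ : Set ℝ),
        4 * (T - q.1 + lam) ^ 2 ≠ 0 :=
      fun q hq => mul_ne_zero four_ne_zero (pow_ne_zero 2 (hne q hq))
    have hc1 : ContinuousOn (fun q : ℝ × ℝ => T - q.1 + lam)
        (Icc (t₀ - 1) (t₀ + (T - t₀ + lam) / 2) ×ˢ (univ : Set ℝ)) := by fun_prop
    refine ((hc1.rpow_const fun q hq => Or.inl (hne q hq)).mul ?_).mul ?_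
    · exact (ContinuousOn.div (by fun_prop) (by fun_prop) hne4).rexp
    · exact (ContinuousOn.div (by fun_prop) hc1 hne).sub
        (ContinuousOn.div (by fun_prop) (by fun_prop) hne5)

/-- Backward difference quotients. -/
theorem HasDerivAt.tendsto_backward_slope {f : ℝ → ℝ} {f' t₀ : ℝ} (hf : HasDerivAt f f' t₀) :
    Tendsto (fun t => (t₀ - t)⁻¹ * (f t₀ - f t)) (𝓝[<] t₀) (𝓝 f') := by
  have := (hasDerivWithinAt_iff_tendsto_slope' (s := Iio t₀) (by simp)).1 hf.hasDerivWithinAt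
  refine this.congr fun t => ?_
  rw [slope_def_field, ← neg_sub t₀, ← neg_sub (f t₀), neg_div_neg_eq, div_eq_inv_mul]

namespace DirichletSolution

variable {T M : ℝ} {u w : EuclideanSpace ℝ (Fin n) → ℝ → ℝ} {lam t₀ : ℝ}
  {x₀ : EuclideanSpace ℝ (Fin n)}

theorem tendsto_integral_slope_mul (h : DirichletSolution Ω T M u w) (hΩ : IsOpen Ω)
    (hb : Bornology.IsBounded Ω) (hM : 0 ≤ M) (ht₀ : t₀ ∈ Ioo 0 T) {C : ℝ}
    (hC : ∀ᶠ t in 𝓝[<] t₀, ∫ x in Ω, (u x t₀ - u x t) ^ 2 ≤ C * (t₀ - t) ^ 2)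
    {f : ℝ → EuclideanSpace ℝ (Fin n) → ℝ} {f₀ : EuclideanSpace ℝ (Fin n) → ℝ} {B : ℝ}
    (hf : ∀ᶠ t in 𝓝[<] t₀, BddMeas Ω (f t) ∧ ∀ x ∈ Ω, |f t x| ≤ B)
    (hlim : ∀ x ∈ Ω, Tendsto (fun t => f t x) (𝓝[<] t₀) (𝓝 (f₀ x))) :
    Tendsto (fun t => (t₀ - t)⁻¹ * ∫ x in Ω, (u x t₀ - u x t) * f t x) (𝓝[<] t₀)
      (𝓝 (∫ x in Ω, w x t₀ * f₀ x)) := by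
  have hmem : ∀ᶠ t in 𝓝[<] t₀, t ∈ Ioo 0 t₀ := Ioo_mem_nhdsLT ht₀.1
  have : IsFiniteMeasure (volume.restrict Ω) := isFiniteMeasure_restrict.2 hb.measure_lt_top.ne
  have hint : ∀ {f : EuclideanSpace ℝ (Fin n) → ℝ}, BddMeas Ω f → IntegrableOn f Ω := fun hf =>
    hf.integrableOn hΩ.measurableSet hb
  refine tendsto_of_seq_tendsto fun s hs => ?_
  obtain ⟨N, hN⟩ := eventually_atTop.1 (hs.eventually (hmem.and (hC.and hf)))
  refine (tendsto_add_atTop_iff_nat N).1 ?_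
  replace hs := (tendsto_add_atTop_iff_nat N).2 hs
  have hN' : ∀ j, _ := fun j => hN (j + N) (Nat.le_add_left N j)
  set σ : ℕ → ℝ := fun j => s (j + N)
  have hW := h.bddMeas_deriv hΩ hb hM ht₀
  have hut : ∀ t ∈ Ioo 0 T, BddMeas Ω fun x => u x t := fun t ht =>
    (h.regular t ht).zeroLip.bddMeas hΩ.measurableSet hb
  have hσT : ∀ j, σ j ∈ Ioo 0 T := fun j => ⟨(hN' j).1.1, (hN' j).1.2.trans ht₀.2⟩
  set Q : ℕ → EuclideanSpace ℝ (Fin n) → ℝ := fun j x =>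
    (t₀ - σ j)⁻¹ * (u x t₀ - u x (σ j)) with hQdef
  have hQ : ∀ j, BddMeas Ω (Q j) := fun j =>
    ((hut t₀ ht₀).sub (hut _ (hσT j))).const_mul _
  have hQ2 : ∀ j, ∫ x in Ω, Q j x ^ 2 ≤ C := fun j => by
    have hpos : 0 < t₀ - σ j := sub_pos.2 (hN' j).1.2
    simp only [hQdef, mul_pow]
    rw [integral_const_mul, inv_pow, inv_mul_le_iff₀ (by positivity), mul_comm]
    exact (hN' j).2.1
  have hd : ∀ j, BddMeas Ω fun x => Q j x - w x t₀ := fun j => (hQ j).sub hW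
  have hL1 : Tendsto (fun j => ∫ x in Ω, |Q j x - w x t₀|) atTop (𝓝 0) := by
    refine tendsto_integral_abs_of_sq_bounded (C := 2 * C + 2 * ∫ x in Ω, w x t₀ ^ 2)
      (fun j => hint (hd j)) (fun j => hint ((hd j).pow 2)) (fun j => ?_)
      ((ae_restrict_iff' hΩ.measurableSet).2 (Eventually.of_forall fun x hx => ?_))
    · calc ∫ x in Ω, (Q j x - w x t₀) ^ 2 ≤ ∫ x in Ω, (2 * Q j x ^ 2 + 2 * w x t₀ ^ 2) :=
            integral_mono (hint ((hd j).pow 2))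
              (((hint ((hQ j).pow 2)).const_mul 2).add ((hint (hW.pow 2)).const_mul 2)) fun x => by
              have := sq_nonneg (Q j x + w x t₀)
              show (Q j x - w x t₀) ^ 2 ≤ 2 * Q j x ^ 2 + 2 * w x t₀ ^ 2
              linarith
        _ = 2 * (∫ x in Ω, Q j x ^ 2) + 2 * ∫ x in Ω, w x t₀ ^ 2 := by
            rw [integral_add ((hint ((hQ j).pow 2)).const_mul 2)
              ((hint (hW.pow 2)).const_mul 2), integral_const_mul, integral_const_mul]
        _ ≤ _ := by linarith [hQ2 j]
    · have := ((h.hasDerivAt x hx t₀ ht₀).tendsto_backward_slope.comp hs).sub_const (w x t₀)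
      simpa [Function.comp_def, hQdef] using this
  have hI1 : Tendsto (fun j => ∫ x in Ω, (Q j x - w x t₀) * f (σ j) x) atTop (𝓝 0) := by
    refine squeeze_zero_norm (fun j => ?_) (by simpa using hL1.mul_const B)
    rw [Real.norm_eq_abs, ← integral_mul_const]
    refine abs_integral_le_integral_abs.trans (setIntegral_mono_on
      (hint ((hd j).mul (hN' j).2.2.1).abs) ((hint (hd j).abs).mul_const B) hΩ.measurableSet
      fun x hx => ?_)
    rw [abs_mul]
    exact mul_le_mul_of_nonneg_left ((hN' j).2.2.2 x hx) (abs_nonneg _)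
  have hI2 : Tendsto (fun j => ∫ x in Ω, w x t₀ * f (σ j) x) atTop
      (𝓝 (∫ x in Ω, w x t₀ * f₀ x)) := by
    refine tendsto_integral_of_dominated_convergence (fun x => |w x t₀| * B)
      (fun j => (hint (hW.mul (hN' j).2.2.1)).1) ((hint hW.abs).mul_const B) (fun j => ?_) ?_
    · refine (ae_restrict_iff' hΩ.measurableSet).2 (Eventually.of_forall fun x hx => ?_)
      rw [Real.norm_eq_abs, abs_mul]
      exact mul_le_mul_of_nonneg_left ((hN' j).2.2.2 x hx) (abs_nonneg _)
    · exact (ae_restrict_iff' hΩ.measurableSet).2 (Eventually.of_forall fun x hx =>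
        ((hlim x hx).comp hs).const_mul _)
  have hsum := hI1.add hI2
  rw [zero_add] at hsum
  refine hsum.congr fun j => ?_
  rw [← integral_add (hint ((hd j).mul (hN' j).2.2.1)) (hint (hW.mul (hN' j).2.2.1)),
    Function.comp_apply, ← integral_const_mul]
  refine integral_congr_ae (Eventually.of_forall fun x => ?_)
  simp only [hQdef]
  ring

end DirichletSolution
end Solution

section Solution

open Set Filter Topology
open scoped RealInnerProductSpace

variable {n : ℕ} {Ω : Set (EuclideanSpace ℝ (Fin n))} {lam T t₀ : ℝ}
  {x₀ : EuclideanSpace ℝ (Fin n)}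

theorem exists_heatWeight_le (hΩ : IsOpen Ω) (hb : Bornology.IsBounded Ω) (hc : Convex ℝ Ω)
    (ht₀ : 0 < T - t₀ + lam) (x₀ : EuclideanSpace ℝ (Fin n)) :
    ∃ B, 0 ≤ B ∧ ∀ t ∈ Icc (t₀ - 1) t₀, ∀ x ∈ Ω, heatWeight (T - t + lam) x₀ x ≤ B := by
  obtain ⟨R, -, hR⟩ := exists_norm_sub_le hb x₀
  obtain ⟨-, G, hG⟩ := bddMeas_heatWeight hΩ hb hc (T - t₀ + lam) x₀
  set a := (n : ℝ) / (2 * (T - t₀ + lam)) + R ^ 2 / (4 * (T - t₀ + lam) ^ 2)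
  have ha : 0 ≤ a := by positivity
  refine ⟨rexp a * |G|, by positivity, fun t ht x hx => ?_⟩
  have h1 := (heatWeight_comparison ht₀ (sub_nonneg.2 ht.2) (hR x hx)).1
  rw [show T - t₀ + lam + (t₀ - t) = T - t + lam by ring] at h1
  refine h1.trans (mul_le_mul (Real.exp_le_exp.2 ?_)
    ((le_abs_self _).trans ((hG x hx).trans (le_abs_self _))) (heatWeight_pos ht₀ x₀ x).le
    (Real.exp_pos _).le)
  exact mul_le_of_le_one_right ha (by linarith [ht.1])

theorem continuousAt_heatWeight (ht₀ : 0 < T - t₀ + lam) (x₀ x : EuclideanSpace ℝ (Fin n)) :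
    ContinuousAt (fun t => heatWeight (T - t + lam) x₀ x) t₀ :=
  (hasDerivAt_rpow_mul_exp ht₀ _).continuousAt

namespace DirichletSolution

variable {M : ℝ} {u w : EuclideanSpace ℝ (Fin n) → ℝ → ℝ}

theorem tendsto_slope_Hfun (h : DirichletSolution Ω T M u w) (hΩ : IsOpen Ω)
    (hb : Bornology.IsBounded Ω) (hc : Convex ℝ Ω) (hM : 0 ≤ M) (hlam : 0 < lam)
    (ht₀ : t₀ ∈ Ioo 0 T) {C : ℝ}
    (hC : ∀ᶠ t in 𝓝[<] t₀, ∫ x in Ω, (u x t₀ - u x t) ^ 2 ≤ C * (t₀ - t) ^ 2) :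
    Tendsto (fun t => (t₀ - t)⁻¹ * (Hfun Ω T lam x₀ u t₀ - Hfun Ω T lam x₀ u t)) (𝓝[<] t₀)
      (𝓝 ((∫ x in Ω, u x t₀ ^ 2 * (heatWeight (T - t₀ + lam) x₀ x *
        (n / (2 * (T - t₀ + lam)) - ‖x - x₀‖ ^ 2 / (4 * (T - t₀ + lam) ^ 2)))) +
        2 * ∫ x in Ω, w x t₀ * (u x t₀ * heatWeight (T - t₀ + lam) x₀ x))) := by
  have hθ : 0 < T - t₀ + lam := by linarith [ht₀.2]
  have hint : ∀ {f : EuclideanSpace ℝ (Fin n) → ℝ}, BddMeas Ω f → IntegrableOn f Ω := fun hf =>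
    hf.integrableOn hΩ.measurableSet hb
  have hut : ∀ t ∈ Ioo 0 T, BddMeas Ω fun x => u x t := fun t ht =>
    (h.regular t ht).zeroLip.bddMeas hΩ.measurableSet hb
  have hG : ∀ t, BddMeas Ω fun x => heatWeight (T - t + lam) x₀ x := fun t =>
    bddMeas_heatWeight hΩ hb hc _ x₀
  obtain ⟨B, hB0, hB⟩ := exists_heatWeight_le hΩ hb hc hθ x₀
  obtain ⟨-, D, hD⟩ := hut t₀ ht₀
  have hpos : ∀ t ∈ Ioo (t₀ - 1) t₀, ∀ x, 0 ≤ heatWeight (T - t + lam) x₀ x := fun t ht x =>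
    (heatWeight_pos (by linarith [ht.2]) x₀ x).le
  have hnear : ∀ᶠ t in 𝓝[<] t₀, t ∈ Ioo (t₀ - 1) t₀ := Ioo_mem_nhdsLT (by linarith)
  have hnear' : ∀ᶠ t in 𝓝[<] t₀, t ∈ Ioo 0 t₀ := Ioo_mem_nhdsLT ht₀.1
  have h1 := (hasDerivAt_integral_mul_heatWeight ((hut t₀ ht₀).pow 2) hΩ hb x₀
    hθ).tendsto_backward_slope
  have h2 := h.tendsto_integral_slope_mul hΩ hb hM ht₀ hC
    (f := fun t x => u x t₀ * heatWeight (T - t + lam) x₀ x)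
    (f₀ := fun x => u x t₀ * heatWeight (T - t₀ + lam) x₀ x) (B := |D| * B) (by
      filter_upwards [hnear] with t ht
      refine ⟨(hut t₀ ht₀).mul (hG t), fun x hx => ?_⟩
      rw [abs_mul, abs_of_nonneg (hpos t ht x)]
      exact mul_le_mul ((hD x hx).trans (le_abs_self _)) (hB t (Ioo_subset_Icc_self ht) x hx)
        (hpos t ht x) (abs_nonneg _))
    (fun x _ => ((continuousAt_heatWeight hθ x₀ x).tendsto.const_mul _).mono_left
      nhdsWithin_le_nhds)
  have h3 : Tendsto (fun t => (t₀ - t)⁻¹ *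
      ∫ x in Ω, (u x t₀ - u x t) ^ 2 * heatWeight (T - t + lam) x₀ x) (𝓝[<] t₀) (𝓝 0) := by
    have hlin : Tendsto (fun t => C * B * (t₀ - t)) (𝓝[<] t₀) (𝓝 0) := by
      have : ContinuousAt (fun t => C * B * (t₀ - t)) t₀ := by fun_prop
      simpa using this.tendsto.mono_left nhdsWithin_le_nhds
    refine squeeze_zero' ?_ ?_ hlin
    · filter_upwards [hnear] with t ht
      have : 0 < t₀ - t := sub_pos.2 ht.2
      exact mul_nonneg (inv_nonneg.2 this.le) (integral_nonneg fun x =>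
        mul_nonneg (sq_nonneg _) (hpos t ht x))
    · filter_upwards [hnear, hnear', hC] with t ht ht' hCt
      have ht0 : 0 < t₀ - t := sub_pos.2 ht.2
      have hd := ((hut t₀ ht₀).sub (hut t ⟨ht'.1, ht'.2.trans ht₀.2⟩)).pow 2
      rw [inv_mul_le_iff₀ ht0]
      calc ∫ x in Ω, (u x t₀ - u x t) ^ 2 * heatWeight (T - t + lam) x₀ x
          ≤ ∫ x in Ω, (u x t₀ - u x t) ^ 2 * B :=
            setIntegral_mono_on (hint (hd.mul (hG t))) ((hint hd).mul_const B) hΩ.measurableSet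
              fun x hx => mul_le_mul_of_nonneg_left (hB t (Ioo_subset_Icc_self ht) x hx)
                (sq_nonneg _)
        _ ≤ C * (t₀ - t) ^ 2 * B := by
            rw [integral_mul_const]
            exact mul_le_mul_of_nonneg_right hCt hB0
        _ = _ := by ring
  have hsum := (h1.add (h2.const_mul 2)).sub h3
  rw [sub_zero] at hsum
  refine hsum.congr' ?_
  filter_upwards [hnear'] with t ht
  have htT : t ∈ Ioo 0 T := ⟨ht.1, ht.2.trans ht₀.2⟩
  have i0 := hint (((hut t₀ ht₀).pow 2).mul (hG t₀))
  have i1 := hint (((hut t₀ ht₀).pow 2).mul (hG t))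
  have i2 := hint (((hut t₀ ht₀).sub (hut t htT)).mul ((hut t₀ ht₀).mul (hG t)))
  have i3 := hint ((((hut t₀ ht₀).sub (hut t htT)).pow 2).mul (hG t))
  have key : Hfun Ω T lam x₀ u t = (∫ x in Ω, u x t₀ ^ 2 * heatWeight (T - t + lam) x₀ x) -
      2 * (∫ x in Ω, (u x t₀ - u x t) * (u x t₀ * heatWeight (T - t + lam) x₀ x)) +
      ∫ x in Ω, (u x t₀ - u x t) ^ 2 * heatWeight (T - t + lam) x₀ x := by
    have i12 : IntegrableOn (fun x => u x t₀ ^ 2 * heatWeight (T - t + lam) x₀ x -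
        2 * ((u x t₀ - u x t) * (u x t₀ * heatWeight (T - t + lam) x₀ x))) Ω :=
      i1.sub (i2.const_mul 2)
    rw [← integral_const_mul, ← integral_sub i1 (i2.const_mul 2), ← integral_add i12 i3]
    refine integral_congr_ae (Eventually.of_forall fun x => ?_)
    change u x t ^ 2 * heatWeight (T - t + lam) x₀ x = _
    ring
  have key0 : Hfun Ω T lam x₀ u t₀ =
      ∫ x in Ω, u x t₀ ^ 2 * heatWeight (T - t₀ + lam) x₀ x := rfl
  rw [key, key0]
  ring

theorem Dfun_sub_le (h : DirichletSolution Ω T M u w) (hΩ : IsOpen Ω)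
    (hb : Bornology.IsBounded Ω) (hc : Convex ℝ Ω) (hlam : 0 < lam)
    (ht₀ : t₀ ∈ Ioo 0 T) {t : ℝ} (ht : t ∈ Ioo 0 T) :
    Dfun Ω T lam x₀ u t₀ - Dfun Ω T lam x₀ u t ≤
      (∫ x in Ω, ‖gradient (fun y => u y t₀) x‖ ^ 2 * heatWeight (T - t₀ + lam) x₀ x) -
      (∫ x in Ω, ‖gradient (fun y => u y t₀) x‖ ^ 2 * heatWeight (T - t + lam) x₀ x) -
      2 * ∫ x in Ω, (u x t₀ - u x t) * (driftLap (T - t + lam) x₀ (fun y => u y t₀) x *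
        heatWeight (T - t + lam) x₀ x) := by
  have hint : ∀ {f : EuclideanSpace ℝ (Fin n) → ℝ}, BddMeas Ω f → IntegrableOn f Ω := fun hf =>
    hf.integrableOn hΩ.measurableSet hb
  have hG := bddMeas_heatWeight hΩ hb hc (T - t + lam) x₀
  have hr := h.regular t ht
  have hr₀ := h.regular t₀ ht₀
  have hz := hr₀.zeroLip.sub hr.zeroLip
  have hgreen := hr₀.integral_inner_gradient hz hΩ hb hc (T - t + lam) x₀
  have i1 := hint (hr₀.zeroLip.bddMeas_norm_gradient_sq.mul hG)
  have i2 := hint (hr.zeroLip.bddMeas_norm_gradient_sq.mul hG)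
  have i3 := hint ((hz.bddMeas_inner_gradient hr₀.zeroLip).mul hG)
  have key : (∫ x in Ω, ‖gradient (fun y => u y t₀) x‖ ^ 2 * heatWeight (T - t + lam) x₀ x) -
      (∫ x in Ω, ‖gradient (fun y => u y t) x‖ ^ 2 * heatWeight (T - t + lam) x₀ x) ≤
      2 * ∫ x in Ω, ⟪gradient (fun y => u y t₀ - u y t) x, gradient (fun y => u y t₀) x⟫ *
        heatWeight (T - t + lam) x₀ x := by
    rw [← integral_sub i1 i2, ← integral_const_mul]
    refine setIntegral_mono_on (i1.sub i2) (i3.const_mul 2) hΩ.measurableSet fun x hx => ?_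
    have hgr : gradient (fun y => u y t₀ - u y t) x =
        gradient (fun y => u y t₀) x - gradient (fun y => u y t) x := by
      rw [gradient, fderiv_fun_sub (hr₀.differentiableAt x hx) (hr.differentiableAt x hx), map_sub]
      rfl
    have h1 := norm_sq_sub_le_inner (gradient (fun y => u y t) x) (gradient (fun y => u y t₀) x)
    rw [hgr, inner_sub_left]
    have h2 := mul_le_mul_of_nonneg_right h1
      (heatWeight_pos (show 0 < T - t + lam by linarith [ht.2]) x₀ x).le
    linarith
  rw [hgreen] at key
  have e1 : Dfun Ω T lam x₀ u t₀ =
    ∫ x in Ω, ‖gradient (fun y => u y t₀) x‖ ^ 2 * heatWeight (T - t₀ + lam) x₀ x := rfl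
  have e2 : Dfun Ω T lam x₀ u t =
    ∫ x in Ω, ‖gradient (fun y => u y t) x‖ ^ 2 * heatWeight (T - t + lam) x₀ x := rfl
  simp only [← mul_assoc]
  linarith

theorem tendsto_slope_Dfun_bound (h : DirichletSolution Ω T M u w) (hΩ : IsOpen Ω)
    (hb : Bornology.IsBounded Ω) (hc : Convex ℝ Ω) (hM : 0 ≤ M) (hlam : 0 < lam)
    (ht₀ : t₀ ∈ Ioo 0 T) {C : ℝ}
    (hC : ∀ᶠ t in 𝓝[<] t₀, ∫ x in Ω, (u x t₀ - u x t) ^ 2 ≤ C * (t₀ - t) ^ 2) :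
    Tendsto (fun t => (t₀ - t)⁻¹ *
      ((∫ x in Ω, ‖gradient (fun y => u y t₀) x‖ ^ 2 * heatWeight (T - t₀ + lam) x₀ x) -
      (∫ x in Ω, ‖gradient (fun y => u y t₀) x‖ ^ 2 * heatWeight (T - t + lam) x₀ x) -
      2 * ∫ x in Ω, (u x t₀ - u x t) * (driftLap (T - t + lam) x₀ (fun y => u y t₀) x *
        heatWeight (T - t + lam) x₀ x))) (𝓝[<] t₀)
      (𝓝 ((∫ x in Ω, ‖gradient (fun y => u y t₀) x‖ ^ 2 * (heatWeight (T - t₀ + lam) x₀ x *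
        (n / (2 * (T - t₀ + lam)) - ‖x - x₀‖ ^ 2 / (4 * (T - t₀ + lam) ^ 2)))) -
        2 * ∫ x in Ω, w x t₀ * (driftLap (T - t₀ + lam) x₀ (fun y => u y t₀) x *
          heatWeight (T - t₀ + lam) x₀ x))) := by
  have hθ : 0 < T - t₀ + lam := by linarith [ht₀.2]
  have hr₀ := h.regular t₀ ht₀
  have hG : ∀ t, BddMeas Ω fun x => heatWeight (T - t + lam) x₀ x := fun t =>
    bddMeas_heatWeight hΩ hb hc _ x₀
  obtain ⟨B, hB0, hB⟩ := exists_heatWeight_le hΩ hb hc hθ x₀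
  obtain ⟨-, E, hE⟩ := hr₀.bddMeas_lap hΩ
  obtain ⟨-, Y, hY⟩ := hr₀.zeroLip.bddMeas_fderiv_sub hΩ hb x₀
  have hnear : ∀ᶠ t in 𝓝[<] t₀, t ∈ Ioo (t₀ - 1) t₀ := Ioo_mem_nhdsLT (by linarith)
  have h1 := (hasDerivAt_integral_mul_heatWeight hr₀.zeroLip.bddMeas_norm_gradient_sq hΩ hb x₀
    hθ).tendsto_backward_slope
  have h2 := h.tendsto_integral_slope_mul hΩ hb hM ht₀ hC
    (f := fun t x => driftLap (T - t + lam) x₀ (fun y => u y t₀) x * heatWeight (T - t + lam) x₀ x)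
    (f₀ := fun x => driftLap (T - t₀ + lam) x₀ (fun y => u y t₀) x *
      heatWeight (T - t₀ + lam) x₀ x) (B := (|E| + |Y| / (2 * (T - t₀ + lam))) * B) (by
      filter_upwards [hnear] with t ht
      have hθt : T - t₀ + lam ≤ T - t + lam := by linarith [ht.2]
      have hG0 := fun x => (heatWeight_pos (hθ.trans_le hθt) x₀ x).le
      refine ⟨(hr₀.bddMeas_driftLap hΩ hb _ x₀).mul (hG t), fun x hx => ?_⟩
      rw [abs_mul, abs_of_nonneg (hG0 x)]
      refine mul_le_mul ?_ (hB t (Ioo_subset_Icc_self ht) x hx) (hG0 x) (by positivity)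
      rw [driftLap]
      refine (abs_sub _ _).trans (add_le_add ((hE x hx).trans (le_abs_self _)) ?_)
      rw [abs_div, abs_of_pos (by linarith : 0 < 2 * (T - t + lam))]
      exact div_le_div₀ (abs_nonneg _) ((hY x hx).trans (le_abs_self _)) (by positivity)
        (by linarith))
    (fun x _ => by
      have hcont : ContinuousAt (fun t => driftLap (T - t + lam) x₀ (fun y => u y t₀) x) t₀ := by
        unfold driftLap
        exact continuousAt_const.sub (continuousAt_const.div (by fun_prop) (by positivity))
      exact (hcont.mul (continuousAt_heatWeight hθ x₀ x)).tendsto.mono_left nhdsWithin_le_nhds)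
  refine (h1.sub (h2.const_mul 2)).congr fun t => ?_
  ring

end DirichletSolution
end Solution

section Frequency

open Set Filter Topology
open scoped RealInnerProductSpace

/-- The Cauchy–Schwarz step in the monotonicity of the frequency of `U`, whose drift Laplacian is
`L` and whose time derivative is `F + L + Y`. -/
theorem frequency_numerator_le {E : Type*} [NormedAddCommGroup E] [InnerProductSpace ℝ E]
    {U L Y F : E} {P Q θ : ℝ} (hP : P ≤ -⟪U, L⟫ / θ + 2 * ⟪Y, L⟫) (hQ : Q = -2 * ⟪U, Y⟫) :
    (P - 2 * ⟪F + L + Y, L⟫) * ‖U‖ ^ 2 - (-⟪U, L⟫) * (Q + 2 * ⟪F + L + Y, U⟫) ≤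
      -⟪U, L⟫ * ‖U‖ ^ 2 / θ + ‖F‖ ^ 2 * ‖U‖ ^ 2 / 2 := by
  have h1 : ⟪U, L + (1 / 2 : ℝ) • F⟫ ^ 2 ≤ ‖U‖ ^ 2 * ‖L + (1 / 2 : ℝ) • F‖ ^ 2 := by
    rw [← mul_pow, ← sq_abs]
    exact pow_le_pow_left₀ (abs_nonneg _) (abs_real_inner_le_norm _ _) 2
  have h2 : ‖L + (1 / 2 : ℝ) • F‖ ^ 2 = ‖L‖ ^ 2 + ⟪F, L⟫ + ‖F‖ ^ 2 / 4 := by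
    rw [norm_add_sq_real, inner_smul_right, norm_smul, real_inner_comm]
    norm_num
    ring
  rw [h2, inner_add_right, inner_smul_right] at h1
  have h3 := mul_le_mul_of_nonneg_right hP (sq_nonneg ‖U‖)
  have h4 : ⟪L, L⟫ = ‖L‖ ^ 2 := real_inner_self_eq_norm_sq L
  rw [hQ]
  simp only [inner_add_left, h4, real_inner_comm U L, real_inner_comm U F, real_inner_comm U Y]
  have h5 : -⟪U, L⟫ * ‖U‖ ^ 2 / θ = -⟪U, L⟫ / θ * ‖U‖ ^ 2 := by ring
  rw [h5]
  linarith [sq_nonneg ⟪U, F⟫]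

variable {n : ℕ} {Ω : Set (EuclideanSpace ℝ (Fin n))} {lam T t₀ : ℝ}
  {x₀ : EuclideanSpace ℝ (Fin n)}

namespace DirichletSolution

variable {M : ℝ} {u w : EuclideanSpace ℝ (Fin n) → ℝ → ℝ}

theorem frequency_numerator_le (h : DirichletSolution Ω T M u w) (hΩ : IsOpen Ω)
    (hb : Bornology.IsBounded Ω) (hc : Convex ℝ Ω) (hM : 0 ≤ M) (hlam : 0 < lam)
    (hx₀ : x₀ ∈ Ω) (ht₀ : t₀ ∈ Ioo 0 T) :
    ((∫ x in Ω, ‖gradient (fun y => u y t₀) x‖ ^ 2 * (heatWeight (T - t₀ + lam) x₀ x *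
        (n / (2 * (T - t₀ + lam)) - ‖x - x₀‖ ^ 2 / (4 * (T - t₀ + lam) ^ 2)))) -
        2 * ∫ x in Ω, w x t₀ * (driftLap (T - t₀ + lam) x₀ (fun y => u y t₀) x *
          heatWeight (T - t₀ + lam) x₀ x)) * Hfun Ω T lam x₀ u t₀ -
      Dfun Ω T lam x₀ u t₀ * ((∫ x in Ω, u x t₀ ^ 2 * (heatWeight (T - t₀ + lam) x₀ x *
        (n / (2 * (T - t₀ + lam)) - ‖x - x₀‖ ^ 2 / (4 * (T - t₀ + lam) ^ 2)))) +
        2 * ∫ x in Ω, w x t₀ * (u x t₀ * heatWeight (T - t₀ + lam) x₀ x)) ≤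
      Dfun Ω T lam x₀ u t₀ * Hfun Ω T lam x₀ u t₀ / (T - t₀ + lam) +
        M ^ 2 * (Dfun Ω T lam x₀ u t₀ + Hfun Ω T lam x₀ u t₀) * Hfun Ω T lam x₀ u t₀ := by
  have hθ : 0 < T - t₀ + lam := by linarith [ht₀.2]
  have hr := h.regular t₀ ht₀
  set θ := T - t₀ + lam with hθdef
  set v := fun y => u y t₀ with hv
  have hvb : BddMeas Ω v := hr.zeroLip.bddMeas hΩ.measurableSet hb
  have hwb : BddMeas Ω fun x => w x t₀ := h.bddMeas_deriv hΩ hb hM ht₀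
  have hlap : BddMeas Ω (lap v) := hr.bddMeas_lap hΩ
  have hdl : BddMeas Ω (driftLap θ x₀ v) := hr.bddMeas_driftLap hΩ hb θ x₀
  have hrad : BddMeas Ω fun x => fderiv ℝ v x (x - x₀) := hr.zeroLip.bddMeas_fderiv_sub hΩ hb x₀
  have hgr := hr.zeroLip.bddMeas_norm_gradient_sq
  have hG := bddMeas_heatWeight hΩ hb hc θ x₀
  set U := toL2 (heatMeasure Ω θ x₀) v
  set L := toL2 (heatMeasure Ω θ x₀) (driftLap θ x₀ v) with hL
  set W := toL2 (heatMeasure Ω θ x₀) (fun x => w x t₀) with hWdef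
  set Y := toL2 (heatMeasure Ω θ x₀) (fun x => (2 * θ)⁻¹ * fderiv ℝ v x (x - x₀)) with hY
  set F := toL2 (heatMeasure Ω θ x₀) (fun x => w x t₀ - lap v x) with hF
  have hW : F + L + Y = W := by
    have e : driftLap θ x₀ v = fun x => lap v x - (2 * θ)⁻¹ * fderiv ℝ v x (x - x₀) := by
      funext x
      rw [driftLap, div_eq_inv_mul]
    rw [hF, hL, hY, e, toL2_sub (hwb.memLp_heatMeasure hΩ hb hc) (hlap.memLp_heatMeasure hΩ hb hc),
      toL2_sub (hlap.memLp_heatMeasure hΩ hb hc)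
        ((hrad.const_mul _).memLp_heatMeasure hΩ hb hc)]
    abel
  have hU : ‖U‖ ^ 2 = Hfun Ω T lam x₀ u t₀ := norm_toL2_heatMeasure_sq hvb hθ hΩ hb hc
  have hD : -⟪U, L⟫ = Dfun Ω T lam x₀ u t₀ := hr.neg_inner_toL2_driftLap_self hθ hΩ hb hc
  have hweight : ∀ f : EuclideanSpace ℝ (Fin n) → ℝ,
      ∫ x in Ω, f x * (heatWeight θ x₀ x * (n / (2 * θ) - ‖x - x₀‖ ^ 2 / (4 * θ ^ 2))) =
      (2 * θ)⁻¹ * ∫ x in Ω, f x * ((n - ‖x - x₀‖ ^ 2 / (2 * θ)) * heatWeight θ x₀ x) := fun f => by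
    rw [← integral_const_mul]
    congr 1 with x
    field_simp
    ring
  have hP : ∫ x in Ω, ‖gradient v x‖ ^ 2 *
      (heatWeight θ x₀ x * (n / (2 * θ) - ‖x - x₀‖ ^ 2 / (4 * θ ^ 2))) ≤
      -⟪U, L⟫ / θ + 2 * ⟪Y, L⟫ := by
    have h1 := mul_le_mul_of_nonneg_left (hr.pohozaev hΩ hb hc hx₀ hθ)
      (show 0 ≤ (2 * θ)⁻¹ by positivity)
    have h2 : ⟪Y, L⟫ = (2 * θ)⁻¹ *
        ∫ x in Ω, fderiv ℝ v x (x - x₀) * driftLap θ x₀ v x * heatWeight θ x₀ x := by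
      rw [hY, hL, inner_toL2_heatMeasure (hrad.const_mul _) hdl hθ hΩ hb hc,
        ← integral_const_mul]
      congr 1 with x
      ring
    have h3 : -⟪U, L⟫ = ∫ x in Ω, ‖gradient v x‖ ^ 2 * heatWeight θ x₀ x := hD
    rw [hweight, h2, h3]
    refine h1.trans (le_of_eq ?_)
    field_simp
  have hQ : ∫ x in Ω, v x ^ 2 *
      (heatWeight θ x₀ x * (n / (2 * θ) - ‖x - x₀‖ ^ 2 / (4 * θ ^ 2))) = -2 * ⟪U, Y⟫ := by
    have h1 := hr.integral_mul_fderiv_sub hΩ hb hc θ x₀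
    have h2 : ⟪U, Y⟫ = (2 * θ)⁻¹ *
        ∫ x in Ω, v x * fderiv ℝ v x (x - x₀) * heatWeight θ x₀ x := by
      rw [hY, inner_toL2_heatMeasure hvb (hrad.const_mul _) hθ hΩ hb hc, ← integral_const_mul]
      congr 1 with x
      ring
    rw [hweight, h2]
    linear_combination (2 * θ)⁻¹ * h1
  have hWL : ⟪W, L⟫ = ∫ x in Ω, w x t₀ * (driftLap θ x₀ v x * heatWeight θ x₀ x) := by
    rw [hWdef, hL, inner_toL2_heatMeasure hwb hdl hθ hΩ hb hc]
    simp only [mul_assoc]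
  have hWU : ⟪W, U⟫ = ∫ x in Ω, w x t₀ * (v x * heatWeight θ x₀ x) := by
    rw [hWdef, inner_toL2_heatMeasure hwb hvb hθ hΩ hb hc]
    simp only [mul_assoc]
  have hFle : ‖F‖ ^ 2 ≤ 2 * M ^ 2 * (Dfun Ω T lam x₀ u t₀ + Hfun Ω T lam x₀ u t₀) := by
    have i1 := (hgr.mul hG).integrableOn hΩ.measurableSet hb
    have i2 := ((hvb.pow 2).mul hG).integrableOn hΩ.measurableSet hb
    have hsum : Dfun Ω T lam x₀ u t₀ + Hfun Ω T lam x₀ u t₀ =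
        ∫ x in Ω, (‖gradient v x‖ ^ 2 * heatWeight θ x₀ x + v x ^ 2 * heatWeight θ x₀ x) :=
      (integral_add i1 i2).symm
    rw [hF, norm_toL2_heatMeasure_sq (hwb.sub hlap) hθ hΩ hb hc, hsum, ← integral_const_mul]
    refine setIntegral_mono_on ((((hwb.sub hlap).pow 2).mul hG).integrableOn hΩ.measurableSet hb)
      ((i1.add i2).const_mul _) hΩ.measurableSet fun x hx => ?_
    have h1 := h.abs_sub_lap_le x hx t₀ ht₀
    have h2 : (w x t₀ - lap v x) ^ 2 ≤ 2 * M ^ 2 * (‖gradient v x‖ ^ 2 + v x ^ 2) := by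
      rw [← sq_abs]
      refine (pow_le_pow_left₀ (abs_nonneg _) h1 2).trans ?_
      rw [mul_pow, ← sq_abs (v x)]
      nlinarith [mul_nonneg (sq_nonneg M) (sq_nonneg (‖gradient v x‖ - |v x|))]
    calc _ ≤ 2 * M ^ 2 * (‖gradient v x‖ ^ 2 + v x ^ 2) * heatWeight θ x₀ x :=
          mul_le_mul_of_nonneg_right h2 (heatWeight_pos hθ x₀ x).le
      _ = _ := by ring
  have key := _root_.frequency_numerator_le (F := F) hP hQ
  rw [hW, hWL, hWU, hU, hD] at key
  have h1 := mul_le_mul_of_nonneg_right hFle (hU ▸ sq_nonneg ‖U‖ : 0 ≤ Hfun Ω T lam x₀ u t₀)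
  linarith

/-- The differential inequality for the frequency of a solution vanishing outside the domain. -/
theorem hasDerivAt_Nfun_le (h : DirichletSolution Ω T M u w) (hΩ : IsOpen Ω)
    (hb : Bornology.IsBounded Ω) (hc : Convex ℝ Ω) (hM : 0 ≤ M) (hlam : 0 < lam)
    (hx₀ : x₀ ∈ Ω) (hH : ∀ t ∈ Ioo 0 T, 0 < Hfun Ω T lam x₀ u t) (ht₀ : t₀ ∈ Ioo 0 T) {N' : ℝ}
    (hN : HasDerivAt (fun t => Nfun Ω T lam x₀ u t) N' t₀) :
    N' ≤ (1 / (T - t₀ + lam) + M ^ 2) * Nfun Ω T lam x₀ u t₀ + 2 * M ^ 2 := by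
  have hθ : 0 < T - t₀ + lam := by linarith [ht₀.2]
  have hN' : ∃ a, ∀ᶠ t in 𝓝[≤] t₀,
      Nfun Ω T lam x₀ u t ≤ Nfun Ω T lam x₀ u t₀ + a * (t₀ - t) := by
    obtain ⟨a, ha⟩ := hN.isBigO_sub.bound
    refine ⟨a, ?_⟩
    filter_upwards [nhdsWithin_le_nhds ha, self_mem_nhdsWithin] with t h1 h2
    rw [Real.norm_eq_abs, Real.norm_eq_abs, abs_sub_comm t,
      abs_of_nonneg (sub_nonneg.2 (mem_Iic.1 h2))] at h1
    linarith [le_abs_self (Nfun Ω T lam x₀ u t - Nfun Ω T lam x₀ u t₀)]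
  obtain ⟨a, ha⟩ := hN'
  obtain ⟨C, hC⟩ := h.exists_integral_sub_sq_le hΩ hb hc hM hlam ht₀ hH ha
  have hnum := h.frequency_numerator_le hΩ hb hc hM hlam hx₀ ht₀
  have hs := h.tendsto_slope_Hfun hΩ hb hc hM hlam (x₀ := x₀) ht₀ hC
  have hq := h.tendsto_slope_Dfun_bound hΩ hb hc hM hlam (x₀ := x₀) ht₀ hC
  revert hnum hs hq
  generalize (∫ x in Ω, u x t₀ ^ 2 * (heatWeight (T - t₀ + lam) x₀ x *
    (n / (2 * (T - t₀ + lam)) - ‖x - x₀‖ ^ 2 / (4 * (T - t₀ + lam) ^ 2)))) +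
    2 * ∫ x in Ω, w x t₀ * (u x t₀ * heatWeight (T - t₀ + lam) x₀ x) = H'
  generalize (∫ x in Ω, ‖gradient (fun y => u y t₀) x‖ ^ 2 * (heatWeight (T - t₀ + lam) x₀ x *
    (n / (2 * (T - t₀ + lam)) - ‖x - x₀‖ ^ 2 / (4 * (T - t₀ + lam) ^ 2)))) -
    2 * ∫ x in Ω, w x t₀ * (driftLap (T - t₀ + lam) x₀ (fun y => u y t₀) x *
      heatWeight (T - t₀ + lam) x₀ x) = D'
  intro hnum hs hq
  have hpos := hH t₀ ht₀
  have hnear : ∀ᶠ t in 𝓝[<] t₀, t ∈ Ioo 0 t₀ := Ioo_mem_nhdsLT ht₀.1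
  have hcont : Tendsto (fun t => Hfun Ω T lam x₀ u t) (𝓝[<] t₀) (𝓝 (Hfun Ω T lam x₀ u t₀)) := by
    have hlin : Tendsto (fun t => t₀ - t) (𝓝[<] t₀) (𝓝 0) := by
      have : ContinuousAt (fun t => t₀ - t) t₀ := by fun_prop
      simpa using this.tendsto.mono_left nhdsWithin_le_nhds
    have := (hlin.mul hs).const_sub (Hfun Ω T lam x₀ u t₀)
    rw [zero_mul, sub_zero] at this
    refine this.congr' ?_
    filter_upwards [hnear] with t ht
    rw [mul_inv_cancel_left₀ (sub_pos.2 ht.2).ne']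
    ring
  have hlim := (((hq.mul_const (Hfun Ω T lam x₀ u t₀)).sub
    (hs.const_mul (Dfun Ω T lam x₀ u t₀))).const_mul 2).div
    (hcont.mul_const (Hfun Ω T lam x₀ u t₀)) (mul_pos hpos hpos).ne'
  have hle := le_of_tendsto_of_tendsto hN.tendsto_backward_slope hlim (by
    filter_upwards [hnear] with t ht
    have htT : t ∈ Ioo 0 T := ⟨ht.1, ht.2.trans ht₀.2⟩
    have hHt := hH t htT
    have hℓ : 0 < t₀ - t := sub_pos.2 ht.2
    have hd := h.Dfun_sub_le hΩ hb hc hlam ht₀ htT (x₀ := x₀)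
    have e : (t₀ - t)⁻¹ * (Nfun Ω T lam x₀ u t₀ - Nfun Ω T lam x₀ u t) =
        2 * ((t₀ - t)⁻¹ * (Dfun Ω T lam x₀ u t₀ - Dfun Ω T lam x₀ u t) * Hfun Ω T lam x₀ u t₀ -
          Dfun Ω T lam x₀ u t₀ *
            ((t₀ - t)⁻¹ * (Hfun Ω T lam x₀ u t₀ - Hfun Ω T lam x₀ u t))) /
          (Hfun Ω T lam x₀ u t * Hfun Ω T lam x₀ u t₀) := by
      rw [Nfun, Nfun]
      field_simp
      ring
    simp only [Pi.div_apply]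
    rw [e]
    gcongr)
  refine hle.trans ?_
  rw [div_le_iff₀ (mul_pos hpos hpos)]
  have e : ((1 / (T - t₀ + lam) + M ^ 2) * Nfun Ω T lam x₀ u t₀ + 2 * M ^ 2) *
      (Hfun Ω T lam x₀ u t₀ * Hfun Ω T lam x₀ u t₀) =
      2 * (Dfun Ω T lam x₀ u t₀ * Hfun Ω T lam x₀ u t₀ / (T - t₀ + lam) +
        M ^ 2 * (Dfun Ω T lam x₀ u t₀ + Hfun Ω T lam x₀ u t₀) * Hfun Ω T lam x₀ u t₀) := by
    rw [Nfun]
    field_simp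
    ring
  linarith

end DirichletSolution
end Frequency

section Reduction

open Set Filter Topology

variable {n : ℕ} {Ω : Set (EuclideanSpace ℝ (Fin n))} {T : ℝ}

theorem indicator_eventuallyEq_of_mem (hΩ : IsOpen Ω) (f : EuclideanSpace ℝ (Fin n) → ℝ)
    {x : EuclideanSpace ℝ (Fin n)} (hx : x ∈ Ω) : Ω.indicator f =ᶠ[𝓝 x] f := by
  filter_upwards [hΩ.mem_nhds hx] with y hy using indicator_of_mem hy f

theorem gradient_indicator (hΩ : IsOpen Ω) (f : EuclideanSpace ℝ (Fin n) → ℝ)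
    {x : EuclideanSpace ℝ (Fin n)} (hx : x ∈ Ω) :
    gradient (Ω.indicator f) x = gradient f x := by
  rw [gradient, gradient, (indicator_eventuallyEq_of_mem hΩ f hx).fderiv_eq]

theorem lap_indicator (hΩ : IsOpen Ω) (f : EuclideanSpace ℝ (Fin n) → ℝ)
    {x : EuclideanSpace ℝ (Fin n)} (hx : x ∈ Ω) : lap (Ω.indicator f) x = lap f x := by
  refine Finset.sum_congr rfl fun i _ => ?_
  rw [Filter.EventuallyEq.fderiv_eq]
  filter_upwards [(indicator_eventuallyEq_of_mem hΩ f hx).fderiv (𝕜 := ℝ)] with y hy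
  rw [hy]

theorem Nfun_indicator (hΩ : IsOpen Ω) (lam : ℝ) (x₀ : EuclideanSpace ℝ (Fin n))
    (u : EuclideanSpace ℝ (Fin n) → ℝ → ℝ) (t : ℝ) :
    Hfun Ω T lam x₀ (fun x s => Ω.indicator (fun y => u y s) x) t = Hfun Ω T lam x₀ u t ∧
      Nfun Ω T lam x₀ (fun x s => Ω.indicator (fun y => u y s) x) t = Nfun Ω T lam x₀ u t := by
  have hH : Hfun Ω T lam x₀ (fun x s => Ω.indicator (fun y => u y s) x) t =
      Hfun Ω T lam x₀ u t :=
    setIntegral_congr_fun hΩ.measurableSet fun x hx => by simp only [indicator_of_mem hx]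
  have hD : Dfun Ω T lam x₀ (fun x s => Ω.indicator (fun y => u y s) x) t =
      Dfun Ω T lam x₀ u t :=
    setIntegral_congr_fun hΩ.measurableSet fun x hx => by
      change ‖gradient (Ω.indicator fun y => u y t) x‖ ^ 2 * _ = _
      rw [gradient_indicator hΩ _ hx]
  exact ⟨hH, by rw [Nfun, Nfun, hH, hD]⟩

theorem DirichletSolution.of_contDiffOn (hΩ : IsOpen Ω) (hb : Bornology.IsBounded Ω)
    (hc : Convex ℝ Ω) {M : ℝ} {u : EuclideanSpace ℝ (Fin n) → ℝ → ℝ}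
    (hx : ∀ t ∈ Icc 0 T, ContDiffOn ℝ 2 (fun x => u x t) (closure Ω))
    (ht : ∀ x ∈ closure Ω, ContDiffOn ℝ 1 (fun s => u x s) (Icc 0 T))
    (h0 : ∀ x ∈ frontier Ω, ∀ t ∈ Icc 0 T, u x t = 0)
    (hu : ∀ x ∈ Ω, ∀ t ∈ Ioc 0 T, |deriv (fun s => u x s) t - lap (fun y => u y t) x| ≤
      M * (‖gradient (fun y => u y t) x‖ + |u x t|)) :
    DirichletSolution Ω T M (fun x t => Ω.indicator (fun y => u y t) x)
      fun x => deriv (u x) where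
  regular t hT := IsDirichletC2.of_contDiffOn hΩ hb hc (hx t (Ioo_subset_Icc_self hT))
    fun x hx => h0 x hx t (Ioo_subset_Icc_self hT)
  hasDerivAt x hxΩ t hT := by
    simp only [indicator_of_mem hxΩ]
    exact (((ht x (subset_closure hxΩ)).contDiffAt (Icc_mem_nhds hT.1 hT.2)).differentiableAt
      one_ne_zero).hasDerivAt
  continuousOn x hxΩ := ((ht x (subset_closure hxΩ)).mono
    Ioo_subset_Icc_self).continuousOn_deriv_of_isOpen isOpen_Ioo le_rfl
  abs_sub_lap_le x hxΩ t hT := by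
    change |deriv (u x) t - lap (Ω.indicator fun y => u y t) x| ≤
      M * (‖gradient (Ω.indicator fun y => u y t) x‖ + |Ω.indicator (fun y => u y t) x|)
    rw [lap_indicator hΩ _ hxΩ, gradient_indicator hΩ _ hxΩ, indicator_of_mem hxΩ]
    exact hu x hxΩ t (Ioo_subset_Ioc_self hT)

theorem Nfun_nonneg {lam t : ℝ} (ht : 0 < T - t + lam) (x₀ : EuclideanSpace ℝ (Fin n))
    (u : EuclideanSpace ℝ (Fin n) → ℝ → ℝ) : 0 ≤ Nfun Ω T lam x₀ u t := by
  have hG : ∀ x, 0 ≤ caloric T lam x₀ x t := fun x => (heatWeight_pos ht x₀ x).le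
  exact div_nonneg (mul_nonneg zero_le_two (integral_nonneg fun x =>
    mul_nonneg (sq_nonneg _) (hG x))) (integral_nonneg fun x => mul_nonneg (sq_nonneg _) (hG x))

end Reduction

/-- inequality (2.18): differential inequality for the frequency function:
there is a constant `C > 0`, depending only on the dimension `n`, with
`N_λ'(t) − (1/(T−t+λ) + C M²) N_λ(t) ≤ C M²` on `(0,T)`. -/
theorem frequency_differential_inequality
    {n : ℕ} (hn : 1 ≤ n) :
    ∃ C > (0:ℝ),
      ∀ (Ω : Set (EuclideanSpace ℝ (Fin n))),
        IsOpen Ω → Bornology.IsBounded Ω → Convex ℝ Ω →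
      ∀ (T M lam : ℝ), 0 < T → 0 < M → 0 < lam →
      ∀ x₀ ∈ Ω, ∀ (u : EuclideanSpace ℝ (Fin n) → ℝ → ℝ),
        -- regularity up to the closure: `C²` in `x`, `C¹` in `t`
        (∀ t ∈ Set.Icc (0:ℝ) T, ContDiffOn ℝ 2 (fun x => u x t) (closure Ω)) →
        (∀ x ∈ closure Ω, ContDiffOn ℝ 1 (fun s => u x s) (Set.Icc (0:ℝ) T)) →
        -- homogeneous Dirichlet boundary condition
        (∀ x ∈ frontier Ω, ∀ t ∈ Set.Icc (0:ℝ) T, u x t = 0) →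
        -- the parabolic differential inequality on `Ω × (0,T]`
        (∀ x ∈ Ω, ∀ t ∈ Set.Ioc (0:ℝ) T,
          |deriv (fun s => u x s) t - lap (fun y => u y t) x| ≤
            M * (‖gradient (fun y => u y t) x‖ + |u x t|)) →
        -- positivity of `H_λ` on `(0,T)`
        (∀ t ∈ Set.Ioo (0:ℝ) T, 0 < Hfun Ω T lam x₀ u t) →
        ∀ t ∈ Set.Ioo (0:ℝ) T,
          deriv (fun s => Nfun Ω T lam x₀ u s) t -
            (1 / (T - t + lam) + C * M^2) * Nfun Ω T lam x₀ u t ≤ C * M^2 := by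
  refine ⟨2, two_pos, fun Ω hΩ hb hc T M lam _ hM hlam x₀ hx₀ u hx ht h0 hu hH t hT => ?_⟩
  have hθ : 0 < T - t + lam := by linarith [hT.2]
  have hN := Nfun_nonneg (Ω := Ω) hθ x₀ u
  have hMN : 0 ≤ M ^ 2 * Nfun Ω T lam x₀ u t := mul_nonneg (sq_nonneg M) hN
  have hθN : 0 ≤ 1 / (T - t + lam) * Nfun Ω T lam x₀ u t :=
    mul_nonneg (one_div_nonneg.2 hθ.le) hN
  by_cases hd : DifferentiableAt ℝ (fun s => Nfun Ω T lam x₀ u s) t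
  · have key := (DirichletSolution.of_contDiffOn hΩ hb hc hx ht h0 hu).hasDerivAt_Nfun_le hΩ hb hc
      hM.le hlam hx₀ (fun s hs => (Nfun_indicator hΩ lam x₀ u s).1.symm ▸ hH s hs) hT
      (hd.hasDerivAt.congr_of_eventuallyEq
        (Filter.Eventually.of_forall fun s => (Nfun_indicator hΩ lam x₀ u s).2))
    rw [(Nfun_indicator hΩ lam x₀ u t).2] at key
    linarith
  · rw [deriv_zero_of_not_differentiableAt hd]
    linarith [sq_nonneg M]
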